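/- Let N(T) denote the number of zeros ρ = β + iγ of Riemann's auxiliary function R with 0 < γ ≤ T, counted with multiplicity. Then there exist constants C > 0 and T₀ > 0 such that for all T ≥ T₀, | N(T) − ( (T/4π) log(T/2π) − T/4π − (1/2)√(T/2π) ) | ≤ C · T^{2/5} (log T)². -/

import Mathlib

open MeasureTheory

/-- The straight line of slope 1 crossing the real axis at `1/2`,
parametrized from upper right to lower left. -/
noncomputable def rline (u : ℝ) : ℂ :=
  1 / 2 - Complex.exp (Real.pi * Complex.I / 4) * (u : ℂ)

/-- Riemann's auxiliary function
`R(s) = ∫_{0↙1} x^{-s} e^{πix²}/(e^{πix} − e^{-πix}) dx`, written out as an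
integral over the real parameter of the line `0↙1`. Here `z ^ (-s)` is the
principal power `exp (−s Log z)`. -/
noncomputable def RiemannR (s : ℂ) : ℂ :=
  -Complex.exp (Real.pi * Complex.I / 4) *
    ∫ u : ℝ, (rline u) ^ (-s) *
      Complex.exp (Real.pi * Complex.I * (rline u) ^ 2) /
      (Complex.exp (Real.pi * Complex.I * rline u) -
        Complex.exp (-(Real.pi * Complex.I * rline u)))

namespace RZ
open Complex Filter Topology Set

/-- Truncated contour shift between two horizontal lines. -/
theorem hshift_trunc (g : ℂ → ℂ) (y1 y2 : ℝ) (h12 : y1 ≤ y2)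
    (Hc : ContinuousOn g {z | y1 ≤ z.im ∧ z.im ≤ y2})
    (Hd : ∀ z : ℂ, y1 < z.im → z.im < y2 → DifferentiableAt ℂ g z)
    (B : ℝ → ℝ) (hB1 : Tendsto B atTop (𝓝 0)) (hB2 : Tendsto B atBot (𝓝 0)) (X0 : ℝ)
    (hB : ∀ x y : ℝ, X0 ≤ |x| → y1 ≤ y → y ≤ y2 → ‖g (x + y * I)‖ ≤ B x) :
    Tendsto (fun X : ℝ => (∫ x in (-X)..X, g (x + y1 * I)) - ∫ x in (-X)..X, g (x + y2 * I))
      atTop (𝓝 0) := by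
  have hkey : ∀ X : ℝ, 0 ≤ X → (∫ x in (-X)..X, g (x + y1 * I)) - ∫ x in (-X)..X, g (x + y2 * I)
      = I • (∫ y in y1..y2, g ((-X : ℝ) + y * I)) - I • (∫ y in y1..y2, g (X + y * I)) := by
    intro X hX
    have := integral_boundary_rect_eq_zero_of_continuousOn_of_differentiableOn g
      (⟨-X, y1⟩ : ℂ) (⟨X, y2⟩ : ℂ) ?_ ?_
    · simp only at this
      rw [sub_eq_zero] at this
      rw [← this]; ring
    · apply Hc.mono
      intro z hz
      have := hz.2
      simp only [mem_preimage, uIcc_of_le h12, mem_Icc] at this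
      exact this
    · intro z hz
      have := hz.2
      simp only [mem_preimage, min_eq_left h12, max_eq_right h12, mem_Ioo] at this
      exact (Hd z this.1 this.2).differentiableWithinAt
  have hb : ∀ x : ℝ, X0 ≤ |x| → ‖∫ y in y1..y2, g (x + y * I)‖ ≤ B x * |y2 - y1| := by
    intro x hx
    apply intervalIntegral.norm_integral_le_of_norm_le_const
    intro y hy
    rw [uIoc_of_le h12] at hy
    exact hB x y hx hy.1.le hy.2
  have t1 : Tendsto (fun X : ℝ => B (-X) * |y2 - y1| + B X * |y2 - y1|) atTop (𝓝 0) := by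
    have a1 := (hB2.comp tendsto_neg_atTop_atBot).mul_const |y2 - y1|
    have a2 := hB1.mul_const |y2 - y1|
    simpa using a1.add a2
  apply squeeze_zero_norm' _ t1
  filter_upwards [eventually_ge_atTop (max X0 0)] with X hX
  have hX0 : X0 ≤ X := le_trans (le_max_left _ _) hX
  have hX1 : 0 ≤ X := le_trans (le_max_right _ _) hX
  rw [hkey X hX1]
  refine (norm_sub_le _ _).trans ?_
  rw [norm_smul, norm_smul, norm_I, one_mul, one_mul]
  apply add_le_add
  · exact hb (-X) (by rw [abs_neg, abs_of_nonneg hX1]; exact hX0)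
  · exact hb X (by rw [abs_of_nonneg hX1]; exact hX0)

theorem hshift (g : ℂ → ℂ) (y1 y2 : ℝ) (h12 : y1 ≤ y2)
    (Hc : ContinuousOn g {z | y1 ≤ z.im ∧ z.im ≤ y2})
    (Hd : ∀ z : ℂ, y1 < z.im → z.im < y2 → DifferentiableAt ℂ g z)
    (B : ℝ → ℝ) (hB1 : Tendsto B atTop (𝓝 0)) (hB2 : Tendsto B atBot (𝓝 0)) (X0 : ℝ)
    (hB : ∀ x y : ℝ, X0 ≤ |x| → y1 ≤ y → y ≤ y2 → ‖g (x + y * I)‖ ≤ B x)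
    (hi1 : Integrable fun x : ℝ => g (x + y1 * I)) (hi2 : Integrable fun x : ℝ => g (x + y2 * I)) :
    ∫ x : ℝ, g (x + y1 * I) = ∫ x : ℝ, g (x + y2 * I) := by
  have h0 := hshift_trunc g y1 y2 h12 Hc Hd B hB1 hB2 X0 hB
  have h1 := intervalIntegral_tendsto_integral hi1 tendsto_neg_atTop_atBot tendsto_id
  have h2 := intervalIntegral_tendsto_integral hi2 tendsto_neg_atTop_atBot tendsto_id
  have := tendsto_nhds_unique h0 (h1.sub h2)
  exact (sub_eq_zero.mp this.symm)

theorem integral_pole_diff (c d : ℝ) (hc : 0 < c) (hd : 0 < d) :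
    Tendsto (fun X : ℝ => (∫ x in (-X)..X, (1 : ℂ) / (x - c * I)) -
      ∫ x in (-X)..X, (1 : ℂ) / (x + d * I)) atTop (𝓝 (2 * Real.pi * I)) := by
  have key : ∀ e : ℝ, e ≠ 0 → ∀ X : ℝ, 
      (∫ x in (-X)..X, (1 : ℂ) / (x + e * I)) = -(2 * Real.arctan (X / e) : ℝ) * I := by
    intro e he X
    have hne : ∀ x : ℝ, (x : ℂ) + e * I ≠ 0 := by
      intro x h
      have := congrArg Complex.im h
      simp at this; exact he this
    have hpos : ∀ x : ℝ, x ^ 2 + e ^ 2 ≠ 0 := fun x => by positivity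
    have e1 : ∀ x : ℝ, (1 : ℂ) / (x + e * I) = ((x / (x ^ 2 + e ^ 2) : ℝ) : ℂ) -
        ((e / (x ^ 2 + e ^ 2) : ℝ) : ℂ) * I := by
      intro x
      have h1 : ((x : ℂ) ^ 2 + (e : ℂ) ^ 2) ≠ 0 := by exact_mod_cast hpos x
      push_cast
      rw [div_eq_iff (hne x)]
      field_simp
      linear_combination ((e:ℂ)^2) * I_sq
    simp_rw [e1]
    have c1 : Continuous fun x : ℝ => x / (x ^ 2 + e ^ 2) := by fun_prop (disch := exact hpos _)
    have c2 : Continuous fun x : ℝ => e / (x ^ 2 + e ^ 2) := by fun_prop (disch := exact hpos _)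
    rw [intervalIntegral.integral_sub, intervalIntegral.integral_mul_const,
      intervalIntegral.integral_ofReal, intervalIntegral.integral_ofReal]
    · have i1 : ∫ x in (-X)..X, x / (x ^ 2 + e ^ 2) = 0 := by
        have := intervalIntegral.integral_comp_neg (a := -X) (b := X) (fun x => x / (x ^ 2 + e ^ 2))
        simp only [neg_neg, neg_div, neg_sq, intervalIntegral.integral_neg] at this
        linarith
      have i2 : ∫ x in (-X)..X, e / (x ^ 2 + e ^ 2) = 2 * Real.arctan (X / e) := by
        rw [intervalIntegral.integral_eq_sub_of_hasDerivAt (f := fun x => Real.arctan (x / e))]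
        · rw [neg_div, Real.arctan_neg]; ring
        · intro x _
          refine ((hasDerivAt_id x).div_const e).arctan.congr_deriv ?_
          have := hpos x
          have h3 : 1 + (x/e)^2 ≠ 0 := by positivity
          show 1 / (1 + (x / e) ^ 2) * (1 / e) = e / (x ^ 2 + e ^ 2)
          field_simp
          ring
        · exact c2.intervalIntegrable _ _
      rw [i1, i2]; push_cast; ring
    · exact (continuous_ofReal.comp c1).intervalIntegrable _ _
    · exact ((continuous_ofReal.comp c2).mul continuous_const).intervalIntegrable _ _
  have k1 : ∀ X : ℝ, (∫ x in (-X)..X, (1 : ℂ) / (x - c * I)) = (2 * Real.arctan (X / c) : ℝ) * I := by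
    intro X
    have := key (-c) (by linarith) X
    rw [div_neg, Real.arctan_neg] at this
    push_cast at this ⊢
    simp only [neg_mul, mul_neg, neg_neg, ← sub_eq_add_neg] at this
    exact this
  have lim : ∀ e : ℝ, 0 < e → Tendsto (fun X : ℝ => Real.arctan (X / e)) atTop (𝓝 (Real.pi / 2)) := by
    intro e he
    exact (tendsto_nhds_of_tendsto_nhdsWithin Real.tendsto_arctan_atTop).comp
      (tendsto_id.atTop_div_const he)
  simp_rw [k1, key d hd.ne']
  have l := (((lim c hc).const_mul 2).add ((lim d hd).const_mul 2))
  have l2 := ((continuous_ofReal.tendsto _).comp l).mul_const I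
  convert l2 using 1
  · ext X; simp only [Function.comp]; push_cast; ring
  · push_cast; ring_nf

theorem hshift_res (g h : ℂ → ℂ) (y1 y2 : ℝ) (w r : ℂ) (hw1 : y1 < w.im) (hw2 : w.im < y2)
    (hw0 : w.re = 0)
    (Hc : ContinuousOn h {z | y1 ≤ z.im ∧ z.im ≤ y2})
    (Hd : ∀ z : ℂ, y1 < z.im → z.im < y2 → DifferentiableAt ℂ h z)
    (hg : ∀ z, z ≠ w → y1 ≤ z.im → z.im ≤ y2 → g z = h z + r / (z - w))
    (B : ℝ → ℝ) (hB1 : Tendsto B atTop (𝓝 0)) (hB2 : Tendsto B atBot (𝓝 0)) (X0 : ℝ)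
    (hB : ∀ x y : ℝ, X0 ≤ |x| → y1 ≤ y → y ≤ y2 → ‖g (x + y * I)‖ ≤ B x)
    (hi1 : Integrable fun x : ℝ => g (x + y1 * I)) (hi2 : Integrable fun x : ℝ => g (x + y2 * I)) :
    (∫ x : ℝ, g (x + y1 * I)) - ∫ x : ℝ, g (x + y2 * I) = 2 * Real.pi * I * r := by
  have h0 := hshift_trunc h y1 y2 (by linarith) Hc Hd (fun x => B x + ‖r‖ / |x|)
    (by simpa using hB1.add (tendsto_abs_atTop_atTop.const_div_atTop ‖r‖))
    (by simpa using hB2.add (tendsto_abs_atBot_atTop.const_div_atTop ‖r‖)) (max X0 1) ?_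
  · have h1 := intervalIntegral_tendsto_integral hi1 tendsto_neg_atTop_atBot tendsto_id
    have h2 := intervalIntegral_tendsto_integral hi2 tendsto_neg_atTop_atBot tendsto_id
    have h3 := (integral_pole_diff (w.im - y1) (y2 - w.im) (by linarith) (by linarith)).const_mul r
    have h4 := (h1.sub h2).sub h3
    have hwe : w = w.im * I := by
      apply Complex.ext <;> simp [hw0]
    have cc : ∀ y : ℝ, y ≠ w.im → ∀ X:ℝ, IntervalIntegrable (fun x : ℝ => r * (1 / ((x:ℂ) + y * I - w))) volume (-X) X := by
      intro y hy X
      apply Continuous.intervalIntegrable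
      have : ∀ x : ℝ, (x:ℂ) + y * I - w ≠ 0 := by
        intro x h
        have := congrArg Complex.im h
        simp at this
        exact hy (by linarith)
      fun_prop (disch := exact this _)
    have h5 : Tendsto (fun X : ℝ => (∫ x in (-X)..X, h (x + y1 * I)) - ∫ x in (-X)..X, h (x + y2 * I))
      atTop (𝓝 ((∫ x : ℝ, g (x + y1 * I)) - (∫ x : ℝ, g (x + y2 * I)) - r * (2 * Real.pi * I))) := by
      refine h4.congr ?_
      intro X
      have eq : ∀ y : ℝ, y ≠ w.im → y1 ≤ y → y ≤ y2 →
          ∀ x : ℝ, h (x + y * I) = g (x + y * I) - r * (1 / ((x:ℂ) + y * I - w)) := by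
        intro y hy ha hb x
        rw [hg]
        · ring
        · intro h
          have := congrArg Complex.im h
          simp at this
          exact hy this
        · simpa using ha
        · simpa using hb
      simp_rw [eq y1 hw1.ne le_rfl (by linarith), eq y2 hw2.ne' (by linarith) le_rfl]
      rw [intervalIntegral.integral_sub hi1.intervalIntegrable (cc y1 hw1.ne X),
        intervalIntegral.integral_sub hi2.intervalIntegrable (cc y2 hw2.ne' X),
        intervalIntegral.integral_const_mul, intervalIntegral.integral_const_mul]
      have e1 : ∀ x : ℝ, (x:ℂ) + y1 * I - w = x - ((w.im - y1 : ℝ) : ℂ) * I := by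
        intro x; rw [hwe]; push_cast; simp; ring
      have e2 : ∀ x : ℝ, (x:ℂ) + y2 * I - w = x + ((y2 - w.im : ℝ) : ℂ) * I := by
        intro x; rw [hwe]; push_cast; simp; ring
      simp_rw [e1, e2]
      simp only [id]
      ring
    have := tendsto_nhds_unique h0 h5
    linear_combination -this
  · intro x y hx hy1 hy2
    have hx1 : 1 ≤ |x| := le_trans (le_max_right _ _) hx
    have hne : (x : ℂ) + y * I ≠ w := by
      intro h
      have := congrArg Complex.re h
      simp [hw0] at this
      simp [this] at hx1; linarith
    have := hg (x + y * I) hne (by simpa using hy1) (by simpa using hy2)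
    have e : h (x + y * I) = g (x + y * I) - r / (x + y * I - w) := by rw [this]; ring
    rw [e]
    refine (norm_sub_le _ _).trans (add_le_add (hB x y (le_trans (le_max_left _ _) hx) hy1 hy2) ?_)
    rw [norm_div]
    apply div_le_div_of_nonneg_left (norm_nonneg _) (by linarith)
    have := abs_re_le_norm ((x:ℂ) + y * I - w)
    simpa [hw0] using this

end RZ

namespace RZ
open Complex Filter Topology Set

/-- The multiplicity condition. -/
def MultAt (f : ℂ → ℂ) (ρ : ℂ) (n : ℕ) : Prop :=
  ∃ g : ℂ → ℂ, AnalyticAt ℂ g ρ ∧ g ρ ≠ 0 ∧ ∀ᶠ s in 𝓝 ρ, f s = (s - ρ) ^ n * g s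

theorem finite_zeros (f : ℂ → ℂ) (hf : Differentiable ℂ f) (c : ℂ) (hc : f c ≠ 0)
    (K : Set ℂ) (hK : IsCompact K) : {z | z ∈ K ∧ f z = 0}.Finite := by
  by_contra hinf
  have hinf : {z | z ∈ K ∧ f z = 0}.Infinite := hinf
  obtain ⟨z, hz, hacc⟩ := hinf.exists_accPt_of_subset_isCompact hK (fun z hz => hz.1)
  have ha : AnalyticOnNhd ℂ f univ := fun z _ => hf.analyticAt z
  have := ha.eqOn_zero_of_preconnected_of_frequently_eq_zero isPreconnected_univ (mem_univ z) ?_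
  · exact hc (this (mem_univ c))
  · rw [accPt_iff_frequently_nhdsNE] at hacc
    exact hacc.mono fun y hy => hy.2

theorem factor_one (f : ℂ → ℂ) (hf : Differentiable ℂ f) (ρ : ℂ) (n : ℕ) (h : MultAt f ρ n) :
    ∃ G : ℂ → ℂ, Differentiable ℂ G ∧ (∀ z, f z = (z - ρ) ^ n * G z) ∧ G ρ ≠ 0 := by
  obtain ⟨g, hg, hg0, hfg⟩ := h
  classical
  refine ⟨fun z => if z = ρ then g ρ else f z / (z - ρ) ^ n, ?_, ?_, ?_⟩
  · intro z
    by_cases hz : z = ρ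
    · subst hz
      apply hg.differentiableAt.congr_of_eventuallyEq
      filter_upwards [hfg] with w hw
      by_cases hwz : w = z
      · simp [hwz]
      · have : (w - z) ^ n ≠ 0 := pow_ne_zero _ (sub_ne_zero.mpr hwz)
        simp only [hwz, if_false, hw]
        field_simp
    · have hd : DifferentiableAt ℂ (fun z => f z / (z - ρ) ^ n) z := by
        apply (hf z).div (by fun_prop)
        exact pow_ne_zero _ (sub_ne_zero.mpr hz)
      apply hd.congr_of_eventuallyEq
      filter_upwards [isOpen_ne.mem_nhds hz] with w hw
      have hw' : w ≠ ρ := hw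
      simp [hw']
  · intro z
    by_cases hz : z = ρ
    · subst hz
      simpa using hfg.self_of_nhds
    · have : (z - ρ) ^ n ≠ 0 := pow_ne_zero _ (sub_ne_zero.mpr hz)
      simp only [hz, if_false]
      field_simp
  · simpa using hg0

theorem exists_factor (f : ℂ → ℂ) (hf : Differentiable ℂ f) (m : ℂ → ℕ) (S : Finset ℂ)
    (hm : ∀ ρ ∈ S, MultAt f ρ (m ρ)) :
    ∃ G : ℂ → ℂ, Differentiable ℂ G ∧ (∀ z, f z = (∏ ρ ∈ S, (z - ρ) ^ m ρ) * G z) ∧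
      ∀ ρ ∈ S, G ρ ≠ 0 := by
  classical
  induction S using Finset.induction_on with
  | empty => exact ⟨f, hf, by simp, by simp⟩
  | insert a S ha ih =>
    obtain ⟨G, hG, hfG, hGS⟩ := ih (fun ρ hρ => hm ρ (Finset.mem_insert_of_mem hρ))
    have hP : (∏ ρ ∈ S, (a - ρ) ^ m ρ) ≠ 0 := by
      rw [Finset.prod_ne_zero_iff]
      intro ρ hρ
      apply pow_ne_zero
      rw [sub_ne_zero]
      rintro rfl
      exact ha hρ
    have hPd : Differentiable ℂ fun z : ℂ => ∏ ρ ∈ S, (z - ρ) ^ m ρ := by fun_prop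
    have hmG : MultAt G a (m a) := by
      obtain ⟨g, hg, hg0, hfg⟩ := hm a (Finset.mem_insert_self _ _)
      refine ⟨fun z => g z / ∏ ρ ∈ S, (z - ρ) ^ m ρ, hg.div (hPd.analyticAt a) hP,
        div_ne_zero hg0 hP, ?_⟩
      filter_upwards [hfg, (hPd.continuous.continuousAt (x := a)).eventually_ne hP] with z hz hz2
      have h1 := hfG z
      rw [hz] at h1
      rw [← mul_div_assoc, h1]
      field_simp
    obtain ⟨G1, hG1, hGG1, hG10⟩ := factor_one G hG a (m a) hmG
    refine ⟨G1, hG1, ?_, ?_⟩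
    · intro z
      rw [hfG z, hGG1 z, Finset.prod_insert ha]
      ring
    · intro ρ hρ
      rw [Finset.mem_insert] at hρ
      rcases hρ with rfl | hρ
      · exact hG10
      · have := hGS ρ hρ
        rw [hGG1] at this
        exact right_ne_zero_of_mul this

theorem logDeriv_factor (f G : ℂ → ℂ) (hG : Differentiable ℂ G) (m : ℂ → ℕ) (S : Finset ℂ)
    (hfG : ∀ z, f z = (∏ ρ ∈ S, (z - ρ) ^ m ρ) * G z) (z : ℂ) (hz : f z ≠ 0) :
    logDeriv f z = (∑ ρ ∈ S, (m ρ : ℂ) * (1 / (z - ρ))) + logDeriv G z := by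
  have hf : f = fun z => (∏ ρ ∈ S, (z - ρ) ^ m ρ) * G z := funext hfG
  have h0 := hz
  rw [hfG z] at h0
  have hP := left_ne_zero_of_mul h0
  have hG0 := right_ne_zero_of_mul h0
  rw [hf, logDeriv_mul z hP hG0 (by fun_prop) (hG z)]
  congr 1
  rw [Finset.prod_ne_zero_iff] at hP
  rw [logDeriv_prod (f := fun ρ z => (z - ρ) ^ m ρ) (hf := hP) (hd := by intro i _; fun_prop)]
  apply Finset.sum_congr rfl
  intro ρ hρ
  rw [logDeriv_fun_pow (by fun_prop)]
  rw [logDeriv_apply]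
  congr 2
  simp

theorem int_pole_horiz (x1 x2 e : ℝ) (he : e ≠ 0) :
    (∫ x in x1..x2, (1 : ℂ) / (x + e * I)).im = -(Real.arctan (x2 / e) - Real.arctan (x1 / e)) := by
  have hpos : ∀ x : ℝ, x ^ 2 + e ^ 2 ≠ 0 := fun x => by positivity
  have hne : ∀ x : ℝ, (x : ℂ) + e * I ≠ 0 := by
    intro x h
    have := congrArg Complex.im h
    simp at this; exact he this
  have hcont : Continuous fun x : ℝ => (1 : ℂ) / (x + e * I) := by fun_prop (disch := exact hne _)
  have h1 : (∫ x in x1..x2, (1 : ℂ) / (x + e * I)).im = ∫ x in x1..x2, ((1 : ℂ) / (x + e * I)).im := by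
    have := (imCLM.intervalIntegral_comp_comm (hcont.intervalIntegrable x1 x2) (μ := volume))
    simpa using this.symm
  rw [h1]
  rw [intervalIntegral.integral_eq_sub_of_hasDerivAt (f := fun x => -Real.arctan (x / e))]
  · ring
  · intro x _
    refine ((hasDerivAt_id x).div_const e).arctan.neg.congr_deriv ?_
    have := hpos x
    have h3 : 1 + (x/e)^2 ≠ 0 := by positivity
    show -(1 / (1 + (x / e) ^ 2) * (1 / e)) = _
    rw [Complex.div_im]
    simp [Complex.normSq_apply]
    field_simp
    ring_nf
  · exact (continuous_im.comp hcont).intervalIntegrable _ _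

theorem int_pole_vert (y1 y2 e : ℝ) (he : e ≠ 0) :
    (I • ∫ y in y1..y2, (1 : ℂ) / (e + y * I)).im = (Real.arctan (y2 / e) - Real.arctan (y1 / e)) := by
  have hne : ∀ x : ℝ, (x : ℂ) + (-e : ℝ) * I ≠ 0 := by
    intro x h
    have := congrArg Complex.im h
    simp at this; exact he this
  have hne2 : ∀ x : ℝ, (e : ℂ) + x * I ≠ 0 := by
    intro x h
    have := congrArg Complex.re h
    simp at this; exact he this
  have : ∀ y : ℝ, I * ((1 : ℂ) / (e + y * I)) = 1 / (y + (-e : ℝ) * I) := by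
    intro y
    have h1 := hne y
    have h2 := hne2 y
    rw [← mul_div_assoc, mul_one, div_eq_div_iff h2 h1]
    push_cast
    linear_combination (-(e:ℂ)) * I_sq
  rw [smul_eq_mul, ← intervalIntegral.integral_const_mul]
  simp_rw [this]
  rw [int_pole_horiz _ _ _ (neg_ne_zero.mpr he), div_neg, div_neg, Real.arctan_neg, Real.arctan_neg]
  ring

/-- boundary functional of a rectangle -/
noncomputable def rectInt (u : ℂ → ℂ) (x1 x2 y1 y2 : ℝ) : ℂ :=
  (∫ x : ℝ in x1..x2, u (x + y1 * I)) - (∫ x : ℝ in x1..x2, u (x + y2 * I)) +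
    I • (∫ y : ℝ in y1..y2, u (x2 + y * I)) - I • (∫ y : ℝ in y1..y2, u (x1 + y * I))

theorem rectInt_pole (x1 x2 y1 y2 : ℝ) (ρ : ℂ) (hx1 : x1 < ρ.re) (hx2 : ρ.re < x2)
    (hy1 : y1 < ρ.im) (hy2 : ρ.im < y2) :
    (rectInt (fun z => 1 / (z - ρ)) x1 x2 y1 y2).im = 2 * Real.pi := by
  have e1 : ∀ y : ℝ, ∀ x : ℝ, (1 : ℂ) / (x + y * I - ρ) =
      1 / (((x - ρ.re : ℝ) : ℂ) + ((y - ρ.im : ℝ) : ℂ) * I) := by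
    intro y x
    congr 1
    apply Complex.ext <;> simp
  have H : ∀ y : ℝ, y ≠ ρ.im → (∫ x : ℝ in x1..x2, (1 : ℂ) / (x + y * I - ρ)).im
      = -(Real.arctan ((x2 - ρ.re) / (y - ρ.im)) - Real.arctan ((x1 - ρ.re) / (y - ρ.im))) := by
    intro y hy
    simp_rw [e1]
    rw [intervalIntegral.integral_comp_sub_right
      (fun x : ℝ => (1 : ℂ) / ((x : ℂ) + ((y - ρ.im : ℝ) : ℂ) * I)) ρ.re]
    exact int_pole_horiz _ _ _ (sub_ne_zero.mpr hy)
  have V : ∀ x : ℝ, x ≠ ρ.re → (I • ∫ y : ℝ in y1..y2, (1 : ℂ) / (x + y * I - ρ)).im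
      = (Real.arctan ((y2 - ρ.im) / (x - ρ.re)) - Real.arctan ((y1 - ρ.im) / (x - ρ.re))) := by
    intro x hx
    simp_rw [e1]
    rw [intervalIntegral.integral_comp_sub_right
      (fun y : ℝ => (1 : ℂ) / (((x - ρ.re : ℝ) : ℂ) + (y : ℂ) * I)) ρ.im]
    exact int_pole_vert _ _ _ (sub_ne_zero.mpr hx)
  unfold rectInt
  rw [Complex.sub_im, Complex.add_im, Complex.sub_im, H y1 hy1.ne, H y2 hy2.ne', V x1 hx1.ne,
    V x2 hx2.ne']
  have inv : ∀ a b : ℝ, 0 < a → 0 < b → Real.arctan (a / b) = Real.pi / 2 - Real.arctan (b / a) := by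
    intro a b ha hb
    rw [← Real.arctan_inv_of_pos (by positivity), inv_div]
  have n1 : ∀ a b : ℝ, Real.arctan (a / b) = -Real.arctan ((-a) / b) := by
    intro a b; rw [neg_div, Real.arctan_neg]; ring
  have n2 : ∀ a b : ℝ, Real.arctan (a / b) = -Real.arctan (a / (-b)) := by
    intro a b; rw [div_neg, Real.arctan_neg]; ring
  rw [n2 (x2 - ρ.re) (y1 - ρ.im), n2 (x1 - ρ.re) (y1 - ρ.im), n1 (x1 - ρ.re) (y2 - ρ.im),
    n1 (x1 - ρ.re) (-(y1 - ρ.im)), n1 (y1 - ρ.im) (x2 - ρ.re), n2 (y2 - ρ.im) (x1 - ρ.re),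
    n1 (y1 - ρ.im) (x1 - ρ.re), n2 (-(y1 - ρ.im)) (x1 - ρ.re)]
  rw [inv (x2 - ρ.re) (y2 - ρ.im) (by linarith) (by linarith),
    inv (x2 - ρ.re) (-(y1 - ρ.im)) (by linarith) (by linarith),
    inv (-(x1 - ρ.re)) (y2 - ρ.im) (by linarith) (by linarith),
    inv (-(x1 - ρ.re)) (-(y1 - ρ.im)) (by linarith) (by linarith)]
  ring

end RZ

namespace RZ
open Complex Filter Topology Set

theorem rectInt_congr (u v : ℂ → ℂ) (x1 x2 y1 y2 : ℝ) (hx : x1 ≤ x2) (hy : y1 ≤ y2)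
    (h : ∀ x y : ℝ, x1 ≤ x → x ≤ x2 → y1 ≤ y → y ≤ y2 → (x = x1 ∨ x = x2 ∨ y = y1 ∨ y = y2) →
      u (x + y * I) = v (x + y * I)) :
    rectInt u x1 x2 y1 y2 = rectInt v x1 x2 y1 y2 := by
  unfold rectInt
  congr 1
  · congr 1
    · congr 1
      · apply intervalIntegral.integral_congr
        intro x hx'
        rw [uIcc_of_le hx] at hx'
        exact h x y1 hx'.1 hx'.2 le_rfl hy (by tauto)
      · apply intervalIntegral.integral_congr
        intro x hx'
        rw [uIcc_of_le hx] at hx'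
        exact h x y2 hx'.1 hx'.2 hy le_rfl (by tauto)
    · congr 1
      apply intervalIntegral.integral_congr
      intro y hy'
      rw [uIcc_of_le hy] at hy'
      exact h x2 y hx le_rfl hy'.1 hy'.2 (by tauto)
  · congr 1
    apply intervalIntegral.integral_congr
    intro y hy'
    rw [uIcc_of_le hy] at hy'
    exact h x1 y le_rfl hx hy'.1 hy'.2 (by tauto)

/-- integrability of a function along the four sides -/
def RectII (u : ℂ → ℂ) (x1 x2 y1 y2 : ℝ) : Prop :=
  IntervalIntegrable (fun x : ℝ => u (x + y1 * I)) volume x1 x2 ∧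
  IntervalIntegrable (fun x : ℝ => u (x + y2 * I)) volume x1 x2 ∧
  IntervalIntegrable (fun y : ℝ => u (x1 + y * I)) volume y1 y2 ∧
  IntervalIntegrable (fun y : ℝ => u (x2 + y * I)) volume y1 y2

theorem RectII.add {u v : ℂ → ℂ} {x1 x2 y1 y2 : ℝ} (hu : RectII u x1 x2 y1 y2)
    (hv : RectII v x1 x2 y1 y2) : RectII (fun z => u z + v z) x1 x2 y1 y2 :=
  ⟨hu.1.add hv.1, hu.2.1.add hv.2.1, hu.2.2.1.add hv.2.2.1, hu.2.2.2.add hv.2.2.2⟩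

theorem RectII.const_mul {u : ℂ → ℂ} {x1 x2 y1 y2 : ℝ} (hu : RectII u x1 x2 y1 y2) (c : ℂ) :
    RectII (fun z => c * u z) x1 x2 y1 y2 :=
  ⟨hu.1.const_mul c, hu.2.1.const_mul c, hu.2.2.1.const_mul c, hu.2.2.2.const_mul c⟩

theorem rectInt_add {u v : ℂ → ℂ} {x1 x2 y1 y2 : ℝ} (hu : RectII u x1 x2 y1 y2)
    (hv : RectII v x1 x2 y1 y2) :
    rectInt (fun z => u z + v z) x1 x2 y1 y2 = rectInt u x1 x2 y1 y2 + rectInt v x1 x2 y1 y2 := by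
  unfold rectInt
  rw [intervalIntegral.integral_add hu.1 hv.1, intervalIntegral.integral_add hu.2.1 hv.2.1,
    intervalIntegral.integral_add hu.2.2.1 hv.2.2.1, intervalIntegral.integral_add hu.2.2.2 hv.2.2.2]
  simp only [smul_eq_mul]
  ring

theorem rectInt_const_mul (u : ℂ → ℂ) (x1 x2 y1 y2 : ℝ) (c : ℂ) :
    rectInt (fun z => c * u z) x1 x2 y1 y2 = c * rectInt u x1 x2 y1 y2 := by
  unfold rectInt
  simp only [intervalIntegral.integral_const_mul, smul_eq_mul]
  ring

theorem rectII_of_cont (u : ℂ → ℂ) (x1 x2 y1 y2 : ℝ) (hx : x1 ≤ x2) (hy : y1 ≤ y2)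
    (h : ∀ x y : ℝ, x1 ≤ x → x ≤ x2 → y1 ≤ y → y ≤ y2 → (x = x1 ∨ x = x2 ∨ y = y1 ∨ y = y2) →
      ContinuousAt u (x + y * I)) : RectII u x1 x2 y1 y2 := by
  refine ⟨?_, ?_, ?_, ?_⟩ <;> apply ContinuousOn.intervalIntegrable <;> intro w hw
  · rw [uIcc_of_le hx] at hw
    exact (ContinuousAt.comp (f := fun x : ℝ => (x : ℂ) + y1 * I) (h w y1 hw.1 hw.2 le_rfl hy (by tauto))
      (by fun_prop)).continuousWithinAt
  · rw [uIcc_of_le hx] at hw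
    exact (ContinuousAt.comp (f := fun x : ℝ => (x : ℂ) + y2 * I) (h w y2 hw.1 hw.2 hy le_rfl (by tauto))
      (by fun_prop)).continuousWithinAt
  · rw [uIcc_of_le hy] at hw
    exact (ContinuousAt.comp (f := fun x : ℝ => (x1 : ℂ) + x * I) (h x1 w le_rfl hx hw.1 hw.2 (by tauto))
      (by fun_prop)).continuousWithinAt
  · rw [uIcc_of_le hy] at hw
    exact (ContinuousAt.comp (f := fun x : ℝ => (x2 : ℂ) + x * I) (h x2 w hx le_rfl hw.1 hw.2 (by tauto))
      (by fun_prop)).continuousWithinAt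

theorem rectInt_sum (x1 x2 y1 y2 : ℝ) (hx : x1 ≤ x2) (hy : y1 ≤ y2) (m : ℂ → ℕ) (S : Finset ℂ)
    (hS : ∀ ρ ∈ S, x1 < ρ.re ∧ ρ.re < x2 ∧ y1 < ρ.im ∧ ρ.im < y2) :
    RectII (fun z => ∑ ρ ∈ S, (m ρ : ℂ) * (1 / (z - ρ))) x1 x2 y1 y2 ∧
    (rectInt (fun z => ∑ ρ ∈ S, (m ρ : ℂ) * (1 / (z - ρ))) x1 x2 y1 y2).im =
      2 * Real.pi * ∑ ρ ∈ S, (m ρ : ℝ) := by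
  classical
  induction S using Finset.induction_on with
  | empty =>
    simp only [Finset.sum_empty, mul_zero]
    refine ⟨⟨by simp, by simp, by simp, by simp⟩, by simp [rectInt]⟩
  | insert a S ha ih =>
    obtain ⟨i1, i2⟩ := ih (fun ρ hρ => hS ρ (Finset.mem_insert_of_mem hρ))
    obtain ⟨h1, h2, h3, h4⟩ := hS a (Finset.mem_insert_self _ _)
    have hp : RectII (fun z => (1 / (z - a))) x1 x2 y1 y2 := by
      apply rectII_of_cont _ _ _ _ _ hx hy
      intro x y _ _ _ _ hor
      have : (x : ℂ) + y * I - a ≠ 0 := by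
        intro h
        have e1 := congrArg Complex.re h
        have e2 := congrArg Complex.im h
        simp at e1 e2
        rcases hor with h | h | h | h <;> linarith
      fun_prop (disch := exact this)
    simp only [Finset.sum_insert ha]
    refine ⟨(hp.const_mul _).add i1, ?_⟩
    rw [rectInt_add (hp.const_mul _) i1, rectInt_const_mul, Complex.add_im, i2]
    have := rectInt_pole x1 x2 y1 y2 a h1 h2 h3 h4
    rw [← Complex.ofReal_natCast, Complex.im_ofReal_mul, this]
    push_cast; ring

theorem arg_principle (f : ℂ → ℂ) (hf : Differentiable ℂ f) (m : ℂ → ℕ) (x1 x2 y1 y2 : ℝ)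
    (hx : x1 ≤ x2) (hy : y1 ≤ y2) (S : Finset ℂ)
    (hS : ∀ ρ, ρ ∈ S ↔ f ρ = 0 ∧ x1 < ρ.re ∧ ρ.re < x2 ∧ y1 < ρ.im ∧ ρ.im < y2)
    (hm : ∀ ρ ∈ S, MultAt f ρ (m ρ))
    (hb : ∀ x y : ℝ, x1 ≤ x → x ≤ x2 → y1 ≤ y → y ≤ y2 → (x = x1 ∨ x = x2 ∨ y = y1 ∨ y = y2) →
      f (x + y * I) ≠ 0) :
    (rectInt (logDeriv f) x1 x2 y1 y2).im = 2 * Real.pi * ∑ ρ ∈ S, (m ρ : ℝ) := by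
  obtain ⟨G, hG, hfG, hGS⟩ := exists_factor f hf m S hm
  obtain ⟨i1, i2⟩ := rectInt_sum x1 x2 y1 y2 hx hy m S (fun ρ h => ((hS ρ).1 h).2)
  have hG0 : ∀ z : ℂ, x1 ≤ z.re → z.re ≤ x2 → y1 ≤ z.im → z.im ≤ y2 → G z ≠ 0 := by
    intro z h1 h2 h3 h4 h0
    have hfz : f z = 0 := by rw [hfG, h0, mul_zero]
    by_cases hzS : z ∈ S
    · exact hGS z hzS h0
    · have hz : z = (z.re : ℂ) + z.im * I := (re_add_im z).symm
      by_cases hor : z.re = x1 ∨ z.re = x2 ∨ z.im = y1 ∨ z.im = y2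
      · exact hb z.re z.im h1 h2 h3 h4 hor (by rw [← hz]; exact hfz)
      · push Not at hor
        exact hzS ((hS z).2 ⟨hfz, lt_of_le_of_ne h1 (Ne.symm hor.1), lt_of_le_of_ne h2 hor.2.1,
          lt_of_le_of_ne h3 (Ne.symm hor.2.2.1), lt_of_le_of_ne h4 hor.2.2.2⟩)
  have hGd : ∀ z : ℂ, G z ≠ 0 → DifferentiableAt ℂ (logDeriv G) z := by
    intro z hz
    have : DifferentiableAt ℂ (fun z => deriv G z / G z) z :=
      ((hG.analyticAt z).deriv.differentiableAt).div (hG z) hz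
    exact this
  have hGii : RectII (logDeriv G) x1 x2 y1 y2 := by
    apply rectII_of_cont _ _ _ _ _ hx hy
    intro x y h1 h2 h3 h4 _
    exact (hGd _ (hG0 _ (by simpa) (by simpa) (by simpa) (by simpa))).continuousAt
  have hGr : rectInt (logDeriv G) x1 x2 y1 y2 = 0 := by
    have := integral_boundary_rect_eq_zero_of_differentiableOn (logDeriv G)
      (⟨x1, y1⟩ : ℂ) (⟨x2, y2⟩ : ℂ) ?_
    · exact this
    · intro z hz
      rw [mem_reProdIm, uIcc_of_le hx, uIcc_of_le hy] at hz
      exact (hGd z (hG0 z hz.1.1 hz.1.2 hz.2.1 hz.2.2)).differentiableWithinAt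
  rw [rectInt_congr (logDeriv f) (fun z => (∑ ρ ∈ S, (m ρ : ℂ) * (1 / (z - ρ))) + logDeriv G z)
    _ _ _ _ hx hy, rectInt_add i1 hGii, hGr, add_zero, i2]
  intro x y h1 h2 h3 h4 h5
  exact logDeriv_factor f G hG m S hfG _ (hb x y h1 h2 h3 h4 h5)

end RZ

namespace RZ
open Complex Filter Topology Set

/-- holomorphic nonvanishing with bounded growth: change of argument -/
theorem log_ball_bound (G : ℂ → ℂ) (hG : Differentiable ℂ G) (c : ℂ) (d : ℝ) (hd : 0 < d) (L : ℝ)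
    (hL : 0 ≤ L) (hG0 : ∀ z ∈ Metric.closedBall c (2 * d), G z ≠ 0)
    (hGb : ∀ z ∈ Metric.closedBall c (2 * d), ‖G z‖ ≤ Real.exp L * ‖G c‖) :
    ‖∫ x : ℝ in (0 : ℝ)..d, logDeriv G (c + x)‖ ≤ 2 * (L + 1) := by
  have hGd : ∀ z : ℂ, G z ≠ 0 → DifferentiableAt ℂ (logDeriv G) z := by
    intro z hz
    have : DifferentiableAt ℂ (fun z => deriv G z / G z) z :=
      ((hG.analyticAt z).deriv.differentiableAt).div (hG z) hz
    exact this
  have hsub : Metric.ball c (2 * d) ⊆ Metric.closedBall c (2 * d) := Metric.ball_subset_closedBall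
  have hdo : DifferentiableOn ℂ (logDeriv G) (Metric.ball c (2 * d)) :=
    fun z hz => (hGd z (hG0 z (hsub hz))).differentiableWithinAt
  obtain ⟨h, hc, hh⟩ := hdo.isExactOn_ball.with_val_at c 0
  have hcb : c ∈ Metric.ball c (2 * d) := Metric.mem_ball_self (by linarith)
  have hexp : ∀ z ∈ Metric.ball c (2 * d), G z = G c * exp (h z) := by
    have hconst : ∀ z ∈ Metric.ball c (2 * d), G z * exp (-h z) = G c * exp (-h c) := by
      intro z hz
      have hder : ∀ w ∈ Metric.ball c (2 * d),
          HasDerivWithinAt (fun w => G w * exp (-h w)) 0 (Metric.ball c (2 * d)) w := by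
        intro w hw
        have h1 := (hG w).hasDerivAt.mul ((hh w hw).neg.cexp)
        refine (h1.congr_deriv ?_).hasDerivWithinAt
        have := hG0 w (hsub hw)
        rw [logDeriv_apply]
        simp only [Pi.neg_apply]
        field_simp
        ring
      have hdf : ∀ w ∈ Metric.ball c (2 * d), ‖(0 : ℂ)‖ ≤ 0 := by simp
      have := (convex_ball c (2 * d)).norm_image_sub_le_of_norm_hasDerivWithin_le hder hdf hcb hz
      simp only [zero_mul, norm_le_zero_iff, sub_eq_zero] at this
      exact this
    intro z hz
    have := hconst z hz
    rw [hc] at this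
    simp only [neg_zero, Complex.exp_zero, mul_one] at this
    rw [← this, mul_assoc, ← Complex.exp_add]
    simp
  have hGc : 0 < ‖G c‖ := norm_pos_iff.mpr (hG0 c (hsub hcb))
  have hre : ∀ z ∈ Metric.ball c (2 * d), (h z).re ≤ L := by
    intro z hz
    have h1 := hGb z (hsub hz)
    rw [hexp z hz, norm_mul, Complex.norm_exp, mul_comm] at h1
    have := le_of_mul_le_mul_right h1 hGc
    exact Real.exp_le_exp.mp this
  have hIntg : ∫ x : ℝ in (0 : ℝ)..d, logDeriv G (c + x) = h (c + d) - h c := by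
    have hm : ∀ x : ℝ, x ∈ uIcc 0 d → c + (x : ℂ) ∈ Metric.ball c (2 * d) := by
      intro x hx
      rw [uIcc_of_le hd.le] at hx
      simp only [Metric.mem_ball, dist_self_add_left, Complex.norm_real, Real.norm_eq_abs]
      rw [abs_of_nonneg hx.1]; linarith [hx.2]
    rw [intervalIntegral.integral_eq_sub_of_hasDerivAt (f := fun x : ℝ => h (c + x))]
    · simp
    · intro x hx
      have h1 := hh _ (hm x hx)
      have h2 : HasDerivAt (fun x : ℝ => c + (x : ℂ)) 1 x := by
        simpa using (Complex.ofRealCLM.hasDerivAt (x := x)).const_add c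
      exact (h1.comp x h2).congr_deriv (by simp)
    · apply ContinuousOn.intervalIntegrable
      intro x hx
      exact (ContinuousAt.comp (f := fun x : ℝ => c + (x : ℂ)) (hGd _ (hG0 _ (hsub (hm x hx)))).continuousAt
        (by fun_prop)).continuousWithinAt
  rw [hIntg, hc, sub_zero]
  have hbc := borelCaratheodory_zero (f := fun z => h (c + z)) (R := 2 * d) (M := L + 1) (z := (d : ℂ))
    (by linarith) ?_ ?_ (by linarith) ?_ (by simpa using hc)
  · simp only [Complex.norm_real, Real.norm_eq_abs, abs_of_pos hd] at hbc
    refine hbc.trans (le_of_eq ?_)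
    field_simp
    ring
  · intro z hz
    have hz' : c + z ∈ Metric.ball c (2 * d) := by simpa using hz
    have := (hh _ hz').comp_const_add c z
    exact this.differentiableAt.differentiableWithinAt
  · intro z hz
    have hz' : c + z ∈ Metric.ball c (2 * d) := by simpa using hz
    have := hre _ hz'
    simp only [Set.mem_setOf_eq]; linarith
  · simp [abs_of_pos hd]; linarith

theorem int_pole_le (c ρ : ℂ) (h : ρ.im ≠ c.im) (d : ℝ) :
    |(∫ x : ℝ in (0 : ℝ)..d, (1 : ℂ) / (c + x - ρ)).im| ≤ Real.pi := by
  have e1 : ∀ x : ℝ, (1 : ℂ) / (c + x - ρ) =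
      1 / (((x - (ρ.re - c.re) : ℝ) : ℂ) + ((c.im - ρ.im : ℝ) : ℂ) * I) := by
    intro x
    congr 1
    apply Complex.ext <;> simp
    ring
  simp_rw [e1]
  rw [intervalIntegral.integral_comp_sub_right
      (fun x : ℝ => (1 : ℂ) / ((x : ℂ) + ((c.im - ρ.im : ℝ) : ℂ) * I)) (ρ.re - c.re),
      int_pole_horiz _ _ _ (sub_ne_zero.mpr h.symm)]
  set A := (d - (ρ.re - c.re)) / (c.im - ρ.im)
  set B := (0 - (ρ.re - c.re)) / (c.im - ρ.im)
  have a1 := Real.arctan_lt_pi_div_two A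
  have a2 := Real.neg_pi_div_two_lt_arctan A
  have b1 := Real.arctan_lt_pi_div_two B
  have b2 := Real.neg_pi_div_two_lt_arctan B
  rw [abs_le]; constructor <;> linarith

theorem local_arg (f : ℂ → ℂ) (hf : Differentiable ℂ f) (m : ℂ → ℕ)
    (hm : ∀ ρ, f ρ = 0 → MultAt f ρ (m ρ)) (c : ℂ) (hc : f c ≠ 0) (d : ℝ) (hd : 0 < d) (M : ℝ)
    (hM : ∀ z ∈ Metric.closedBall c (8 * d), ‖f z‖ ≤ M)
    (hz : ∀ z, f z = 0 → z.im ≠ c.im) :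
    |(∫ x : ℝ in (0 : ℝ)..d, logDeriv f (c + x)).im| ≤ 6 * (Real.log (M / ‖f c‖) + 1) := by
  classical
  have hfin := finite_zeros f hf c hc _ (isCompact_closedBall c (2 * d))
  set S := hfin.toFinset with hSdef
  have hS : ∀ z, z ∈ S ↔ z ∈ Metric.closedBall c (2 * d) ∧ f z = 0 := by
    intro z; simp [hSdef]
  obtain ⟨G, hG, hfG, hGS⟩ := exists_factor f hf m S (fun ρ h => hm ρ ((hS ρ).1 h).2)
  have hG0 : ∀ z ∈ Metric.closedBall c (2 * d), G z ≠ 0 := by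
    intro z hz h0
    have : f z = 0 := by rw [hfG, h0, mul_zero]
    exact hGS z ((hS z).2 ⟨hz, this⟩) h0
  set n := ∑ ρ ∈ S, m ρ with hn
  have hfc : 0 < ‖f c‖ := norm_pos_iff.mpr hc
  have hGc : 0 < ‖G c‖ := norm_pos_iff.mpr (hG0 c (Metric.mem_closedBall_self (by linarith)))
  have hM0 : ‖f c‖ ≤ M := hM c (Metric.mem_closedBall_self (by linarith))
  -- upper bound for P(c)
  have hPc : ‖f c‖ ≤ (2 * d) ^ n * ‖G c‖ := by
    rw [hfG c, norm_mul, norm_prod]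
    apply mul_le_mul_of_nonneg_right _ (norm_nonneg _)
    rw [hn, ← Finset.prod_pow_eq_pow_sum]
    apply Finset.prod_le_prod
    · intro i _; positivity
    · intro ρ hρ
      rw [norm_pow]
      apply pow_le_pow_left₀ (norm_nonneg _)
      have := ((hS ρ).1 hρ).1
      rw [Metric.mem_closedBall, dist_comm, dist_eq_norm] at this
      exact this
  have hGs : ∀ z ∈ Metric.sphere c (8 * d), ‖G z‖ ≤ M / (6 * d) ^ n := by
    intro z hz
    rw [le_div_iff₀ (by positivity)]
    refine le_trans ?_ (hM z (Metric.sphere_subset_closedBall hz))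
    rw [hfG z, norm_mul, norm_prod, mul_comm]
    apply mul_le_mul_of_nonneg_right _ (norm_nonneg _)
    rw [hn, ← Finset.prod_pow_eq_pow_sum]
    apply Finset.prod_le_prod
    · intro i _; positivity
    · intro ρ hρ
      rw [norm_pow]
      apply pow_le_pow_left₀ (by positivity)
      have h1 := ((hS ρ).1 hρ).1
      rw [Metric.mem_closedBall] at h1
      rw [Metric.mem_sphere] at hz
      have := dist_triangle z ρ c
      rw [← dist_eq_norm]
      linarith
  have hGb : ∀ z ∈ Metric.closedBall c (8 * d), ‖G z‖ ≤ M / (6 * d) ^ n := by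
    intro z hz
    apply norm_le_of_forall_mem_frontier_norm_le (U := Metric.ball c (8 * d)) Metric.isBounded_ball
      hG.diffContOnCl
    · intro w hw
      rw [frontier_ball c (by positivity)] at hw
      exact hGs w hw
    · rwa [closure_ball c (by positivity)]
  have hrat : ∀ z ∈ Metric.closedBall c (8 * d), ‖G z‖ * 3 ^ n ≤ M / ‖f c‖ * ‖G c‖ := by
    intro z hz
    have h1 := hGb z hz
    have h6 : (6 * d) ^ n = 3 ^ n * (2 * d) ^ n := by rw [← mul_pow]; congr 1; ring
    rw [h6, le_div_iff₀ (by positivity)] at h1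
    rw [div_mul_eq_mul_div, le_div_iff₀ hfc]
    calc ‖G z‖ * 3 ^ n * ‖f c‖ ≤ ‖G z‖ * 3 ^ n * ((2 * d) ^ n * ‖G c‖) := by gcongr
      _ = (‖G z‖ * (3 ^ n * (2 * d) ^ n)) * ‖G c‖ := by ring
      _ ≤ M * ‖G c‖ := by gcongr
  have h3n : (3 : ℝ) ^ n ≤ M / ‖f c‖ := by
    have := hrat c (Metric.mem_closedBall_self (by linarith))
    rw [mul_comm] at this
    exact le_of_mul_le_mul_right this hGc
  have hMpos : 0 < M / ‖f c‖ := lt_of_lt_of_le (by positivity) h3n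
  have hL1 : (1 : ℝ) ≤ M / ‖f c‖ := (one_le_pow₀ (by norm_num)).trans h3n
  set L := Real.log (M / ‖f c‖) with hLdef
  have hL0 : 0 ≤ L := Real.log_nonneg hL1
  have hnL : (n : ℝ) ≤ L := by
    have h1 := Real.log_le_log (by positivity) h3n
    rw [Real.log_pow] at h1
    have h3 : 1 ≤ Real.log 3 := by
      rw [Real.le_log_iff_exp_le (by norm_num)]
      linarith [Real.exp_one_lt_d9]
    nlinarith [Nat.cast_nonneg (α := ℝ) n]
  have hGint := log_ball_bound G hG c d hd L hL0 hG0 (by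
    intro z hz
    have hz' : z ∈ Metric.closedBall c (8 * d) := Metric.closedBall_subset_closedBall (by linarith) hz
    rw [hLdef, Real.exp_log hMpos]
    refine le_trans ?_ (hrat z hz')
    have : (1 : ℝ) ≤ 3 ^ n := one_le_pow₀ (by norm_num)
    nlinarith [norm_nonneg (G z)])
  -- integrability
  have hne : ∀ x : ℝ, f (c + x) ≠ 0 := by
    intro x h0
    exact hz _ h0 (by simp)
  have hld : ∀ x : ℝ, logDeriv f (c + x) = (∑ ρ ∈ S, (m ρ : ℂ) * (1 / (c + x - ρ))) + logDeriv G (c + x) :=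
    fun x => logDeriv_factor f G hG m S hfG _ (hne x)
  have hcontG : Continuous fun x : ℝ => logDeriv G (c + x) := by
    have hG1 : Continuous fun x : ℝ => deriv G (c + x) :=
      (hG.contDiff (n := 1)).continuous_deriv le_rfl |>.comp (by fun_prop)
    have hG2 : Continuous fun x : ℝ => G (c + x) := hG.continuous.comp (by fun_prop)
    refine hG1.div hG2 ?_
    intro x h0
    exact hne x (by rw [hfG, h0, mul_zero])
  have hcontp : ∀ ρ ∈ S, Continuous fun x : ℝ => (m ρ : ℂ) * ((1 : ℂ) / (c + x - ρ)) := by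
    intro ρ hρ
    have : ∀ x : ℝ, c + x - ρ ≠ 0 := by
      intro x h0
      have h1 := congrArg Complex.im h0
      simp at h1
      exact hz ρ ((hS ρ).1 hρ).2 (by linarith)
    fun_prop (disch := exact this _)
  simp_rw [hld]
  rw [intervalIntegral.integral_add ((continuous_finset_sum S hcontp).intervalIntegrable _ _)
    (hcontG.intervalIntegrable _ _), intervalIntegral.integral_finset_sum
    (fun ρ hρ => (hcontp ρ hρ).intervalIntegrable _ _)]
  simp_rw [intervalIntegral.integral_const_mul]
  rw [Complex.add_im, Complex.im_sum]
  have hsum : |∑ ρ ∈ S, ((m ρ : ℂ) * ∫ x : ℝ in (0 : ℝ)..d, (1 : ℂ) / (c + x - ρ)).im| ≤ n * Real.pi := by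
    refine (Finset.abs_sum_le_sum_abs _ _).trans ?_
    rw [hn, Nat.cast_sum, Finset.sum_mul]
    apply Finset.sum_le_sum
    intro ρ hρ
    rw [← Complex.ofReal_natCast, Complex.im_ofReal_mul, abs_mul, Nat.abs_cast]
    exact mul_le_mul_of_nonneg_left (int_pole_le c ρ (hz ρ ((hS ρ).1 hρ).2) d) (Nat.cast_nonneg _)
  have him := (Complex.abs_im_le_norm _).trans hGint
  refine (abs_add_le _ _).trans ?_
  have : (n : ℝ) * Real.pi ≤ 4 * L := by
    nlinarith [Real.pi_le_four, Real.pi_pos, Nat.cast_nonneg (α := ℝ) n]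
  linarith

end RZ

namespace RZ
open Complex Filter Topology Set

noncomputable def fR (s x : ℂ) : ℂ := x ^ (-s) * exp (Real.pi * I * x ^ 2)
noncomputable def dR (x : ℂ) : ℂ := exp (Real.pi * I * x) - exp (-(Real.pi * I * x))
noncomputable def xl (c w : ℝ) : ℂ := ((c + w : ℝ) : ℂ) + w * I
noncomputable def JR (s : ℂ) (c : ℝ) : ℂ := ∫ w : ℝ, fR s (xl c w) / dR (xl c w)

theorem xl_re (c w : ℝ) : (xl c w).re = c + w := by simp [xl]
theorem xl_im (c w : ℝ) : (xl c w).im = w := by simp [xl]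

theorem dR_eq (x : ℂ) : dR x = 2 * I * sin (Real.pi * x) := by
  unfold dR
  rw [Complex.sin]
  have e1 : -(↑Real.pi * x) * I = -(Real.pi * I * x) := by ring
  have e2 : (↑Real.pi * x) * I = Real.pi * I * x := by ring
  rw [e1, e2]
  linear_combination -(exp (-(Real.pi * I * x)) - exp (Real.pi * I * x)) * I_sq

theorem normSq_sin (z : ℂ) : ‖sin z‖ ^ 2 = Real.sin z.re ^ 2 + Real.sinh z.im ^ 2 := by
  rw [Complex.sin_eq]
  have : sin (z.re : ℂ) * cosh z.im + cos z.re * sinh z.im * I =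
    ((Real.sin z.re * Real.cosh z.im : ℝ) : ℂ) + ((Real.cos z.re * Real.sinh z.im : ℝ) : ℂ) * I := by
    push_cast; ring
  rw [this, ← Complex.normSq_eq_norm_sq, Complex.normSq_add_mul_I]
  have h1 := Real.cosh_sq z.im
  have h2 := Real.sin_sq_add_cos_sq z.re
  rw [mul_pow, mul_pow, h1]
  linear_combination (Real.sinh z.im ^ 2) * h2

theorem sq_le_sinh_sq (y : ℝ) : y ^ 2 ≤ Real.sinh y ^ 2 := by
  rw [sq_le_sq, Real.abs_sinh]
  exact Real.self_le_sinh_iff.mpr (abs_nonneg y)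

theorem norm_dR_sq (x : ℂ) : ‖dR x‖ ^ 2 =
    4 * (Real.sin (Real.pi * x.re) ^ 2 + Real.sinh (Real.pi * x.im) ^ 2) := by
  rw [dR_eq, norm_mul, mul_pow, normSq_sin]
  simp
  norm_num

theorem norm_dR_ge (x : ℂ) : 2 * |x.im| ≤ ‖dR x‖ := by
  apply le_of_sq_le_sq _ (norm_nonneg _)
  rw [norm_dR_sq, mul_pow, sq_abs]
  have h1 := sq_le_sinh_sq (Real.pi * x.im)
  have := Real.pi_gt_three
  have h3 : x.im ^ 2 ≤ (Real.pi * x.im) ^ 2 := by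
    rw [mul_pow]
    nlinarith [mul_nonneg (show (0:ℝ) ≤ Real.pi ^ 2 - 1 by nlinarith) (sq_nonneg x.im)]
  nlinarith [sq_nonneg (Real.sin (Real.pi * x.re))]

theorem norm_dR_half (N : ℕ) (w : ℝ) : 2 ≤ ‖dR (xl (N + 1 / 2) w)‖ := by
  apply le_of_sq_le_sq _ (norm_nonneg _)
  rw [norm_dR_sq, xl_re, xl_im]
  have h1 := sq_le_sinh_sq (Real.pi * w)
  have h2 : Real.sin (Real.pi * (N + 1 / 2 + w)) ^ 2 = 1 - Real.sin (Real.pi * w) ^ 2 := by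
    have : Real.pi * (N + 1 / 2 + w) = (Real.pi * w + Real.pi / 2) + N * Real.pi := by ring
    rw [this, Real.sin_add_nat_mul_pi, Real.sin_add_pi_div_two, mul_pow, ← pow_mul, mul_comm N 2, pow_mul]
    have := Real.sin_sq_add_cos_sq (Real.pi * w)
    norm_num
    linarith
  have h3 := Real.sin_sq_le_sq (x := Real.pi * w)
  rw [h2]
  linarith

theorem dR_ne_zero (x : ℂ) (h : ∀ n : ℤ, x ≠ n) : dR x ≠ 0 := by
  rw [dR_eq]
  have : sin (Real.pi * x) ≠ 0 := by
    rw [Complex.sin_ne_zero_iff]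
    intro k hk
    apply h k
    have hp : (Real.pi : ℂ) ≠ 0 := by exact_mod_cast Real.pi_ne_zero
    rw [mul_comm (k : ℂ)] at hk
    exact mul_left_cancel₀ hp hk
  simp [this]

theorem xl_norm_ge (c w : ℝ) (hc : 0 < c) : c / 2 ≤ ‖xl c w‖ := by
  apply le_of_sq_le_sq _ (norm_nonneg _)
  rw [← Complex.normSq_eq_norm_sq, xl, Complex.normSq_add_mul_I]
  nlinarith [sq_nonneg (c + 2 * w), sq_nonneg c]

theorem xl_norm_le (c w : ℝ) (hc : 0 ≤ c) : ‖xl c w‖ ≤ c + 2 * |w| := by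
  unfold xl
  refine (norm_add_le _ _).trans ?_
  rw [norm_mul, Complex.norm_I, mul_one, Complex.norm_real, Complex.norm_real]
  have := abs_add_le c w
  simp only [Real.norm_eq_abs]
  rw [abs_of_nonneg hc] at this
  linarith

theorem xl_ne_zero (c w : ℝ) (hc : 0 < c) : xl c w ≠ 0 := by
  have := xl_norm_ge c w hc
  intro h
  rw [h, norm_zero] at this
  linarith

theorem xl_slit (c w : ℝ) (hc : 0 < c) : xl c w ∈ slitPlane := by
  rw [mem_slitPlane_iff, xl_re, xl_im]
  by_cases h : w = 0
  · left; rw [h]; linarith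
  · right; exact h

theorem norm_log_le' (x : ℂ) (hx : x ≠ 0) : ‖log x‖ ≤ ‖x‖ + 1 / ‖x‖ + 4 := by
  have hp : 0 < ‖x‖ := norm_pos_iff.mpr hx
  have h1 : ‖log x‖ ≤ |(log x).re| + |(log x).im| := Complex.norm_le_abs_re_add_abs_im _
  rw [Complex.log_re, Complex.log_im] at h1
  have h2 := Complex.abs_arg_le_pi x
  have h3 : |Real.log ‖x‖| ≤ ‖x‖ + 1 / ‖x‖ := by
    rw [abs_le]
    have a := Real.log_le_sub_one_of_pos hp
    have b := Real.one_sub_inv_le_log_of_pos hp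
    have : 0 < 1 / ‖x‖ := by positivity
    rw [one_div] at *
    constructor <;> linarith
  linarith [Real.pi_le_four]

theorem norm_log_xl (c w : ℝ) (hc : 0 < c) : ‖log (xl c w)‖ ≤ 2 / c + c + 4 + 2 * |w| := by
  have h1 := norm_log_le' _ (xl_ne_zero c w hc)
  have h2 := xl_norm_le c w hc.le
  have h3 := xl_norm_ge c w hc
  have : 1 / ‖xl c w‖ ≤ 1 / (c / 2) := one_div_le_one_div_of_le (by positivity) h3
  rw [one_div_div] at this
  linarith

theorem norm_gauss_xl (c w : ℝ) :
    ‖exp (Real.pi * I * (xl c w) ^ 2)‖ = Real.exp (-(2 * Real.pi * (c * w + w ^ 2))) := by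
  rw [Complex.norm_exp]
  congr 1
  have : (Real.pi : ℂ) * I * (xl c w) ^ 2 = ((-(2 * Real.pi * (c * w + w ^ 2)) : ℝ) : ℂ) +
      ((Real.pi * (c ^ 2 + 2 * c * w) : ℝ) : ℂ) * I := by
    unfold xl
    push_cast
    linear_combination (Real.pi * w ^ 2 * I + 2 * Real.pi * (c + w) * w) * I_sq
  rw [this, Complex.add_re, Complex.ofReal_re, Complex.re_ofReal_mul, I_re, mul_zero, add_zero]

theorem cpow_eq (s x : ℂ) (hx : x ≠ 0) : x ^ (-s) = exp (-s * log x) := by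
  rw [cpow_def_of_ne_zero hx, mul_comm]

theorem gauss_bd (M c w : ℝ) (hM : 0 ≤ M) (hc : 0 < c) :
    Real.exp (M * (2 / c + c + 4 + 2 * |w|)) * Real.exp (-(2 * Real.pi * (c * w + w ^ 2))) ≤
      Real.exp (M * (2 / c + c + 4) + (2 * M + 7 * c) ^ 2) * Real.exp (-w ^ 2) := by
  rw [← Real.exp_add, ← Real.exp_add]
  apply Real.exp_le_exp.mpr
  have hp := Real.pi_gt_three
  have hp2 : Real.pi < 3.5 := by linarith [Real.pi_lt_d2]
  have h1 : -(2 * Real.pi * (c * w)) ≤ 7 * c * |w| := by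
    have : -(c * w) ≤ c * |w| := by
      have := neg_abs_le w
      nlinarith
    have h0 : 0 ≤ c * |w| := by positivity
    nlinarith
  have h2 : 2 * Real.pi * w ^ 2 ≥ 6 * w ^ 2 := by nlinarith [sq_nonneg w]
  have h3 : w ^ 2 = |w| ^ 2 := (sq_abs w).symm
  nlinarith [sq_nonneg ((2 * M + 7 * c) - |w|), abs_nonneg w, mul_nonneg hM (abs_nonneg w), sq_nonneg (2 * M + 7 * c)]

theorem norm_fR_xl (s : ℂ) (M c w : ℝ) (hM : ‖s‖ ≤ M) (hc : 0 < c) :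
    ‖fR s (xl c w)‖ ≤ Real.exp (M * (2 / c + c + 4) + (2 * M + 7 * c) ^ 2) * Real.exp (-w ^ 2) := by
  have hM0 : 0 ≤ M := (norm_nonneg s).trans hM
  refine le_trans ?_ (gauss_bd M c w hM0 hc)
  unfold fR
  rw [norm_mul, norm_gauss_xl, cpow_eq _ _ (xl_ne_zero c w hc)]
  gcongr
  refine (Complex.norm_exp_le_exp_norm _).trans ?_
  apply Real.exp_le_exp.mpr
  rw [norm_mul, norm_neg]
  exact mul_le_mul hM (norm_log_xl c w hc) (norm_nonneg _) hM0

theorem cont_xl (c : ℝ) : Continuous (xl c) := by unfold xl; fun_prop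

theorem cont_fR_xl (s : ℂ) (c : ℝ) (hc : 0 < c) : Continuous fun w => fR s (xl c w) := by
  unfold fR
  have h := cont_xl c
  apply Continuous.mul
  · rw [continuous_iff_continuousAt]
    intro w
    exact (continuousAt_cpow_const (xl_slit c w hc)).comp h.continuousAt
  · fun_prop

theorem cont_dR : Continuous dR := by unfold dR; fun_prop

theorem exp_neg_sq_int : Integrable fun w : ℝ => Real.exp (-w ^ 2) := by
  simpa using integrable_exp_neg_mul_sq (b := 1) (by norm_num)

theorem int_JR (s : ℂ) (N : ℕ) :
    Integrable fun w => fR s (xl (N + 1 / 2) w) / dR (xl (N + 1 / 2) w) := by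
  have hc : (0 : ℝ) < N + 1 / 2 := by positivity
  have hne : ∀ w, dR (xl (N + 1 / 2) w) ≠ 0 := fun w h => by
    have := norm_dR_half N w
    rw [h, norm_zero] at this; linarith
  apply (exp_neg_sq_int.const_mul (Real.exp (‖s‖ * (2 / (N + 1 / 2 : ℝ) + (N + 1 / 2 : ℝ) + 4) +
    (2 * ‖s‖ + 7 * (N + 1 / 2 : ℝ)) ^ 2))).mono'
  · exact ((cont_fR_xl s _ hc).div (cont_dR.comp (cont_xl _)) hne).aestronglyMeasurable
  · filter_upwards with w
    rw [norm_div]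
    refine le_trans ?_ (norm_fR_xl s ‖s‖ _ w le_rfl hc)
    apply div_le_self (norm_nonneg _)
    linarith [norm_dR_half N w]

theorem R_eq_J (s : ℂ) : RiemannR s = -(1 + I) * JR s (1 / 2) := by
  have hpi : exp (Real.pi * I / 4) = (1 + I) / (Real.sqrt 2 : ℝ) := by
    have : (Real.pi : ℂ) * I / 4 = ((Real.pi / 4 : ℝ) : ℂ) * I := by push_cast; ring
    rw [this, Complex.exp_mul_I, ← Complex.ofReal_cos, ← Complex.ofReal_sin, Real.cos_pi_div_four,
      Real.sin_pi_div_four]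
    have h2 : ((Real.sqrt 2 : ℝ) : ℂ) ≠ 0 := by simp
    have h3 : ((Real.sqrt 2 : ℝ) : ℂ) ^ 2 = 2 := by
      rw [← Complex.ofReal_pow, Real.sq_sqrt (by norm_num)]; simp
    push_cast
    field_simp
    linear_combination (1 + I) * h3
  have h2 : ((Real.sqrt 2 : ℝ) : ℂ) ≠ 0 := by simp
  have hr : ∀ u : ℝ, rline u = xl (1 / 2) ((-(Real.sqrt 2)⁻¹) * u) := by
    intro u
    unfold rline xl
    rw [hpi]
    push_cast
    field_simp
    ring
  unfold RiemannR JR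
  have := MeasureTheory.Measure.integral_comp_mul_left (fun w : ℝ => fR s (xl (1 / 2) w) / dR (xl (1 / 2) w)) (-(Real.sqrt 2)⁻¹)
  have e : ∀ u : ℝ, rline u ^ (-s) * exp (Real.pi * I * rline u ^ 2) /
      (exp (Real.pi * I * rline u) - exp (-(Real.pi * I * rline u))) =
      fR s (xl (1 / 2) (-(Real.sqrt 2)⁻¹ * u)) / dR (xl (1 / 2) (-(Real.sqrt 2)⁻¹ * u)) := by
    intro u; rw [← hr]; rfl
  simp_rw [e]
  rw [show (∫ u : ℝ, fR s (xl (1 / 2) (-(Real.sqrt 2)⁻¹ * u)) / dR (xl (1 / 2) (-(Real.sqrt 2)⁻¹ * u)))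
    = _ from this]
  have h3 : |(-(Real.sqrt 2)⁻¹)⁻¹| = Real.sqrt 2 := by
    rw [inv_neg, inv_inv, abs_neg, abs_of_nonneg (Real.sqrt_nonneg 2)]
  rw [h3, hpi, Complex.real_smul]
  field_simp

theorem R_entire : Differentiable ℂ RiemannR := by
  have hc : (0 : ℝ) < 1 / 2 := by norm_num
  have hN : ∀ w, 2 ≤ ‖dR (xl (1 / 2) w)‖ := by
    intro w; simpa using norm_dR_half 0 w
  have hne : ∀ w, dR (xl (1 / 2) w) ≠ 0 := fun w h => by
    have := hN w
    rw [h, norm_zero] at this; linarith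
  have hJ : ∀ s, HasDerivAt (fun s => JR s (1 / 2)) (∫ w : ℝ, -log (xl (1 / 2) w) *
      (fR s (xl (1 / 2) w) / dR (xl (1 / 2) w))) s := by
    intro s0
    have hcm : Continuous fun w => log (xl (1 / 2) w) := by
      rw [continuous_iff_continuousAt]
      intro w
      exact (cont_xl _).continuousAt.clog (xl_slit _ w hc)
    have hcont : ∀ s, Continuous fun w => fR s (xl (1 / 2) w) / dR (xl (1 / 2) w) :=
      fun s => (cont_fR_xl s _ hc).div (cont_dR.comp (cont_xl _)) hne
    set M := ‖s0‖ + 2 with hM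
    refine (hasDerivAt_integral_of_dominated_loc_of_deriv_le (μ := volume)
      (F := fun s (w : ℝ) => fR s (xl (1 / 2) w) / dR (xl (1 / 2) w))
      (F' := fun s (w : ℝ) => -log (xl (1 / 2) w) * (fR s (xl (1 / 2) w) / dR (xl (1 / 2) w)))
      (bound := fun w => Real.exp (M * (2 / (1/2 : ℝ) + (1/2 : ℝ) + 4) +
        (2 * M + 7 * (1/2 : ℝ)) ^ 2) * Real.exp (-w ^ 2))
      (Metric.ball_mem_nhds s0 one_pos) ?_ ?_ ?_ ?_ ?_ ?_).2
    · exact Eventually.of_forall fun s => (hcont s).aestronglyMeasurable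
    · simpa using int_JR s0 0
    · exact (hcm.neg.mul (hcont s0)).aestronglyMeasurable
    · refine Eventually.of_forall fun w s hs => ?_
      have hs' : ‖s‖ ≤ ‖s0‖ + 1 := by
        rw [Metric.mem_ball, dist_eq_norm] at hs
        have := norm_le_norm_add_norm_sub' s s0
        linarith
      refine le_trans ?_ (gauss_bd M _ w (by positivity) hc)
      rw [norm_mul, norm_neg, norm_div]
      have h1 : ‖fR s (xl (1 / 2) w)‖ / ‖dR (xl (1 / 2) w)‖ ≤ ‖fR s (xl (1 / 2) w)‖ :=
        div_le_self (norm_nonneg _) (by linarith [hN w])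
      unfold fR at h1 ⊢
      rw [norm_mul, norm_gauss_xl, cpow_eq _ _ (xl_ne_zero _ w hc)] at *
      have h2 := norm_log_xl (1/2) w hc
      set Q := (2 : ℝ) / (1 / 2) + 1 / 2 + 4 + 2 * |w| with hQ
      have hQ0 : 0 ≤ Q := by positivity
      have h3 : ‖exp (-s * log (xl (1 / 2) w))‖ ≤ Real.exp ((‖s0‖ + 1) * Q) := by
        refine (Complex.norm_exp_le_exp_norm _).trans ?_
        apply Real.exp_le_exp.mpr
        rw [norm_mul, norm_neg]
        exact mul_le_mul hs' h2 (norm_nonneg _) (by positivity)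
      have h4 : ‖log (xl (1 / 2) w)‖ ≤ Real.exp Q := h2.trans (by linarith [Real.add_one_le_exp Q])
      calc _ ≤ Real.exp Q * (Real.exp ((‖s0‖ + 1) * Q) * Real.exp (-(2 * Real.pi * (1 / 2 * w + w ^ 2)))) := by
            gcongr
            refine h1.trans ?_
            gcongr
        _ = Real.exp (M * Q) * Real.exp (-(2 * Real.pi * (1 / 2 * w + w ^ 2))) := by
            rw [← mul_assoc, ← Real.exp_add]; congr 2; rw [hM]; ring
    · exact exp_neg_sq_int.const_mul _
    · refine Eventually.of_forall fun w s hs => ?_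
      unfold fR
      simp_rw [fun s => cpow_eq s _ (xl_ne_zero _ w hc)]
      have h1 : HasDerivAt (fun s => exp (-s * log (xl (1 / 2) w)))
          (exp (-s * log (xl (1 / 2) w)) * (-1 * log (xl (1 / 2) w))) s :=
        ((hasDerivAt_id s).neg.mul_const _).cexp
      refine ((h1.mul_const _).div_const _).congr_deriv ?_
      ring
  intro s
  have : RiemannR = fun s => -(1 + I) * JR s (1 / 2) := funext R_eq_J
  rw [this]
  exact ((hJ s).const_mul _).differentiableAt

end RZ

namespace RZ
open Complex Filter Topology Set

theorem xl_strip (n X Y : ℝ) : (n : ℂ) + (1 + I) * ((X : ℂ) + Y * I) = xl (n - 2 * Y) (X + Y) := by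
  unfold xl
  push_cast
  linear_combination (Y : ℂ) * I_sq

theorem xl_strip' (n : ℝ) (z : ℂ) : (n : ℂ) + (1 + I) * z = xl (n - 2 * z.im) (z.re + z.im) := by
  rw [← xl_strip, re_add_im]

theorem tendsto_exp_half (K : ℝ) (l : Filter ℝ) (hl : Tendsto (fun x : ℝ => |x|) l atTop) :
    Tendsto (fun X : ℝ => K * Real.exp (-(X ^ 2 / 2))) l (𝓝 0) := by
  have h1 : Tendsto (fun X : ℝ => X ^ 2 / 2) l atTop := by
    have := ((tendsto_pow_atTop (two_ne_zero)).comp hl).atTop_div_const (r := (2:ℝ)) (by norm_num)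
    simpa [Function.comp_def, sq_abs] using this
  have := (Real.tendsto_exp_neg_atTop_nhds_zero.comp h1).const_mul K
  simpa using this

theorem strip_bound (s : ℂ) (n c1 : ℝ) (hc1 : 0 < c1) (C X Y : ℝ) (hX : 2 ≤ |X|) (hY : |Y| ≤ 1 / 4)
    (hc : c1 ≤ n - 2 * Y) (hC : n - 2 * Y ≤ C) :
    ‖fR s (xl (n - 2 * Y) (X + Y)) / dR (xl (n - 2 * Y) (X + Y))‖ ≤
      Real.exp (‖s‖ * (2 / c1 + C + 4) + (2 * ‖s‖ + 7 * C) ^ 2 + 1) * Real.exp (-(X ^ 2 / 2)) := by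
  have hc0 : 0 < n - 2 * Y := lt_of_lt_of_le hc1 hc
  have h1 := norm_fR_xl s ‖s‖ (n - 2 * Y) (X + Y) le_rfl hc0
  have h2 := norm_dR_ge (xl (n - 2 * Y) (X + Y))
  rw [xl_im] at h2
  have h3 : 1 ≤ |X + Y| := by
    have := abs_sub_abs_le_abs_sub X (-Y)
    rw [abs_neg, sub_neg_eq_add] at this
    linarith
  rw [norm_div]
  refine (div_le_self (norm_nonneg _) (by linarith)).trans (h1.trans ?_)
  rw [← Real.exp_add, ← Real.exp_add]
  apply Real.exp_le_exp.mpr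
  have h4 : 2 / (n - 2 * Y) ≤ 2 / c1 := div_le_div_of_nonneg_left (by norm_num) hc1 hc
  have h5 : ‖s‖ * (2 / (n - 2 * Y) + (n - 2 * Y) + 4) ≤ ‖s‖ * (2 / c1 + C + 4) := by gcongr
  have h6 : (2 * ‖s‖ + 7 * (n - 2 * Y)) ^ 2 ≤ (2 * ‖s‖ + 7 * C) ^ 2 := by gcongr
  have h7 : Y ^ 2 ≤ 1 := by
    rw [abs_le] at hY; nlinarith
  nlinarith [sq_nonneg (X + 2 * Y)]

theorem diff_dR : Differentiable ℂ dR := by unfold dR; fun_prop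

theorem diff_fR (s x : ℂ) (hx : x ∈ slitPlane) : DifferentiableAt ℂ (fR s) x := by
  unfold fR
  have h1 : DifferentiableAt ℂ (fun x : ℂ => x ^ (-s)) x := differentiableAt_id.cpow_const hx
  have h2 : DifferentiableAt ℂ (fun x : ℂ => exp (Real.pi * I * x ^ 2)) x := by fun_prop
  exact h1.mul h2

theorem JR_step (s : ℂ) (N : ℕ) :
    JR s (N + 1 + 1 / 2) - JR s (N + 1 / 2) = (N + 1 : ℂ) ^ (-s) / (1 + I) := by
  set n : ℝ := N + 1 with hn
  have hn1 : (1 : ℝ) ≤ n := by rw [hn]; linarith [Nat.cast_nonneg (α := ℝ) N]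
  have h1I : (1 + I : ℂ) ≠ 0 := by
    intro h; have := congrArg Complex.re h; simp at this
  set D : ℂ → ℂ := fun z => dR ((n : ℂ) + (1 + I) * z) with hD
  set Nn : ℂ → ℂ := fun z => fR s ((n : ℂ) + (1 + I) * z) with hNn
  set U : Set ℂ := {z | -(3/8 : ℝ) < z.im ∧ z.im < 3/8} with hU
  have hUo : IsOpen U := (isOpen_lt continuous_const continuous_im).inter
    (isOpen_lt continuous_im continuous_const)
  have h0U : (0 : ℂ) ∈ U := by constructor <;> simp
  have hUn : U ∈ 𝓝 (0 : ℂ) := hUo.mem_nhds h0U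
  have hDd : Differentiable ℂ D := diff_dR.comp (by fun_prop)
  have hD0 : D 0 = 0 := by
    rw [hD]; simp only [mul_zero, add_zero]
    rw [dR_eq]
    have : (Real.pi : ℂ) * (n : ℂ) = ((N + 1 : ℕ) : ℂ) * Real.pi := by rw [hn]; push_cast; ring
    rw [this, Complex.sin_nat_mul_pi]; simp
  have hDder : HasDerivAt D (2 * I * (Complex.cos (Real.pi * n)) * Real.pi * (1 + I)) 0 := by
    have e : D = fun z => 2 * I * sin (Real.pi * ((n : ℂ) + (1 + I) * z)) := by
      funext z; simp only [hD]; rw [dR_eq]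
    rw [e]
    have h1 : HasDerivAt (fun z : ℂ => (Real.pi : ℂ) * ((n : ℂ) + (1 + I) * z)) (Real.pi * (1 + I)) 0 := by
      refine ((((hasDerivAt_id (0 : ℂ)).const_mul (1 + I)).const_add (n : ℂ)).const_mul (Real.pi : ℂ)).congr_deriv ?_
      ring
    refine ((h1.csin).const_mul (2 * I)).congr_deriv ?_
    simp
    ring
  have hcos : Complex.cos (Real.pi * n) = (-1) ^ (N + 1) := by
    have : (Real.pi : ℂ) * (n : ℂ) = ((N + 1 : ℕ) : ℂ) * Real.pi := by rw [hn]; push_cast; ring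
    rw [this]
    have := Real.cos_nat_mul_pi (N + 1)
    exact_mod_cast congrArg (fun x : ℝ => (x : ℂ)) this
  have hE : Differentiable ℂ (dslope D 0) := by
    rw [← differentiableOn_univ]
    exact (Complex.differentiableOn_dslope univ_mem).2 hDd.differentiableOn
  have hE0 : dslope D 0 0 = 2 * I * (-1) ^ (N + 1) * Real.pi * (1 + I) := by
    rw [dslope_same, hDder.deriv, hcos]
  have hpi : (Real.pi : ℂ) ≠ 0 := by exact_mod_cast Real.pi_ne_zero
  have hEne : ∀ z ∈ U, dslope D 0 z ≠ 0 := by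
    intro z hz
    by_cases hz0 : z = 0
    · rw [hz0, hE0]
      have : ((-1 : ℂ)) ^ (N + 1) ≠ 0 := pow_ne_zero _ (by norm_num)
      simp [h1I, this]
    · rw [dslope_of_ne _ hz0, slope_def_module, hD0, sub_zero, sub_zero]
      have : D z ≠ 0 := by
        simp only [hD]
        apply dR_ne_zero
        intro k hk
        rw [xl_strip'] at hk
        have h1 := congrArg Complex.re hk
        have h2 := congrArg Complex.im hk
        rw [xl_re] at h1
        rw [xl_im] at h2
        simp at h1 h2
        have h3 : (k : ℝ) - (N + 1) = - 2 * z.im := by linarith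
        have h4 : |(((k - (N + 1)) : ℤ) : ℝ)| < 1 := by
          push_cast
          rw [h3, abs_lt]
          constructor <;> linarith [hz.1, hz.2]
        have h5 : k - (N + 1) = 0 := by
          rw [← Int.cast_abs] at h4
          have : |k - ((N:ℤ) + 1)| < 1 := by exact_mod_cast h4
          exact Int.abs_lt_one_iff.mp this
        have h6 : (k : ℝ) - (N + 1) = 0 := by exact_mod_cast h5
        apply hz0
        apply Complex.ext <;> simp <;> linarith
      simp [this, hz0]
  have hslit : ∀ z ∈ U, (n : ℂ) + (1 + I) * z ∈ slitPlane := by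
    intro z hz
    rw [xl_strip']
    apply xl_slit
    linarith [hz.2]
  have hNd : DifferentiableOn ℂ Nn U := by
    intro z hz
    have h1 : DifferentiableAt ℂ (fun z : ℂ => (n : ℂ) + (1 + I) * z) z := by fun_prop
    exact ((diff_fR s _ (hslit z hz)).comp z h1).differentiableWithinAt
  set F : ℂ → ℂ := fun z => Nn z / dslope D 0 z with hF
  have hFd : DifferentiableOn ℂ F U := hNd.div hE.differentiableOn hEne
  have hHd : DifferentiableOn ℂ (dslope F 0) U := (Complex.differentiableOn_dslope hUn).2 hFd
  have hsub : ∀ z : ℂ, -(1/4 : ℝ) ≤ z.im → z.im ≤ 1/4 → z ∈ U := by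
    intro z h1 h2; constructor <;> linarith
  have I1 : Integrable fun X : ℝ => Nn (X + (-(1/4) : ℝ) * I) / D (X + (-(1/4) : ℝ) * I) := by
    have := (int_JR s (N + 1)).comp_sub_right (1/4)
    refine this.congr (Eventually.of_forall fun X => ?_)
    simp only [hNn, hD, xl_strip, hn]
    push_cast
    ring_nf
  have I2 : Integrable fun X : ℝ => Nn (X + (1/4 : ℝ) * I) / D (X + (1/4 : ℝ) * I) := by
    have := (int_JR s N).comp_add_right (1/4)
    refine this.congr (Eventually.of_forall fun X => ?_)
    simp only [hNn, hD, xl_strip, hn]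
    push_cast
    ring_nf
  have key := hshift_res (fun z => Nn z / D z) (dslope F 0) (-(1/4)) (1/4) 0 (F 0) (by norm_num)
    (by norm_num) rfl (hHd.continuousOn.mono fun z hz => hsub z hz.1 hz.2)
    (fun z h1 h2 => (hHd z (hsub z h1.le h2.le)).differentiableAt (hUo.mem_nhds (hsub z h1.le h2.le)))
    ?_ (fun X => Real.exp (‖s‖ * (2 / (1/2) + (n + 1) + 4) + (2 * ‖s‖ + 7 * (n + 1)) ^ 2 + 1) * Real.exp (-(X ^ 2 / 2)))
    (tendsto_exp_half _ atTop tendsto_abs_atTop_atTop)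
    (tendsto_exp_half _ atBot tendsto_abs_atBot_atTop) 2 ?_ I1 I2
  · have e1 : ∫ X : ℝ, Nn (X + (-(1/4) : ℝ) * I) / D (X + (-(1/4) : ℝ) * I) = JR s (N + 1 + 1 / 2) := by
      unfold JR
      rw [← integral_sub_right_eq_self (fun w => fR s (xl (N + 1 + 1 / 2) w) / dR (xl (N + 1 + 1 / 2) w)) (1/4)]
      congr 1; funext X
      simp only [hNn, hD, xl_strip, hn]
      ring_nf
    have e2 : ∫ X : ℝ, Nn (X + (1/4 : ℝ) * I) / D (X + (1/4 : ℝ) * I) = JR s (N + 1 / 2) := by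
      unfold JR
      rw [← integral_add_right_eq_self (fun w => fR s (xl (N + 1 / 2) w) / dR (xl (N + 1 / 2) w)) (1/4)]
      congr 1; funext X
      simp only [hNn, hD, xl_strip, hn]
      ring_nf
    rw [e1, e2] at key
    rw [key]
    simp only [hF]
    rw [hE0]
    simp only [hNn, mul_zero, add_zero, fR]
    have hex : exp (Real.pi * I * (n : ℂ) ^ 2) = (-1) ^ (N + 1) := by
      have : (Real.pi : ℂ) * I * (n : ℂ) ^ 2 = (((N + 1) ^ 2 : ℕ) : ℂ) * (Real.pi * I) := by
        rw [hn]; push_cast; ring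
      rw [this, Complex.exp_nat_mul, Complex.exp_pi_mul_I]
      rcases Nat.even_or_odd (N + 1) with h | h
      · rw [h.neg_one_pow, (h.pow_of_ne_zero two_ne_zero).neg_one_pow]
      · rw [h.neg_one_pow, (h.pow).neg_one_pow]
    rw [hex]
    have : ((-1 : ℂ)) ^ (N + 1) ≠ 0 := pow_ne_zero _ (by norm_num)
    have hnn : (n : ℂ) = N + 1 := by rw [hn]; push_cast; rfl
    rw [hnn]
    field_simp
  · intro z hz h1 h2
    have hEz := hEne z (hsub z h1 h2)
    rw [dslope_of_ne _ hz, slope_def_module]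
    have hDz : D z = z * dslope D 0 z := by
      rw [dslope_of_ne _ hz, slope_def_module, hD0]; simp; field_simp
    simp only [sub_zero, smul_eq_mul]
    simp only [hF]
    rw [hDz]
    field_simp
    ring
  · intro X Y hX h1 h2
    have := strip_bound s n (1/2) (by norm_num) (n + 1) X Y hX (by rw [abs_le]; constructor <;> linarith)
      (by linarith) (by linarith)
    simp only [hNn, hD, xl_strip]
    exact this

theorem R_eq_sum (s : ℂ) (N : ℕ) :
    RiemannR s = (∑ n ∈ Finset.range N, (n + 1 : ℂ) ^ (-s)) - (1 + I) * JR s (N + 1 / 2) := by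
  have h1I : (1 + I : ℂ) ≠ 0 := by
    intro h; have := congrArg Complex.re h; simp at this
  induction N with
  | zero => rw [R_eq_J]; simp; ring
  | succ N ih =>
    have := JR_step s N
    rw [Finset.sum_range_succ, ih]
    push_cast
    rw [sub_eq_iff_eq_add] at this
    rw [this]
    field_simp
    ring

end RZ

namespace RZ
open Complex Filter Topology Set

theorem arg_le_ratio (x : ℂ) (hre : 0 < x.re) (him : 0 ≤ x.im) : arg x ≤ x.im / x.re := by
  rw [← Complex.tan_arg]
  apply Real.le_tan (Complex.arg_nonneg_iff.mpr him)
  have := (Complex.abs_arg_lt_pi_div_two_iff (z := x)).mpr (Or.inl hre)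
  exact (abs_lt.mp this).2

theorem arg_le_sincos (x : ℂ) (hx : x ≠ 0) (him : x.im < 0) :
    arg x ≤ x.im * x.re / (x.re ^ 2 + x.im ^ 2) := by
  have h0 : arg x < 0 := Complex.arg_neg_iff.mpr him
  have h1 : Real.sin (2 * (-arg x)) ≤ 2 * (-arg x) := Real.sin_le (by linarith)
  rw [Real.sin_two_mul, Real.sin_neg, Real.cos_neg, Complex.sin_arg, Complex.cos_arg hx] at h1
  have h2 : x.re ^ 2 + x.im ^ 2 = ‖x‖ * ‖x‖ := by
    rw [← sq, ← Complex.normSq_eq_norm_sq, Complex.normSq_apply]; ring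
  have h3 : x.im * x.re / (x.re ^ 2 + x.im ^ 2) = (x.im / ‖x‖) * (x.re / ‖x‖) := by
    rw [h2, div_mul_div_comm]
  rw [h3]; nlinarith

theorem arg_le_neg_pi4 (x : ℂ) (hx : x ≠ 0) (him : x.im < 0) (h : x.re + x.im ≤ 0) :
    arg x ≤ -(Real.pi / 4) := by
  by_contra! hc
  have h0 : arg x < 0 := Complex.arg_neg_iff.mpr him
  have h1 : 0 < Real.sin (arg x + Real.pi / 4) :=
    Real.sin_pos_of_pos_of_lt_pi (by linarith) (by linarith [Real.pi_pos])
  rw [Real.sin_add, Real.cos_pi_div_four, Real.sin_pi_div_four, Complex.sin_arg,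
    Complex.cos_arg hx] at h1
  have hp : 0 < ‖x‖ := norm_pos_iff.mpr hx
  have h2 : x.im / ‖x‖ * (√2 / 2) + x.re / ‖x‖ * (√2 / 2) = (x.re + x.im) * (√2 / 2 / ‖x‖) := by
    ring
  rw [h2] at h1
  have : 0 ≤ √2 / 2 / ‖x‖ := by positivity
  nlinarith

theorem exponent_bd (c w t : ℝ) (hc : 3 / 2 ≤ c) (h1 : 2 * Real.pi * (c - 1 / 2) ^ 2 ≤ t)
    (h2 : t ≤ 2 * Real.pi * (c + 1 / 2) ^ 2) :
    t * arg (xl c w) + -(2 * Real.pi * (c * w + w ^ 2)) ≤ 13 - w ^ 2 := by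
  have hpi := Real.pi_gt_three
  have hpi2 := Real.pi_lt_d2
  have hx := xl_ne_zero c w (by linarith)
  suffices hs : t * arg (xl c w) ≤ 2 * Real.pi * (c * w + w ^ 2 + 2 - w ^ 2 / 4) by
    nlinarith [sq_nonneg w]
  have ht : 0 < t := lt_of_lt_of_le (by have : 0 < c - 1 / 2 := by linarith
                                        positivity) h1
  rcases le_or_gt 0 w with hw | hw
  · have ha := arg_le_ratio (xl c w) (by rw [xl_re]; linarith) (by rw [xl_im]; exact hw)
    have ha0 : 0 ≤ arg (xl c w) := Complex.arg_nonneg_iff.mpr (by rw [xl_im]; exact hw)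
    rw [xl_re, xl_im] at ha
    have hcw : 0 < c + w := by linarith
    have hr : 0 ≤ w / (c + w) := by positivity
    have k1 : t * arg (xl c w) ≤ (2 * Real.pi * (c + 1 / 2) ^ 2) * (w / (c + w)) := by
      gcongr
    have k2 : (c + 1 / 2) ^ 2 * (w / (c + w)) ≤ c * w + w ^ 2 + 2 - w ^ 2 / 4 := by
      rw [← mul_div_assoc, div_le_iff₀ hcw]
      nlinarith [mul_nonneg hw (mul_nonneg hw hw), mul_nonneg (by linarith : (0:ℝ) ≤ c) (sq_nonneg (w - 2/7)), mul_nonneg hw hw]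
    nlinarith
  · have hn : arg (xl c w) < 0 := Complex.arg_neg_iff.mpr (by rw [xl_im]; exact hw)
    have k1 : t * arg (xl c w) ≤ (2 * Real.pi * (c - 1 / 2) ^ 2) * arg (xl c w) :=
      mul_le_mul_of_nonpos_right h1 hn.le
    suffices k2 : (c - 1 / 2) ^ 2 * arg (xl c w) ≤ c * w + w ^ 2 + 2 - w ^ 2 / 4 by nlinarith
    rcases le_or_gt (-w) (c / 2) with hb | hb
    · have ha := arg_le_sincos (xl c w) hx (by rw [xl_im]; exact hw)
      rw [xl_re, xl_im] at ha
      have hD : 0 < (c + w) ^ 2 + w ^ 2 := by nlinarith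
      have k3 : (c - 1 / 2) ^ 2 * arg (xl c w) ≤ (c - 1 / 2) ^ 2 * (w * (c + w) / ((c + w) ^ 2 + w ^ 2)) := by
        gcongr
      refine k3.trans ?_
      rw [← mul_div_assoc, div_le_iff₀ hD]
      obtain ⟨P, hP⟩ : ∃ P, P = -w * (c + w) := ⟨_, rfl⟩
      obtain ⟨b, hbb⟩ : ∃ b, b = -w := ⟨_, rfl⟩
      have hwb : w = -b := by linarith
      subst hwb
      have e1 : (c + -b) ^ 2 + (-b) ^ 2 = c ^ 2 - 2 * P := by rw [hP]; ring
      have e2 : c * -b + (-b) ^ 2 + 2 - (-b) ^ 2 / 4 = -P + 2 - b ^ 2 / 4 := by rw [hP]; ring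
      have e3 : -b * (c + -b) = -P := by rw [hP]; ring
      rw [e1] at hD
      rw [e1, e2, e3]
      have hb0 : 0 < b := by linarith
      have p1 : b * c / 2 ≤ P := by rw [hP]; nlinarith
      have p0 : 0 < P := lt_of_lt_of_le (by positivity) p1
      have p2 : P ≤ c ^ 2 / 4 := by rw [hP]; nlinarith [sq_nonneg (c - 2 * b)]
      have p3 : (b * c / 2) ^ 2 ≤ P ^ 2 := by gcongr
      nlinarith [sq_nonneg (P - c / 2), mul_nonneg (sq_nonneg b) p0.le]
    · have ha := arg_le_neg_pi4 (xl c w) hx (by rw [xl_im]; exact hw) (by rw [xl_re, xl_im]; linarith)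
      have k3 : (c - 1 / 2) ^ 2 * arg (xl c w) ≤ (c - 1 / 2) ^ 2 * (-(3 / 4)) := by
        gcongr; linarith
      refine k3.trans ?_
      nlinarith [sq_nonneg (3 * w + 2 * c), sq_nonneg (c - 9 / 10)]

theorem norm_fR_eq (s : ℂ) (c w : ℝ) (hc : 0 < c) :
    ‖fR s (xl c w)‖ = ‖xl c w‖ ^ (-s.re) *
      Real.exp (s.im * arg (xl c w) + -(2 * Real.pi * (c * w + w ^ 2))) := by
  unfold fR
  rw [norm_mul, norm_gauss_xl, Complex.norm_cpow_of_ne_zero (xl_ne_zero c w hc), Real.exp_add]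
  rw [Complex.neg_re, Complex.neg_im, div_eq_mul_inv, ← Real.exp_neg]
  have : -(arg (xl c w) * -s.im) = s.im * arg (xl c w) := by ring
  rw [this, mul_assoc]

theorem exp_half_int : Integrable fun w : ℝ => Real.exp (-(w ^ 2 / 2)) := by
  have := integrable_exp_neg_mul_sq (b := 1 / 2) (by norm_num)
  refine this.congr (Eventually.of_forall fun w => ?_)
  simp only; congr 1; ring

noncomputable def GG : ℝ := ∫ w : ℝ, Real.exp (-(w ^ 2 / 2))

theorem GG_nonneg : 0 ≤ GG := integral_nonneg fun _ => (Real.exp_pos _).le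

theorem JR_bound (s : ℂ) (N : ℕ) (B : ℝ)
    (h : ∀ w, ‖fR s (xl (N + 1 / 2) w)‖ ≤ B * Real.exp (-(w ^ 2 / 2))) :
    ‖(1 + I) * JR s (N + 1 / 2)‖ ≤ B * GG := by
  have h1 : ‖(1 + I : ℂ)‖ ≤ 2 := by
    refine (norm_add_le _ _).trans ?_
    rw [norm_one, Complex.norm_I]; norm_num
  have h2 : ‖JR s (N + 1 / 2)‖ ≤ ∫ w : ℝ, B / 2 * Real.exp (-(w ^ 2 / 2)) := by
    unfold JR
    apply norm_integral_le_of_norm_le (exp_half_int.const_mul _)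
    refine Eventually.of_forall fun w => ?_
    rw [norm_div]
    have h3 := norm_dR_half N w
    calc _ ≤ ‖fR s (xl (N + 1 / 2) w)‖ / 2 := by gcongr
      _ ≤ (B * Real.exp (-(w ^ 2 / 2))) / 2 := by gcongr; exact h w
      _ = _ := by ring
  rw [integral_const_mul] at h2
  rw [norm_mul]
  calc _ ≤ 2 * (B / 2 * GG) := by
        gcongr
        exact h2
    _ = _ := by ring

theorem exists_N (M t : ℝ) (hM : 1 ≤ M) (ht : 2 * Real.pi * (M + 1) ^ 2 ≤ t) :
    ∃ N : ℕ, M ≤ N ∧ (N : ℝ) ^ 2 ≤ t ∧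
      2 * Real.pi * (((N : ℝ) + 1 / 2) - 1 / 2) ^ 2 ≤ t ∧
      t ≤ 2 * Real.pi * (((N : ℝ) + 1 / 2) + 1 / 2) ^ 2 := by
  have hpi := Real.pi_gt_three
  set u := √(t / (2 * Real.pi)) with hu
  have ht0 : 0 ≤ t := le_trans (by positivity) ht
  have hu2 : u ^ 2 = t / (2 * Real.pi) := Real.sq_sqrt (by positivity)
  have hu3 : 2 * Real.pi * u ^ 2 = t := by rw [hu2]; field_simp
  have hu0 : 0 ≤ u := Real.sqrt_nonneg _
  have hMu : M + 1 ≤ u := by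
    apply Real.le_sqrt_of_sq_le
    rw [le_div_iff₀ (by positivity)]; linarith
  have f1 := Nat.floor_le hu0
  have f2 := Nat.lt_floor_add_one u
  refine ⟨⌊u⌋₊, by linarith, ?_, ?_, ?_⟩
  · have : (⌊u⌋₊ : ℝ) ^ 2 ≤ u ^ 2 := by gcongr
    nlinarith [sq_nonneg u]
  · rw [← hu3, add_sub_cancel_right]; gcongr
  · rw [← hu3, add_assoc]; norm_num; gcongr

theorem sum_cube_le (N : ℕ) : ∑ n ∈ Finset.range N, 1 / ((n : ℝ) + 2) ^ 3 ≤ 1 / 2 - 1 / (2 * ((N : ℝ) + 1)) := by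
  induction N with
  | zero => simp
  | succ k ih =>
    rw [Finset.sum_range_succ]
    have : 1 / ((k : ℝ) + 2) ^ 3 ≤ 1 / (2 * (k + 1)) - 1 / (2 * ((k + 1 : ℕ) + 1)) := by
      push_cast
      rw [div_sub_div _ _ (by positivity) (by positivity), div_le_div_iff₀ (by positivity) (by positivity)]
      have : (0 : ℝ) ≤ k := Nat.cast_nonneg k
      nlinarith [mul_nonneg this this, mul_nonneg this (mul_nonneg this this), mul_nonneg this (mul_nonneg this (mul_nonneg this this))]
    linarith

theorem norm_npow (n : ℕ) (s : ℂ) : ‖((n : ℂ) + 1) ^ (-s)‖ = ((n : ℝ) + 1) ^ (-s.re) := by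
  have : ((n : ℂ) + 1) = (((n : ℝ) + 1 : ℝ) : ℂ) := by push_cast; rfl
  rw [this, Complex.norm_cpow_eq_rpow_re_of_pos (by positivity), Complex.neg_re]

theorem sum_sub_one (s : ℂ) (hs : 3 ≤ s.re) (N : ℕ) (hN : 1 ≤ N) :
    ‖(∑ n ∈ Finset.range N, ((n : ℂ) + 1) ^ (-s)) - 1‖ ≤ 1 / 2 := by
  obtain ⟨k, rfl⟩ : ∃ k, N = k + 1 := ⟨N - 1, by omega⟩
  rw [Finset.sum_range_succ']
  simp only [Nat.cast_zero, zero_add, one_cpow, add_sub_cancel_right]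
  refine (norm_sum_le _ _).trans ?_
  have h := sum_cube_le k
  have h' : (0 : ℝ) ≤ 1 / (2 * (k + 1)) := by positivity
  refine le_trans (Finset.sum_le_sum fun n _ => ?_) (h.trans (by linarith))
  rw [norm_npow]
  push_cast
  have e : (n : ℝ) + 1 + 1 = n + 2 := by ring
  rw [e]
  calc ((n : ℝ) + 2) ^ (-s.re) ≤ ((n : ℝ) + 2) ^ (-(3 : ℝ)) :=
        Real.rpow_le_rpow_of_exponent_le (by linarith [Nat.cast_nonneg (α := ℝ) n]) (by linarith)
    _ = _ := by
        rw [Real.rpow_neg (by positivity), one_div]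
        norm_num

theorem R_right : ∃ t0 ≥ (1 : ℝ), ∀ s : ℂ, 3 ≤ s.re → t0 ≤ s.im → ‖RiemannR s - 1‖ ≤ 3 / 4 := by
  have hG := GG_nonneg
  set M : ℝ := 8 * Real.exp 13 * (GG + 1) + 2 with hM
  have hM1 : 2 ≤ M := by rw [hM]; have : 0 ≤ 8 * Real.exp 13 * (GG + 1) := by positivity
                         linarith
  refine ⟨2 * Real.pi * (M + 1) ^ 2, ?_, ?_⟩
  · have hpi := Real.pi_gt_three
    have : 1 ≤ (M + 1) ^ 2 := by nlinarith
    nlinarith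
  intro s hs ht
  obtain ⟨N, hN, -, h1, h2⟩ := exists_N M s.im (by linarith) ht
  have hN1 : 1 ≤ N := by
    have : (1 : ℝ) ≤ N := by linarith
    exact_mod_cast this
  rw [R_eq_sum s N]
  have hJ := JR_bound s N (Real.exp 13 * (2 / M)) (by
    intro w
    rw [norm_fR_eq s _ w (by positivity)]
    have k1 := exponent_bd (N + 1 / 2) w s.im (by linarith) h1 h2
    have k2 := xl_norm_ge (N + 1 / 2) w (by positivity)
    have k3 : ‖xl (N + 1 / 2) w‖ ^ (-s.re) ≤ 2 / M := by
      have : M / 2 ≤ ‖xl (N + 1 / 2) w‖ := by linarith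
      calc _ ≤ ‖xl (N + 1 / 2) w‖ ^ (-(1 : ℝ)) :=
            Real.rpow_le_rpow_of_exponent_le (by linarith) (by linarith)
        _ = ‖xl (N + 1 / 2) w‖⁻¹ := Real.rpow_neg_one _
        _ ≤ (M / 2)⁻¹ := by gcongr
        _ = 2 / M := by rw [inv_div]
    calc _ ≤ 2 / M * (Real.exp 13 * Real.exp (-(w ^ 2 / 2))) := by
          rw [← Real.exp_add]
          refine mul_le_mul k3 (Real.exp_le_exp.mpr ?_) (Real.exp_pos _).le (by positivity)
          nlinarith [sq_nonneg w]
      _ = _ := by ring)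
  have hJ2 : Real.exp 13 * (2 / M) * GG ≤ 1 / 4 := by
    have : Real.exp 13 * (2 / M) * GG = (2 * Real.exp 13 * GG) / M := by ring
    rw [this, div_le_iff₀ (by linarith), hM]
    nlinarith [Real.exp_pos 13]
  have hS := sum_sub_one s hs N hN1
  have e : (∑ n ∈ Finset.range N, ((n : ℂ) + 1) ^ (-s)) - (1 + I) * JR s (N + 1 / 2) - 1 =
    ((∑ n ∈ Finset.range N, ((n : ℂ) + 1) ^ (-s)) - 1) - (1 + I) * JR s (N + 1 / 2) := by ring
  rw [e]
  refine (norm_sub_le _ _).trans ?_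
  linarith

theorem R_poly : ∃ K > (0 : ℝ), ∃ t0 ≥ (1 : ℝ), ∀ s : ℂ, -7 ≤ s.re → t0 ≤ s.im →
    ‖RiemannR s‖ ≤ K * s.im ^ 8 := by
  have hG := GG_nonneg
  have hpi := Real.pi_gt_three
  refine ⟨1 + 2 ^ 7 * Real.exp 111 * GG, by positivity, 2 * Real.pi * (2 + 1) ^ 2, by nlinarith, ?_⟩
  intro s hs ht
  obtain ⟨N, hN, hNt, h1, h2⟩ := exists_N 2 s.im (by linarith) ht
  have ht1 : 1 ≤ s.im := by nlinarith
  have hNt' : (N : ℝ) ≤ s.im := by nlinarith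
  rw [R_eq_sum s N]
  have hJ := JR_bound s N ((2 * s.im) ^ 7 * Real.exp 111) (by
    intro w
    rw [norm_fR_eq s _ w (by positivity)]
    have k1 := exponent_bd (N + 1 / 2) w s.im (by linarith) h1 h2
    have k2 := xl_norm_ge (N + 1 / 2) w (by positivity)
    have k2' := xl_norm_le (N + 1 / 2) w (by positivity)
    have hw := abs_nonneg w
    have k4 : ‖xl (N + 1 / 2) w‖ ≤ (2 * s.im) * Real.exp (2 * |w|) := by
      have := Real.add_one_le_exp (2 * |w|)
      calc _ ≤ (N + 1 / 2) + 2 * |w| := k2'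
        _ ≤ (2 * s.im) * (2 * |w| + 1) := by nlinarith
        _ ≤ _ := by gcongr
    have k3 : ‖xl (N + 1 / 2) w‖ ^ (-s.re) ≤ (2 * s.im) ^ 7 * Real.exp (14 * |w|) := by
      calc _ ≤ ‖xl (N + 1 / 2) w‖ ^ ((7 : ℕ) : ℝ) :=
            Real.rpow_le_rpow_of_exponent_le (by linarith) (by push_cast; linarith)
        _ = ‖xl (N + 1 / 2) w‖ ^ 7 := Real.rpow_natCast _ _
        _ ≤ ((2 * s.im) * Real.exp (2 * |w|)) ^ 7 := by gcongr
        _ = _ := by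
          rw [mul_pow, ← Real.exp_nat_mul]; congr 2; push_cast; ring
    calc _ ≤ (2 * s.im) ^ 7 * Real.exp (14 * |w|) * Real.exp (13 - w ^ 2) := by gcongr
      _ = (2 * s.im) ^ 7 * Real.exp (14 * |w| + (13 - w ^ 2)) := by rw [Real.exp_add]; ring
      _ ≤ (2 * s.im) ^ 7 * Real.exp (111 + -(w ^ 2 / 2)) := by
        refine mul_le_mul_of_nonneg_left (Real.exp_le_exp.mpr ?_) (by positivity)
        nlinarith [sq_nonneg (|w| - 14), sq_abs w]
      _ = _ := by rw [Real.exp_add]; ring)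
  have hS : ‖∑ n ∈ Finset.range N, ((n : ℂ) + 1) ^ (-s)‖ ≤ s.im ^ 8 := by
    refine (norm_sum_le _ _).trans ?_
    calc ∑ n ∈ Finset.range N, ‖((n : ℂ) + 1) ^ (-s)‖ ≤ ∑ n ∈ Finset.range N, s.im ^ 7 := by
          apply Finset.sum_le_sum
          intro n hn
          have : n + 1 ≤ N := Finset.mem_range.mp hn
          have hn' : (n : ℝ) + 1 ≤ N := by exact_mod_cast this
          rw [norm_npow]
          calc ((n : ℝ) + 1) ^ (-s.re) ≤ ((n : ℝ) + 1) ^ ((7 : ℕ) : ℝ) :=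
                Real.rpow_le_rpow_of_exponent_le (by linarith [Nat.cast_nonneg (α := ℝ) n])
                  (by push_cast; linarith)
            _ = ((n : ℝ) + 1) ^ 7 := Real.rpow_natCast _ _
            _ ≤ s.im ^ 7 := by gcongr; linarith
      _ = N * s.im ^ 7 := by simp
      _ ≤ s.im * s.im ^ 7 := by gcongr
      _ = _ := by ring
  refine (norm_sub_le _ _).trans ?_
  have : s.im ^ 7 ≤ s.im ^ 8 := pow_le_pow_right₀ ht1 (by norm_num)
  calc _ ≤ s.im ^ 8 + (2 * s.im) ^ 7 * Real.exp 111 * GG := by linarith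
    _ = s.im ^ 8 + 2 ^ 7 * Real.exp 111 * GG * s.im ^ 7 := by ring
    _ ≤ s.im ^ 8 + 2 ^ 7 * Real.exp 111 * GG * s.im ^ 8 := by gcongr
    _ = _ := by ring

theorem R_right_bdd (t0 : ℝ) : ∃ σ1 : ℝ, ∀ s : ℂ, σ1 ≤ s.re → 0 ≤ s.im → s.im ≤ t0 →
    ‖RiemannR s - 1‖ ≤ 3 / 4 := by
  have hG := GG_nonneg
  have hlim : Tendsto (fun x : ℝ => (100 / 106 : ℝ) ^ x * Real.exp (4 * t0 + 14) * GG) atTop (𝓝 0) := by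
    have := ((tendsto_rpow_atTop_of_base_lt_one (100 / 106 : ℝ) (by norm_num) (by norm_num)).mul_const
      (Real.exp (4 * t0 + 14))).mul_const GG
    simpa using this
  obtain ⟨σ1, hσ⟩ := (hlim.eventually (gt_mem_nhds (by norm_num : (0 : ℝ) < 3 / 4))).exists_forall_of_atTop
  refine ⟨max σ1 0, ?_⟩
  intro s hs h0 ht
  have hs0 : 0 ≤ s.re := (le_max_right _ _).trans hs
  have hs1 : σ1 ≤ s.re := (le_max_left _ _).trans hs
  rw [R_eq_sum s 1]
  simp only [Finset.range_one, Finset.sum_singleton, Nat.cast_zero, zero_add, one_cpow]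
  have hJ := JR_bound s 1 ((100 / 106 : ℝ) ^ s.re * Real.exp (4 * t0 + 14)) (by
    intro w
    rw [norm_fR_eq s _ w (by positivity)]
    have k2 : 106 / 100 ≤ ‖xl ((1 : ℕ) + 1 / 2) w‖ := by
      apply le_of_sq_le_sq _ (norm_nonneg _)
      rw [← Complex.normSq_eq_norm_sq, xl, Complex.normSq_add_mul_I]
      push_cast
      nlinarith [sq_nonneg (4 * w + 3)]
    have k3 : ‖xl ((1 : ℕ) + 1 / 2) w‖ ^ (-s.re) ≤ (100 / 106 : ℝ) ^ s.re := by
      calc _ ≤ (106 / 100 : ℝ) ^ (-s.re) :=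
            Real.rpow_le_rpow_of_nonpos (by norm_num) k2 (by linarith)
        _ = _ := by
          rw [Real.rpow_neg (by norm_num), ← Real.inv_rpow (by norm_num)]; norm_num
    have k5 : s.im * arg (xl ((1 : ℕ) + 1 / 2) w) ≤ 4 * t0 := by
      have := Complex.arg_le_pi (xl ((1 : ℕ) + 1 / 2) w)
      have := Real.pi_lt_four
      nlinarith
    rw [mul_assoc ((100 / 106 : ℝ) ^ s.re), ← Real.exp_add]
    refine mul_le_mul k3 (Real.exp_le_exp.mpr ?_) (Real.exp_pos _).le (by positivity)
    have hpi := Real.pi_gt_three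
    have hpi4 := Real.pi_lt_d2
    push_cast
    nlinarith [sq_nonneg (w + 3 / 4), sq_nonneg (w + 9/10)])
  have := hσ _ hs1
  have e : (1 : ℂ) - (1 + I) * JR s ((1 : ℕ) + 1 / 2) - 1 = -((1 + I) * JR s ((1 : ℕ) + 1 / 2)) := by ring
  rw [e, norm_neg]
  linarith

end RZ

namespace RZ
open Complex Filter Topology Set

theorem integrable_exp_neg_abs : Integrable fun x : ℝ => Real.exp (-|x|) := by
  refine (integrable_inv_one_add_sq.const_mul 2).mono' (by fun_prop) (Eventually.of_forall fun x => ?_)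
  rw [Real.norm_of_nonneg (Real.exp_pos _).le, Real.exp_neg]
  have h := Real.quadratic_le_exp_of_nonneg (abs_nonneg x)
  rw [sq_abs] at h
  have : (1 + x ^ 2) / 2 ≤ Real.exp |x| := by
    linarith [abs_nonneg x]
  calc (Real.exp |x|)⁻¹ ≤ ((1 + x ^ 2) / 2)⁻¹ := by gcongr
    _ = _ := by field_simp

theorem dR_zero : dR 0 = 0 := by simp [dR]

theorem dR_neg (x : ℂ) : dR (-x) = -dR x := by
  unfold dR
  simp

theorem dR_deriv0 : deriv dR 0 = 2 * Real.pi * I := by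
  have h : HasDerivAt dR (2 * Real.pi * I) 0 := by
    unfold dR
    have h1 : HasDerivAt (fun x : ℂ => (Real.pi : ℂ) * I * x) (Real.pi * I) 0 := by
      simpa using (hasDerivAt_id (0 : ℂ)).const_mul ((Real.pi : ℂ) * I)
    refine (h1.cexp.sub h1.neg.cexp).congr_deriv ?_
    simp; ring
  exact h.deriv

theorem diff_dslope : Differentiable ℂ (dslope dR 0) := by
  rw [← differentiableOn_univ]
  exact (Complex.differentiableOn_dslope univ_mem).2 diff_dR.differentiableOn

theorem dslope_mul (x : ℂ) : dR x = x * dslope dR 0 x := by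
  have := sub_smul_dslope dR 0 x
  rw [dR_zero, sub_zero, sub_zero, smul_eq_mul] at this
  exact this.symm

theorem dslope_ne (x : ℂ) (h : ∀ n : ℤ, n ≠ 0 → x ≠ n) : dslope dR 0 x ≠ 0 := by
  by_cases hx : x = 0
  · rw [hx, dslope_same, dR_deriv0]
    simp [Real.pi_ne_zero]
  · have h1 : dR x ≠ 0 := by
      apply dR_ne_zero
      intro n
      by_cases hn : n = 0
      · rw [hn]; simpa using hx
      · exact h n hn
    rw [dslope_mul] at h1
    exact right_ne_zero_of_mul h1

/-- regularised integrand in the coordinate x = (1+I) z -/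
noncomputable def GJ (s z : ℂ) : ℂ :=
  ((1 + I) * z) ^ (-s - 1) * exp (Real.pi * I * ((1 + I) * z) ^ 2) / dslope dR 0 ((1 + I) * z)

theorem one_add_I_ne : (1 + I : ℂ) ≠ 0 := by
  intro h; have := congrArg Complex.re h; simp at this

theorem GJ_eq (s z : ℂ) (hz : z ≠ 0) : GJ s z = fR s ((1 + I) * z) / dR ((1 + I) * z) := by
  have hx : (1 + I) * z ≠ 0 := mul_ne_zero one_add_I_ne hz
  unfold GJ fR
  rw [dslope_mul, cpow_sub _ _ hx, cpow_one]
  field_simp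

theorem x_re (z : ℂ) : ((1 + I) * z).re = z.re - z.im := by simp
theorem x_im (z : ℂ) : ((1 + I) * z).im = z.re + z.im := by simp; ring

theorem GJ_den (z : ℂ) (h1 : -(1 / 4) ≤ z.im) (h2 : z.im ≤ 0) : dslope dR 0 ((1 + I) * z) ≠ 0 := by
  apply dslope_ne
  intro n hn h
  have e1 := congrArg Complex.re h
  have e2 := congrArg Complex.im h
  rw [x_re, intCast_re] at e1
  rw [x_im, intCast_im] at e2
  have h3 : (-1 : ℝ) < n := by linarith
  have h4 : (n : ℝ) < 1 := by linarith
  have h5 : -1 < n := by exact_mod_cast h3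
  have h6 : n < 1 := by exact_mod_cast h4
  omega

theorem GJ_cont (s : ℂ) (hs : s.re < -1) (z : ℂ) (h1 : -(1 / 4) ≤ z.im) (h2 : z.im ≤ 0) :
    ContinuousAt (GJ s) z := by
  unfold GJ
  have hl : ContinuousAt (fun z : ℂ => (1 + I) * z) z := by fun_prop
  apply ContinuousAt.div
  · apply ContinuousAt.mul
    · refine ContinuousAt.comp (f := fun z : ℂ => (1 + I) * z) (g := fun x : ℂ => x ^ (-s - 1)) ?_ hl
      apply continuousAt_cpow_const_of_re_pos
      · rw [x_re, x_im]
        by_cases h : z.re + z.im = 0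
        · left; linarith
        · right; exact h
      · simp; linarith
    · fun_prop
  · exact ContinuousAt.comp (f := fun z : ℂ => (1 + I) * z) (g := dslope dR 0)
      diff_dslope.continuous.continuousAt hl
  · exact GJ_den z h1 h2

theorem GJ_diff (s : ℂ) (z : ℂ) (h1 : -(1 / 4) < z.im) (h2 : z.im < 0) :
    DifferentiableAt ℂ (GJ s) z := by
  unfold GJ
  have hl : DifferentiableAt ℂ (fun z : ℂ => (1 + I) * z) z := by fun_prop
  apply DifferentiableAt.div
  · apply DifferentiableAt.mul
    · apply DifferentiableAt.cpow_const hl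
      rw [mem_slitPlane_iff, x_re, x_im]
      by_cases h : z.re + z.im = 0
      · left; linarith
      · right; exact h
    · fun_prop
  · exact (diff_dslope _).comp z hl
  · exact GJ_den z h1.le h2.le

theorem GJ_bound (s : ℂ) (X Y : ℝ) (hX : 2 ≤ |X|) (h1 : -(1 / 4) ≤ Y) (h2 : Y ≤ 0) :
    ‖GJ s (X + Y * I)‖ ≤ Real.exp (7 * ‖s‖ + (2 * ‖s‖) ^ 2 + 1) * Real.exp (-(X ^ 2 / 2)) := by
  set z : ℂ := X + Y * I with hz
  have hzr : z.re = X := by simp [hz]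
  have hzi : z.im = Y := by simp [hz]
  have hX2 : 4 ≤ X ^ 2 := by rw [← sq_abs]; nlinarith
  have hz0 : z ≠ 0 := by
    intro h; rw [h] at hzr; simp at hzr; rw [← hzr] at hX2; norm_num at hX2
  rw [GJ_eq s z hz0]
  set x : ℂ := (1 + I) * z with hx
  have hx0 : x ≠ 0 := mul_ne_zero one_add_I_ne hz0
  have hxr : x.re = X - Y := by rw [hx, x_re, hzr, hzi]
  have hxi : x.im = X + Y := by rw [hx, x_im, hzr, hzi]
  have hYa : |Y| ≤ 1 / 4 := by rw [abs_le]; constructor <;> linarith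
  have hn : ‖x‖ ≤ 2 * |X| + 1 / 2 := by
    refine (Complex.norm_le_abs_re_add_abs_im x).trans ?_
    rw [hxr, hxi]
    have := abs_sub X Y
    have := abs_add_le X Y
    linarith
  have hi : 1 ≤ |x.im| := by
    rw [hxi]
    have := abs_sub_abs_le_abs_sub X (-Y)
    rw [abs_neg, sub_neg_eq_add] at this
    linarith
  have hn1 : 1 ≤ ‖x‖ := hi.trans (Complex.abs_im_le_norm x)
  have hlog := norm_log_le' x hx0
  have hlog2 : ‖log x‖ ≤ 2 * |X| + 6 := by
    have : 1 / ‖x‖ ≤ 1 := by rw [div_le_one (by linarith)]; exact hn1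
    linarith
  have hd : 1 ≤ ‖dR x‖ := by linarith [norm_dR_ge x]
  rw [norm_div]
  refine (div_le_self (norm_nonneg _) hd).trans ?_
  unfold fR
  rw [norm_mul, cpow_eq s x hx0, Complex.norm_exp, Complex.norm_exp, ← Real.exp_add, ← Real.exp_add]
  apply Real.exp_le_exp.mpr
  have e1 : (-s * log x).re ≤ ‖s‖ * (2 * |X| + 6) := by
    refine (Complex.re_le_norm _).trans ?_
    rw [norm_mul, norm_neg]; gcongr
  have e2 : ((Real.pi : ℂ) * I * x ^ 2).re = - (2 * Real.pi * (X ^ 2 - Y ^ 2)) := by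
    have : (Real.pi : ℂ) * I * x ^ 2 = ((-(2 * Real.pi) : ℝ) : ℂ) * z ^ 2 := by
      rw [hx]; push_cast; linear_combination ((Real.pi : ℂ) * I * z ^ 2 + 2 * Real.pi * z ^ 2) * I_sq
    rw [this, Complex.re_ofReal_mul, sq z, Complex.mul_re, hzr, hzi]; ring
  rw [e2]
  have hpi := Real.pi_gt_three
  have hY2 : Y ^ 2 ≤ 1 / 16 := by rw [← sq_abs]; nlinarith [abs_nonneg Y]
  have hs := norm_nonneg s
  nlinarith [sq_nonneg (|X| - 2 * ‖s‖), sq_abs X, sq_nonneg (|X| - ‖s‖)]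

theorem integrable_of_tail (g : ℝ → ℂ) (hg : Continuous g) (C : ℝ)
    (h : ∀ X : ℝ, 2 ≤ |X| → ‖g X‖ ≤ C * Real.exp (-(X ^ 2 / 2))) : Integrable g := by
  obtain ⟨M, hM⟩ := (isCompact_Icc (a := (-2 : ℝ)) (b := 2)).exists_bound_of_continuousOn hg.continuousOn
  have hM0 : 0 ≤ M := (norm_nonneg _).trans (hM 0 (by constructor <;> norm_num))
  have hC : 0 ≤ C := by
    have := (norm_nonneg _).trans (h 2 (by norm_num))
    exact nonneg_of_mul_nonneg_left this (Real.exp_pos _)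
  refine (exp_half_int.const_mul (C + M * Real.exp 2)).mono' hg.aestronglyMeasurable
    (Eventually.of_forall fun X => ?_)
  rcases le_or_gt 2 |X| with hX | hX
  · refine (h X hX).trans ?_
    gcongr
    have : 0 ≤ M * Real.exp 2 := by positivity
    linarith
  · have h1 := hM X (by rw [abs_lt] at hX; exact ⟨hX.1.le, hX.2.le⟩)
    have h2 : 1 ≤ Real.exp 2 * Real.exp (-(X ^ 2 / 2)) := by
      rw [← Real.exp_add]
      apply Real.one_le_exp
      rw [← sq_abs]; nlinarith [abs_nonneg X]
    calc ‖g X‖ ≤ M * 1 := by linarith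
      _ ≤ M * (Real.exp 2 * Real.exp (-(X ^ 2 / 2))) := by gcongr
      _ ≤ _ := by
        have : 0 ≤ C * Real.exp (-(X ^ 2 / 2)) := by positivity
        linarith

theorem GJ_line (s : ℂ) (hs : s.re < -1) (Y : ℝ) (h1 : -(1 / 4) ≤ Y) (h2 : Y ≤ 0) :
    Integrable fun X : ℝ => GJ s (X + Y * I) := by
  apply integrable_of_tail _ _ _ (fun X hX => GJ_bound s X Y hX h1 h2)
  rw [continuous_iff_continuousAt]
  intro X
  exact ContinuousAt.comp (g := GJ s) (f := fun X : ℝ => (X : ℂ) + Y * I)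
    (GJ_cont s hs _ (by simpa using h1) (by simpa using h2)) (by fun_prop)

theorem JR_zero (s : ℂ) (hs : s.re < -1) : JR s (1 / 2) = ∫ X : ℝ, GJ s (X : ℂ) := by
  have key := hshift (GJ s) (-(1 / 4)) 0 (by norm_num)
    (fun z hz => (GJ_cont s hs z hz.1 hz.2).continuousWithinAt)
    (fun z h1 h2 => GJ_diff s z h1 h2)
    (fun X => Real.exp (7 * ‖s‖ + (2 * ‖s‖) ^ 2 + 1) * Real.exp (-(X ^ 2 / 2)))
    (tendsto_exp_half _ atTop tendsto_abs_atTop_atTop)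
    (tendsto_exp_half _ atBot tendsto_abs_atBot_atTop) 2
    (fun x y hx h1 h2 => GJ_bound s x y hx h1 h2)
    (GJ_line s hs _ le_rfl (by norm_num)) (GJ_line s hs 0 (by norm_num) le_rfl)
  simp only [ofReal_zero, zero_mul, add_zero] at key
  rw [← key]
  unfold JR
  rw [← integral_sub_right_eq_self (fun w => fR s (xl (1 / 2) w) / dR (xl (1 / 2) w)) (1/4)]
  congr 1; funext X
  rw [GJ_eq]
  · have := xl_strip 0 X (-(1 / 4))
    simp only [ofReal_zero, zero_add] at this
    rw [this]
    ring_nf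
  · intro h
    have := congrArg Complex.im h
    simp at this

/-- integrand in logarithmic coordinates -/
noncomputable def HR (s w : ℂ) : ℂ := exp ((1 - s) * w + Real.pi * I * exp w ^ 2) / dR (exp w)

theorem cpow_exp (s w : ℂ) (h1 : -Real.pi < w.im) (h2 : w.im ≤ Real.pi) :
    (exp w) ^ (-s) = exp (-s * w) := by
  rw [cpow_eq _ _ (exp_ne_zero w), Complex.log_exp h1 h2]

theorem GJ_neg (s : ℂ) (X : ℝ) (hX : 0 < X) :
    GJ s ((-X : ℝ) : ℂ) = -exp (Real.pi * I * s) * GJ s (X : ℂ) := by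
  have hX0 : (X : ℂ) ≠ 0 := by exact_mod_cast hX.ne'
  rw [GJ_eq s _ (by exact_mod_cast (neg_ne_zero.mpr hX.ne')), GJ_eq s _ hX0]
  push_cast
  rw [mul_neg, dR_neg]
  set x : ℂ := (1 + I) * X with hx
  have hx0 : x ≠ 0 := mul_ne_zero one_add_I_ne hX0
  have hlog : log (-x) = log x - Real.pi * I := by
    have : 0 < x.im := by rw [hx, x_im]; simp [hX]
    apply Complex.ext
    · rw [Complex.log_re, norm_neg, Complex.sub_re, Complex.log_re]; simp
    · rw [Complex.log_im, Complex.sub_im, Complex.log_im, Complex.arg_neg_eq_arg_sub_pi_of_im_pos this]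
      simp
  unfold fR
  rw [cpow_eq _ _ hx0, cpow_eq _ _ (neg_ne_zero.mpr hx0), hlog, neg_sq]
  have : exp (-s * (log x - Real.pi * I)) = exp (-s * log x) * exp (Real.pi * I * s) := by
    rw [← Complex.exp_add]; congr 1; ring
  rw [this, div_neg]
  ring

theorem GJ_half (s : ℂ) : (1 + I) * ∫ X in Ioi (0 : ℝ), GJ s (X : ℂ) =
    ∫ y : ℝ, HR s (y + (Real.pi / 4 : ℝ) * I) := by
  have h2 : (0 : ℝ) < √2 := by positivity
  have him : (fun y : ℝ => Real.exp y / √2) '' univ = Ioi 0 := by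
    ext x
    simp only [image_univ, mem_range, mem_Ioi]
    constructor
    · rintro ⟨y, rfl⟩; positivity
    · intro hx
      refine ⟨Real.log (x * √2), ?_⟩
      rw [Real.exp_log (by positivity)]; field_simp
  rw [← him, integral_image_eq_integral_abs_deriv_smul (f' := fun y => Real.exp y / √2) MeasurableSet.univ
    (fun y _ => ((Real.hasDerivAt_exp y).div_const _).hasDerivWithinAt)
    (fun a _ b _ h => by
      rw [div_left_inj' h2.ne'] at h
      exact Real.exp_injective h)]
  rw [setIntegral_univ, ← integral_const_mul]
  congr 1; funext y
  have hpos : 0 < Real.exp y / √2 := by positivity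
  have hw : (1 + I) * ((Real.exp y / √2 : ℝ) : ℂ) = exp (y + (Real.pi / 4 : ℝ) * I) := by
    rw [Complex.exp_add, Complex.exp_mul_I, ← Complex.ofReal_cos, ← Complex.ofReal_sin,
      Real.cos_pi_div_four, Real.sin_pi_div_four, ← Complex.ofReal_exp]
    have : √2 / 2 = 1 / √2 := by
      rw [div_eq_div_iff (by norm_num) h2.ne']; nlinarith [Real.mul_self_sqrt (show (0:ℝ) ≤ 2 by norm_num)]
    rw [this]
    push_cast; ring
  rw [abs_of_pos hpos, GJ_eq _ _ (by exact_mod_cast hpos.ne'), hw]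
  unfold HR fR
  rw [cpow_exp _ _ (by simp; linarith [Real.pi_pos]) (by simp; linarith [Real.pi_pos])]
  rw [Complex.real_smul, ← mul_assoc, hw, ← mul_div_assoc, ← mul_assoc, ← Complex.exp_add,
    ← Complex.exp_add]
  congr 2
  ring

theorem R_eq_H (s : ℂ) (hs : s.re < -1) :
    RiemannR s = (exp (Real.pi * I * s) - 1) * ∫ y : ℝ, HR s (y + (Real.pi / 4 : ℝ) * I) := by
  rw [R_eq_J, JR_zero s hs, ← GJ_half]
  have hIntg : Integrable fun X : ℝ => GJ s (X : ℂ) := by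
    simpa using GJ_line s hs 0 (by norm_num) le_rfl
  rw [← intervalIntegral.integral_Iic_add_Ioi (b := (0:ℝ)) hIntg.integrableOn hIntg.integrableOn]
  have hneg : ∫ X in Iic (0 : ℝ), GJ s (X : ℂ) = -exp (Real.pi * I * s) * ∫ X in Ioi (0 : ℝ), GJ s (X : ℂ) := by
    have := integral_comp_neg_Ioi (0 : ℝ) (fun X : ℝ => GJ s (X : ℂ))
    rw [neg_zero] at this
    rw [← this, ← integral_const_mul]
    apply setIntegral_congr_fun measurableSet_Ioi
    intro X hX
    exact GJ_neg s X hX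
  rw [hneg]
  ring

end RZ

namespace RZ
open Complex Filter Topology Set

theorem expo_bound (A k x : ℝ) (hA : 1 ≤ A) (hk : 0 < k) :
    A * x - k * Real.exp (2 * x) ≤ (A + 1) ^ 2 / (8 * k) - |x| := by
  have hK : 0 ≤ (A + 1) ^ 2 / (8 * k) := by positivity
  have he := Real.exp_pos (2 * x)
  rcases le_or_gt x 0 with hx | hx
  · rw [abs_of_nonpos hx]; nlinarith
  · rw [abs_of_pos hx]
    have h1 := Real.quadratic_le_exp_of_nonneg (show 0 ≤ 2 * x by linarith)
    have h2 : 2 * x ^ 2 ≤ Real.exp (2 * x) := by nlinarith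
    have h3 : (A + 1) * x - 2 * k * x ^ 2 ≤ (A + 1) ^ 2 / (8 * k) := by
      rw [le_div_iff₀ (by positivity)]
      nlinarith [sq_nonneg (A + 1 - 4 * k * x)]
    nlinarith

/-- exponential part in logarithmic coordinates -/
noncomputable def PR (s : ℂ) (κ : ℝ) (w : ℂ) : ℂ :=
  exp ((1 - s) * w + Real.pi * I * exp w ^ 2 + 2 * Real.pi * I * κ * exp w)

theorem PR_diff (s : ℂ) (κ : ℝ) : Differentiable ℂ (PR s κ) := by unfold PR; fun_prop

theorem exp_im_sin (w : ℂ) : (exp w).im = Real.exp w.re * Real.sin w.im := Complex.exp_im w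

theorem exp_sq_im (w : ℂ) : (exp w ^ 2).im = Real.exp (2 * w.re) * Real.sin (2 * w.im) := by
  rw [← Complex.exp_nat_mul, Complex.exp_im]
  simp

theorem norm_PR (s : ℂ) (κ : ℝ) (w : ℂ) : ‖PR s κ w‖ =
    Real.exp ((1 - s.re) * w.re + s.im * w.im - Real.pi * (Real.exp (2 * w.re) * Real.sin (2 * w.im))
      - 2 * Real.pi * κ * (Real.exp w.re * Real.sin w.im)) := by
  unfold PR
  rw [Complex.norm_exp, ← exp_sq_im, ← exp_im_sin]
  congr 1
  have e1 : (Real.pi : ℂ) * I * exp w ^ 2 = (Real.pi : ℝ) * (I * exp w ^ 2) := by ring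
  have e2 : 2 * (Real.pi : ℂ) * I * κ * exp w = ((2 * Real.pi * κ : ℝ) : ℂ) * (I * exp w) := by
    push_cast; ring
  rw [e1, e2, Complex.add_re, Complex.add_re, Complex.re_ofReal_mul, Complex.re_ofReal_mul,
    Complex.I_mul_re, Complex.I_mul_re, Complex.mul_re]
  simp
  ring

theorem HR_eq (s w : ℂ) : HR s w = PR s 0 w / dR (exp w) := by
  unfold HR PR; simp

theorem HR_bound (s : ℂ) (hs : s.re < -1) (θ : ℝ) (h0 : 0 < θ) (x y : ℝ) (h1 : θ ≤ y)
    (h2 : y ≤ Real.pi / 4) :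
    ‖HR s (x + y * I)‖ ≤ Real.exp (|s.im| * 4 + (-s.re + 1) ^ 2 / (8 * (Real.pi * Real.sin (2 * θ)))) /
      Real.sin θ * Real.exp (-|x|) := by
  have hpi := Real.pi_pos
  have hpi4 := Real.pi_lt_four
  have s1 : 0 < Real.sin θ := Real.sin_pos_of_pos_of_lt_pi h0 (by linarith)
  have s2 : 0 < Real.sin (2 * θ) := Real.sin_pos_of_pos_of_lt_pi (by linarith) (by linarith)
  have m1 : Real.sin θ ≤ Real.sin y :=
    Real.sin_le_sin_of_le_of_le_pi_div_two (by linarith) (by linarith) h1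
  have m2 : Real.sin (2 * θ) ≤ Real.sin (2 * y) :=
    Real.sin_le_sin_of_le_of_le_pi_div_two (by linarith) (by linarith) (by linarith)
  rw [HR_eq, norm_div, norm_PR]
  have hre : ((x : ℂ) + y * I).re = x := by simp
  have him : ((x : ℂ) + y * I).im = y := by simp
  rw [hre, him]
  have hd : Real.exp x * Real.sin θ ≤ ‖dR (exp (x + y * I))‖ := by
    have := norm_dR_ge (exp (x + y * I))
    rw [exp_im_sin, hre, him] at this
    have h3 : Real.exp x * Real.sin θ ≤ |Real.exp x * Real.sin y| := by
      refine le_trans ?_ (le_abs_self _)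
      gcongr
    have : 0 ≤ |Real.exp x * Real.sin y| := abs_nonneg _
    linarith
  have hp : 0 < Real.exp x * Real.sin θ := by positivity
  have key := expo_bound (-s.re) (Real.pi * Real.sin (2 * θ)) x (by linarith) (by positivity)
  calc _ ≤ Real.exp ((1 - s.re) * x + s.im * y - Real.pi * (Real.exp (2 * x) * Real.sin (2 * y))
      - 2 * Real.pi * 0 * (Real.exp x * Real.sin y)) / (Real.exp x * Real.sin θ) := by gcongr
    _ = Real.exp (-s.re * x + s.im * y - Real.pi * (Real.exp (2 * x) * Real.sin (2 * y))) / Real.sin θ := by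
      have e : Real.exp ((1 - s.re) * x + s.im * y - Real.pi * (Real.exp (2 * x) * Real.sin (2 * y))
          - 2 * Real.pi * 0 * (Real.exp x * Real.sin y)) =
          Real.exp (-s.re * x + s.im * y - Real.pi * (Real.exp (2 * x) * Real.sin (2 * y))) * Real.exp x := by
        rw [← Real.exp_add]; congr 1; ring
      rw [e]
      field_simp
    _ ≤ Real.exp ((|s.im| * 4 + (-s.re + 1) ^ 2 / (8 * (Real.pi * Real.sin (2 * θ)))) + -|x|) / Real.sin θ := by
      gcongr
      have h5 : s.im * y ≤ |s.im| * 4 := by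
        have := le_abs_self s.im
        have := abs_nonneg s.im
        nlinarith
      have h6 : Real.pi * Real.sin (2 * θ) * Real.exp (2 * x) ≤ Real.pi * (Real.exp (2 * x) * Real.sin (2 * y)) := by
        rw [mul_assoc, mul_comm (Real.sin _)]; gcongr
      linarith
    _ = _ := by rw [Real.exp_add]; ring

theorem HR_contAt (s w : ℂ) (h1 : 0 < w.im) (h2 : w.im < Real.pi) : DifferentiableAt ℂ (HR s) w := by
  have : dR (exp w) ≠ 0 := by
    apply dR_ne_zero
    intro n hn
    have := congrArg Complex.im hn
    rw [exp_im_sin, intCast_im] at this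
    have := Real.sin_pos_of_pos_of_lt_pi h1 h2
    have := Real.exp_pos w.re
    nlinarith
  unfold HR
  have h3 : DifferentiableAt ℂ (fun w => dR (exp w)) w := (diff_dR _).comp w (by fun_prop)
  exact DifferentiableAt.div (by fun_prop) h3 this

theorem HR_int (s : ℂ) (hs : s.re < -1) (θ : ℝ) (h0 : 0 < θ) (h1 : θ ≤ Real.pi / 4) :
    Integrable fun x : ℝ => HR s (x + θ * I) := by
  refine (integrable_exp_neg_abs.const_mul _).mono' ?_ (Eventually.of_forall fun x => HR_bound s hs θ h0 x θ le_rfl h1)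
  apply Continuous.aestronglyMeasurable
  rw [continuous_iff_continuousAt]
  intro x
  exact ContinuousAt.comp (g := HR s) (f := fun x : ℝ => (x : ℂ) + θ * I)
    (HR_contAt s _ (by simpa using h0) (by simp; linarith [Real.pi_pos])).continuousAt (by fun_prop)

theorem tendsto_exp_neg_abs (K : ℝ) (l : Filter ℝ) (hl : Tendsto (fun x : ℝ => |x|) l atTop) :
    Tendsto (fun x : ℝ => K * Real.exp (-|x|)) l (𝓝 0) := by
  simpa using (Real.tendsto_exp_neg_atTop_nhds_zero.comp hl).const_mul K

theorem R_eq_Hray (s : ℂ) (hs : s.re < -1) (θ : ℝ) (h0 : 0 < θ) (h1 : θ ≤ Real.pi / 4) :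
    RiemannR s = (exp (Real.pi * I * s) - 1) * ∫ y : ℝ, HR s (y + θ * I) := by
  rw [R_eq_H s hs]
  congr 1
  symm
  have hpi := Real.pi_pos
  exact hshift (HR s) θ (Real.pi / 4) h1
    (fun z hz => (HR_contAt s z (by linarith [hz.1]) (by linarith [hz.2])).continuousAt.continuousWithinAt)
    (fun z ha hb => HR_contAt s z (by linarith) (by linarith)) _
    (tendsto_exp_neg_abs _ atTop tendsto_abs_atTop_atTop)
    (tendsto_exp_neg_abs _ atBot tendsto_abs_atBot_atTop) 0
    (fun x y _ ha hb => HR_bound s hs θ h0 x y ha hb)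
    (HR_int s hs θ h0 h1) (HR_int s hs _ (by positivity) le_rfl)

/-- the parametrisation s = 2πiη² -/
noncomputable def S (η : ℂ) : ℂ := 2 * Real.pi * I * η ^ 2

theorem S_re (η : ℂ) : (S η).re = -(4 * Real.pi * η.re * η.im) := by
  have : S η = ((2 * Real.pi : ℝ) : ℂ) * (I * (η * η)) := by unfold S; push_cast; ring
  rw [this, Complex.re_ofReal_mul, Complex.I_mul_re, Complex.mul_im]; ring

theorem S_im (η : ℂ) : (S η).im = 2 * Real.pi * (η.re ^ 2 - η.im ^ 2) := by
  have : S η = ((2 * Real.pi : ℝ) : ℂ) * (I * (η * η)) := by unfold S; push_cast; ring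
  rw [this, Complex.im_ofReal_mul, Complex.I_mul_im, Complex.mul_re]; ring

theorem arg_range (η : ℂ) (ha : 0 < η.im) (hb : η.im ≤ η.re) : 0 < arg η ∧ arg η ≤ Real.pi / 4 := by
  have hη : η ≠ 0 := by intro h; rw [h] at ha; simp at ha
  have h0 : 0 < arg η := by
    have h1 : 0 ≤ arg η := Complex.arg_nonneg_iff.mpr ha.le
    rcases h1.lt_or_eq with h | h
    · exact h
    · exfalso
      have := Complex.sin_arg η
      rw [← h, Real.sin_zero] at this
      have hp : 0 < ‖η‖ := norm_pos_iff.mpr hη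
      have : 0 < η.im / ‖η‖ := by positivity
      linarith
  refine ⟨h0, ?_⟩
  by_contra! hc
  have h2 := (abs_lt.mp ((Complex.abs_arg_lt_pi_div_two_iff (z := η)).mpr (Or.inl (by linarith)))).2
  have h3 := Real.tan_lt_tan_of_lt_of_lt_pi_div_two (by linarith [Real.pi_pos]) h2 hc
  rw [Real.tan_pi_div_four, Complex.tan_arg, lt_div_iff₀ (by linarith)] at h3
  linarith

noncomputable def gQ (u : ℂ) : ℂ := (exp (2 * u) - 1) / 2 - u

theorem fR_eta (η : ℂ) (hη : η ≠ 0) : fR (S η) η = exp (-S η * log η + Real.pi * I * η ^ 2) := by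
  unfold fR
  rw [cpow_eq _ _ hη, ← Complex.exp_add]

theorem PR_eta (η : ℂ) (hη : η ≠ 0) (κ : ℝ) (u : ℂ) : PR (S η) κ (log η + u) =
    η * fR (S η) η * exp u * exp (S η * gQ u) * exp (2 * Real.pi * I * κ * η * exp u) := by
  rw [fR_eta η hη]
  unfold PR gQ
  conv_rhs => rw [show η * exp (-S η * log η + Real.pi * I * η ^ 2) =
    exp (log η) * exp (-S η * log η + Real.pi * I * η ^ 2) by rw [Complex.exp_log hη]]
  rw [← Complex.exp_add, ← Complex.exp_add, ← Complex.exp_add, ← Complex.exp_add]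
  congr 1
  rw [Complex.exp_add, Complex.exp_log hη]
  have : exp (2 * u) = exp u ^ 2 := by rw [← Complex.exp_nat_mul]; push_cast; rfl
  rw [this]
  unfold S
  ring

theorem gQ_real (y : ℝ) : gQ y = (((Real.exp (2 * y) - 1) / 2 - y : ℝ) : ℂ) := by
  unfold gQ; push_cast; rfl

theorem norm_PR_ray (η : ℂ) (hη : η ≠ 0) (κ y : ℝ) : ‖PR (S η) κ (log η + y)‖ =
    ‖η‖ * ‖fR (S η) η‖ * Real.exp (y + (S η).re * ((Real.exp (2 * y) - 1) / 2 - y) -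
      2 * Real.pi * κ * η.im * Real.exp y) := by
  rw [PR_eta η hη, norm_mul, norm_mul, norm_mul, norm_mul, gQ_real, mul_assoc, mul_assoc, mul_assoc]
  rw [mul_assoc (‖η‖)]
  congr 2
  rw [Complex.norm_exp, Complex.norm_exp, Complex.norm_exp, ← Real.exp_add, ← Real.exp_add]
  congr 1
  rw [Complex.re_mul_ofReal, Complex.ofReal_re]
  have : 2 * (Real.pi : ℂ) * I * κ * η * exp y = ((2 * Real.pi * κ * Real.exp y : ℝ) : ℂ) * (I * η) := by
    push_cast; ring
  rw [this, Complex.re_ofReal_mul, Complex.I_mul_re]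
  ring

theorem g_ge_sq (y : ℝ) (hy : 0 ≤ y) : y ^ 2 ≤ (Real.exp (2 * y) - 1) / 2 - y := by
  have h1 := Real.quadratic_le_exp_of_nonneg (show 0 ≤ 2 * y by linarith)
  nlinarith

theorem g_nonneg (y : ℝ) : 0 ≤ (Real.exp (2 * y) - 1) / 2 - y := by
  have h1 := Real.add_one_le_exp (2 * y)
  linarith

theorem g_ge_abs (y : ℝ) : |y| - 1 / 2 ≤ (Real.exp (2 * y) - 1) / 2 - y := by
  rcases le_or_gt 0 y with h | h
  · rw [abs_of_nonneg h]
    have := g_ge_sq y h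
    nlinarith [sq_nonneg (y - 1 / 2)]
  · rw [abs_of_neg h]
    have := Real.exp_pos (2 * y)
    linarith

theorem R_eq_ray (η : ℂ) (ha : 0 < η.im) (hb : η.im ≤ η.re) (hs : (S η).re < -1) :
    RiemannR (S η) = (exp (Real.pi * I * S η) - 1) * ∫ y : ℝ, HR (S η) (log η + y) := by
  obtain ⟨h0, h1⟩ := arg_range η ha hb
  rw [R_eq_Hray _ hs (arg η) h0 h1,
    ← integral_add_left_eq_self (fun x : ℝ => HR (S η) (x + arg η * I)) (Real.log ‖η‖)]
  congr 2
  funext y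
  congr 1
  rw [Complex.log]
  push_cast
  ring

theorem HR_ray_int (η : ℂ) (ha : 0 < η.im) (hb : η.im ≤ η.re) (hs : (S η).re < -1) :
    Integrable fun y : ℝ => HR (S η) (log η + y) := by
  obtain ⟨h0, h1⟩ := arg_range η ha hb
  have := (HR_int (S η) hs (arg η) h0 h1).comp_add_left (Real.log ‖η‖)
  refine this.congr (Eventually.of_forall fun y => ?_)
  simp only
  congr 1
  rw [Complex.log]
  push_cast
  ring

theorem inv_dR (x : ℂ) (hx : 0 < x.im) (n : ℕ) : 1 / dR x =
    -((∑ k ∈ Finset.range n, exp (2 * Real.pi * I * ((k + 1 / 2 : ℝ) : ℂ) * x)) +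
      exp (2 * Real.pi * I * ((n + 1 / 2 : ℝ) : ℂ) * x) / (1 - exp (2 * Real.pi * I * x))) := by
  set e := exp (Real.pi * I * x) with he
  have e0 : e ≠ 0 := exp_ne_zero _
  have e2 : exp (2 * Real.pi * I * x) = e ^ 2 := by
    rw [he, ← Complex.exp_nat_mul]; congr 1; push_cast; ring
  have ek : ∀ k : ℕ, exp (2 * Real.pi * I * ((k + 1 / 2 : ℝ) : ℂ) * x) = e * (e ^ 2) ^ k := by
    intro k
    rw [he, ← Complex.exp_nat_mul, ← Complex.exp_nat_mul, ← Complex.exp_add]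
    congr 1; push_cast; ring
  have hlt : ‖e ^ 2‖ < 1 := by
    rw [← e2, Complex.norm_exp]
    have : 2 * (Real.pi : ℂ) * I * x = ((2 * Real.pi : ℝ) : ℂ) * (I * x) := by push_cast; ring
    rw [this, Complex.re_ofReal_mul, Complex.I_mul_re, Real.exp_lt_one_iff]
    have := Real.pi_pos
    nlinarith
  have hne : 1 - e ^ 2 ≠ 0 := by
    intro h
    rw [sub_eq_zero] at h
    rw [← h] at hlt; simp at hlt
  have hne1 : e ^ 2 - 1 ≠ 0 := by
    intro h; apply hne; linear_combination -h
  have hne' : e ^ 2 ≠ 1 := fun h => hne1 (by rw [h]; ring)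
  rw [e2]
  simp only [ek]
  rw [← Finset.mul_sum, geom_sum_eq hne']
  have hd : dR x = (e ^ 2 - 1) / e := by
    unfold dR
    rw [Complex.exp_neg, ← he]
    field_simp
  rw [hd]
  field_simp
  ring

noncomputable def TT (η : ℂ) (n : ℕ) : ℂ :=
  ∫ y : ℝ, PR (S η) (n + 1 / 2) (log η + y) / (1 - exp (2 * Real.pi * I * exp (log η + y)))

theorem norm_one_sub (x : ℂ) (hx : 0 < x.im) :
    ‖(1 - exp (2 * Real.pi * I * x))‖⁻¹ ≤ 1 + 1 / x.im := by
  have hn : ‖exp (2 * Real.pi * I * x)‖ = Real.exp (-(2 * Real.pi * x.im)) := by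
    rw [Complex.norm_exp]
    have : 2 * (Real.pi : ℂ) * I * x = ((2 * Real.pi : ℝ) : ℂ) * (I * x) := by push_cast; ring
    rw [this, Complex.re_ofReal_mul, Complex.I_mul_re]
    congr 1; ring
  have h1 : 1 - Real.exp (-(2 * Real.pi * x.im)) ≤ ‖(1 - exp (2 * Real.pi * I * x))‖ := by
    rw [← hn]
    have := norm_sub_norm_le (1 : ℂ) (exp (2 * Real.pi * I * x))
    rwa [norm_one] at this
  have h2 : x.im / (1 + x.im) ≤ 1 - Real.exp (-(2 * Real.pi * x.im)) := by
    have h3 : Real.exp (-(2 * Real.pi * x.im)) ≤ 1 / (1 + x.im) := by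
      rw [Real.exp_neg, ← one_div]
      apply one_div_le_one_div_of_le (by linarith)
      have := Real.add_one_le_exp (2 * Real.pi * x.im)
      have := Real.pi_gt_three
      nlinarith
    have : x.im / (1 + x.im) = 1 - 1 / (1 + x.im) := by
      rw [eq_sub_iff_add_eq, ← add_div, add_comm, div_self (by linarith)]
    linarith
  calc _ ≤ (x.im / (1 + x.im))⁻¹ := by
        apply inv_anti₀ (by positivity) (h2.trans h1)
    _ = _ := by rw [inv_div, add_div, div_self hx.ne']; ring

theorem tail_ptw (η : ℂ) (ha : 0 < η.im) (hb : η.im ≤ η.re) (hs : (S η).re ≤ -2) (n : ℕ) (y : ℝ) :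
    ‖PR (S η) (n + 1 / 2) (log η + y) / (1 - exp (2 * Real.pi * I * exp (log η + y)))‖ ≤
    ‖η‖ * ‖fR (S η) η‖ * (1 + 1 / η.im) * Real.exp 1 *
      (Real.exp (-(Real.pi * n * η.im)) + Real.exp (((S η).re + 2) / 6)) * Real.exp (-|y|) := by
  have hη : η ≠ 0 := by intro h; rw [h] at ha; simp at ha
  have hx : exp (log η + y) = ((Real.exp y : ℝ) : ℂ) * η := by
    rw [Complex.exp_add, Complex.exp_log hη]; push_cast; ring
  have hxi : (exp (log η + y)).im = Real.exp y * η.im := by rw [hx, Complex.im_ofReal_mul]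
  have hey := Real.exp_pos y
  have h1 := norm_one_sub (exp (log η + y)) (by rw [hxi]; positivity)
  rw [hxi] at h1
  have hg0 := g_nonneg y
  have hga := g_ge_abs y
  set g := (Real.exp (2 * y) - 1) / 2 - y with hg
  have hpi := Real.pi_gt_three
  rw [norm_div, div_eq_mul_inv, norm_PR_ray η hη]
  have h2 : Real.exp (y + (S η).re * g - 2 * Real.pi * (n + 1 / 2) * η.im * Real.exp y) ≤
      Real.exp (y - 2 * g) * (Real.exp (-(Real.pi * n * η.im)) + Real.exp (((S η).re + 2) / 6)) := by
    have p1 := Real.exp_pos (-(Real.pi * n * η.im))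
    have p2 := Real.exp_pos (((S η).re + 2) / 6)
    rcases le_or_gt (-Real.log 2) y with hy | hy
    · have hhalf : (1 / 2 : ℝ) ≤ Real.exp y := by
        have : Real.exp (-Real.log 2) ≤ Real.exp y := Real.exp_le_exp.mpr hy
        rw [Real.exp_neg, Real.exp_log (by norm_num)] at this
        linarith
      calc _ ≤ Real.exp ((y - 2 * g) + -(Real.pi * n * η.im)) := by
            apply Real.exp_le_exp.mpr
            have k1 : (S η).re * g ≤ -2 * g := by gcongr
            have hn : (0 : ℝ) ≤ n := Nat.cast_nonneg n
            have k2 : Real.pi * n * η.im ≤ 2 * Real.pi * (n + 1 / 2) * η.im * Real.exp y := by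
              calc Real.pi * n * η.im ≤ Real.pi * (n + 1 / 2) * η.im * 1 := by
                    rw [mul_one]; gcongr; linarith
                _ ≤ Real.pi * (n + 1 / 2) * η.im * (2 * Real.exp y) := by
                    gcongr; linarith
                _ = _ := by ring
            linarith
        _ = Real.exp (y - 2 * g) * Real.exp (-(Real.pi * n * η.im)) := Real.exp_add _ _
        _ ≤ _ := by gcongr; linarith
    · have hg6 : 1 / 6 ≤ g := by
        have := Real.log_two_gt_d9
        have h3 : |y| = -y := abs_of_neg (by linarith)
        rw [h3] at hga
        linarith
      calc _ ≤ Real.exp ((y - 2 * g) + ((S η).re + 2) / 6) := by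
            apply Real.exp_le_exp.mpr
            have hn : (0 : ℝ) ≤ 2 * Real.pi * (n + 1 / 2) * η.im * Real.exp y := by positivity
            nlinarith
        _ = Real.exp (y - 2 * g) * Real.exp (((S η).re + 2) / 6) := Real.exp_add _ _
        _ ≤ _ := by gcongr; linarith
  have h3 : Real.exp (y - 2 * g) * (1 + 1 / (Real.exp y * η.im)) ≤ (1 + 1 / η.im) * Real.exp 1 * Real.exp (-|y|) := by
    calc _ ≤ Real.exp (y + (1 - 2 * |y|)) * (1 + 1 / (Real.exp y * η.im)) := by
          gcongr; linarith
      _ = (Real.exp y + 1 / η.im) * Real.exp (1 - 2 * |y|) := by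
          rw [Real.exp_add]; field_simp
      _ ≤ (Real.exp |y| + 1 / η.im * Real.exp |y|) * Real.exp (1 - 2 * |y|) := by
          gcongr
          · exact le_abs_self y
          · exact le_mul_of_one_le_right (by positivity) (Real.one_le_exp (abs_nonneg y))
      _ = (1 + 1 / η.im) * (Real.exp |y| * Real.exp (1 - 2 * |y|)) := by ring
      _ = _ := by
          rw [← Real.exp_add, mul_assoc, ← Real.exp_add]; congr 2; ring
  set Z := Real.exp (-(Real.pi * n * η.im)) + Real.exp (((S η).re + 2) / 6) with hZ
  have hZ0 : 0 ≤ Z := by positivity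
  calc _ ≤ ‖η‖ * ‖fR (S η) η‖ * (Real.exp (y - 2 * g) * Z) * (1 + 1 / (Real.exp y * η.im)) := by
        gcongr
    _ = ‖η‖ * ‖fR (S η) η‖ * Z * (Real.exp (y - 2 * g) * (1 + 1 / (Real.exp y * η.im))) := by ring
    _ ≤ ‖η‖ * ‖fR (S η) η‖ * Z * ((1 + 1 / η.im) * Real.exp 1 * Real.exp (-|y|)) := by gcongr
    _ = _ := by ring

noncomputable def EA : ℝ := Real.exp 1 * ∫ x : ℝ, Real.exp (-|x|)

theorem EA_nonneg : 0 ≤ EA := mul_nonneg (Real.exp_pos _).le (integral_nonneg fun _ => (Real.exp_pos _).le)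

theorem TT_bound (η : ℂ) (ha : 0 < η.im) (hb : η.im ≤ η.re) (hs : (S η).re ≤ -2) (n : ℕ) :
    ‖TT η n‖ ≤ EA * (‖η‖ * ‖fR (S η) η‖ * (1 + 1 / η.im) *
      (Real.exp (-(Real.pi * n * η.im)) + Real.exp (((S η).re + 2) / 6))) := by
  unfold TT
  refine (norm_integral_le_of_norm_le (integrable_exp_neg_abs.const_mul _)
    (Eventually.of_forall fun y => tail_ptw η ha hb hs n y)).trans (le_of_eq ?_)
  rw [integral_const_mul]
  unfold EA
  ring

theorem PR_ray_int (η : ℂ) (ha : 0 < η.im) (hb : η.im ≤ η.re) (hs : (S η).re ≤ -2) (κ : ℝ) (hκ : 0 ≤ κ) :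
    Integrable fun y : ℝ => PR (S η) κ (log η + y) := by
  have hη : η ≠ 0 := by intro h; rw [h] at ha; simp at ha
  refine (integrable_exp_neg_abs.const_mul (‖η‖ * ‖fR (S η) η‖ * Real.exp 1)).mono' ?_
    (Eventually.of_forall fun y => ?_)
  · exact ((PR_diff _ _).continuous.comp (by fun_prop)).aestronglyMeasurable
  · rw [norm_PR_ray η hη, mul_assoc _ (Real.exp 1), ← Real.exp_add]
    gcongr
    have h1 := g_nonneg y
    have h2 := g_ge_abs y
    have h3 : 0 ≤ 2 * Real.pi * κ * η.im * Real.exp y := by positivity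
    have h4 := le_abs_self y
    nlinarith

theorem TT_int (η : ℂ) (ha : 0 < η.im) (hb : η.im ≤ η.re) (hs : (S η).re ≤ -2) (n : ℕ) :
    Integrable fun y : ℝ => PR (S η) (n + 1 / 2) (log η + y) / (1 - exp (2 * Real.pi * I * exp (log η + y))) := by
  refine (integrable_exp_neg_abs.const_mul _).mono' ?_
    (Eventually.of_forall fun y => tail_ptw η ha hb hs n y)
  apply Measurable.aestronglyMeasurable
  apply Measurable.div
  · exact ((PR_diff _ _).continuous.comp (by fun_prop)).measurable
  · exact Continuous.measurable (by fun_prop)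

theorem R_expand (η : ℂ) (ha : 0 < η.im) (hb : η.im ≤ η.re) (hs : (S η).re ≤ -2) (n : ℕ) :
    RiemannR (S η) = (1 - exp (Real.pi * I * S η)) *
      ((∑ k ∈ Finset.range n, ∫ y : ℝ, PR (S η) (k + 1 / 2) (log η + y)) + TT η n) := by
  have hη : η ≠ 0 := by intro h; rw [h] at ha; simp at ha
  rw [R_eq_ray η ha hb (by linarith)]
  have e : (∫ y : ℝ, HR (S η) (log η + y)) =
      -((∑ k ∈ Finset.range n, ∫ y : ℝ, PR (S η) (k + 1 / 2) (log η + y)) + TT η n) := by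
    unfold TT
    rw [← integral_finsetSum (Finset.range n) (fun (k : ℕ) _ => PR_ray_int η ha hb hs ((k : ℝ) + 1 / 2) (by positivity)),
      ← integral_add (integrable_finsetSum (Finset.range n) (fun (k : ℕ) _ => PR_ray_int η ha hb hs ((k : ℝ) + 1 / 2) (by positivity)))
      (TT_int η ha hb hs n), ← integral_neg]
    congr 1; funext y
    have hx : exp (log η + y) = ((Real.exp y : ℝ) : ℂ) * η := by
      rw [Complex.exp_add, Complex.exp_log hη]; push_cast; ring
    have hxi : 0 < (exp (log η + y)).im := by rw [hx, Complex.im_ofReal_mul]; positivity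
    have hk : ∀ κ : ℝ, PR (S η) κ (log η + y) = PR (S η) 0 (log η + y) *
        exp (2 * Real.pi * I * (κ : ℂ) * exp (log η + y)) := by
      intro κ
      unfold PR
      rw [← Complex.exp_add]; congr 1; push_cast; ring
    rw [HR_eq, div_eq_mul_one_div, inv_dR _ hxi n, hk (n + 1 / 2)]
    simp only [fun k : ℕ => hk (k + 1 / 2)]
    rw [← Finset.mul_sum]
    ring
  rw [e]; ring

end RZ

namespace RZ
open Complex Filter Topology Set

theorem contour (Ψ : ℂ → ℂ) (hΨ : Differentiable ℂ Ψ) (w0 α β : ℂ) (V : ℝ)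
    (hi0 : Integrable fun y : ℝ => Ψ (w0 + y))
    (him : IntegrableOn (fun y : ℝ => Ψ (w0 + (α - β * V) + y)) (Iic 0))
    (hip : IntegrableOn (fun y : ℝ => Ψ (w0 + (α + β * V) + y)) (Ioi 0))
    (C : ℝ)
    (hbp : ∀ τ ∈ Icc (0:ℝ) 1, ∀ y : ℝ, 0 ≤ y → ‖Ψ (w0 + τ * (α + β * V) + y)‖ ≤ C * Real.exp (-|y|))
    (hbm : ∀ τ ∈ Icc (0:ℝ) 1, ∀ y : ℝ, y ≤ 0 → ‖Ψ (w0 + τ * (α - β * V) + y)‖ ≤ C * Real.exp (-|y|)) :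
    ∫ y : ℝ, Ψ (w0 + y) = (∫ y : ℝ in Iic 0, Ψ (w0 + (α - β * V) + y)) +
      (∫ v : ℝ in (-V)..V, Ψ (w0 + (α + β * v)) * β) +
      ∫ y : ℝ in Ioi 0, Ψ (w0 + (α + β * V) + y) := by
  obtain ⟨Φ, hΦ⟩ : ∃ Φ : ℂ → ℂ, ∀ z, HasDerivAt Φ (Ψ z) z := by
    obtain ⟨Φ, h⟩ := hΨ.isExactOn_univ
    exact ⟨Φ, fun z => h z (mem_univ z)⟩
  have hd : ∀ (w : ℂ) (y : ℝ), HasDerivAt (fun y : ℝ => Φ (w + y)) (Ψ (w + y)) y := by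
    intro w y
    have h1 : HasDerivAt (fun y : ℝ => w + (y : ℂ)) 1 y := (HasDerivAt.ofReal_comp (hasDerivAt_id y)).const_add w
    exact ((hΦ (w + y)).comp y h1).congr_deriv (by simp)
  have hlim0 := tendsto_limUnder_of_hasDerivAt_of_integrableOn_Ioi (a := 0) (fun x _ => hd w0 x) hi0.integrableOn
  have hlimp := tendsto_limUnder_of_hasDerivAt_of_integrableOn_Ioi (a := 0) (fun x _ => hd (w0 + (α + β * V)) x) hip
  have hlim0' := tendsto_limUnder_of_hasDerivAt_of_integrableOn_Iic (a := 0) (fun x _ => hd w0 x) hi0.integrableOn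
  have hlimm := tendsto_limUnder_of_hasDerivAt_of_integrableOn_Iic (a := 0) (fun x _ => hd (w0 + (α - β * V)) x) him
  have key : ∀ (u : ℂ) (y : ℝ), (∀ τ ∈ Icc (0:ℝ) 1, ‖Ψ (w0 + τ * u + y)‖ ≤ C * Real.exp (-|y|)) →
      ‖Φ (w0 + u + y) - Φ (w0 + y)‖ ≤ ‖u‖ * C * Real.exp (-|y|) := by
    intro u y h
    have h1 : ∀ τ ∈ Icc (0:ℝ) 1, HasDerivWithinAt (fun τ : ℝ => Φ (w0 + τ * u + y)) (Ψ (w0 + τ * u + y) * u) (Icc 0 1) τ := by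
      intro τ _
      have h1 : HasDerivAt (fun τ : ℝ => w0 + (τ : ℂ) * u + y) u τ := by
        have := (((HasDerivAt.ofReal_comp (hasDerivAt_id τ)).mul_const u).const_add w0).add_const (y : ℂ)
        simpa using this
      exact ((hΦ (w0 + τ * u + y)).comp τ h1).hasDerivWithinAt
    have h2 := norm_image_sub_le_of_norm_deriv_le_segment' h1 (C := ‖u‖ * C * Real.exp (-|y|)) (by
      intro τ hτ
      rw [norm_mul]
      have := h τ ⟨hτ.1, hτ.2.le⟩
      calc _ ≤ C * Real.exp (-|y|) * ‖u‖ := by gcongr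
        _ = _ := by ring) 1 (by simp)
    simpa using h2
  have ep : limUnder atTop (fun y : ℝ => Φ (w0 + y)) = limUnder atTop (fun y : ℝ => Φ (w0 + (α + β * V) + y)) := by
    have h1 := hlimp.sub hlim0
    have h2 : Tendsto (fun y : ℝ => Φ (w0 + (α + β * V) + y) - Φ (w0 + y)) atTop (𝓝 0) := by
      refine squeeze_zero_norm' ?_ (tendsto_exp_neg_abs (‖α + β * V‖ * C) atTop tendsto_abs_atTop_atTop)
      filter_upwards [eventually_ge_atTop 0] with y hy
      exact key _ y fun τ hτ => hbp τ hτ y hy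
    have := tendsto_nhds_unique h1 h2
    exact (sub_eq_zero.mp this).symm
  have em : limUnder atBot (fun y : ℝ => Φ (w0 + y)) = limUnder atBot (fun y : ℝ => Φ (w0 + (α - β * V) + y)) := by
    have h1 := hlimm.sub hlim0'
    have h2 : Tendsto (fun y : ℝ => Φ (w0 + (α - β * V) + y) - Φ (w0 + y)) atBot (𝓝 0) := by
      refine squeeze_zero_norm' ?_ (tendsto_exp_neg_abs (‖α - β * V‖ * C) atBot tendsto_abs_atBot_atTop)
      filter_upwards [eventually_le_atBot 0] with y hy
      exact key _ y fun τ hτ => hbm τ hτ y hy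
    have := tendsto_nhds_unique h1 h2
    exact (sub_eq_zero.mp this).symm
  have i0 := integral_Ioi_of_hasDerivAt_of_tendsto' (a := (0:ℝ)) (fun x _ => hd w0 x) hi0.integrableOn hlim0
  have i0' := integral_Iic_of_hasDerivAt_of_tendsto' (a := (0:ℝ)) (fun x _ => hd w0 x) hi0.integrableOn hlim0'
  have i1 := integral_Ioi_of_hasDerivAt_of_tendsto' (a := (0:ℝ)) (fun x _ => hd _ x) hip hlimp
  have i1' := integral_Iic_of_hasDerivAt_of_tendsto' (a := (0:ℝ)) (fun x _ => hd _ x) him hlimm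
  have i2 : ∫ v : ℝ in (-V)..V, Ψ (w0 + (α + β * v)) * β = Φ (w0 + (α + β * V)) - Φ (w0 + (α + β * (-V : ℝ))) := by
    refine intervalIntegral.integral_eq_sub_of_hasDerivAt (f := fun v : ℝ => Φ (w0 + (α + β * v))) ?_ ?_
    · intro v _
      have h1 : HasDerivAt (fun v : ℝ => w0 + (α + β * (v:ℂ))) β v := by
        have := (((HasDerivAt.ofReal_comp (hasDerivAt_id v)).const_mul β).const_add α).const_add w0
        simpa using this
      exact (hΦ _).comp v h1
    · apply Continuous.intervalIntegrable
      exact (hΨ.continuous.comp (by fun_prop)).mul continuous_const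
  have e0 : ∫ y : ℝ, Ψ (w0 + y) = (∫ y : ℝ in Iic 0, Ψ (w0 + y)) + ∫ y : ℝ in Ioi 0, Ψ (w0 + y) :=
    (intervalIntegral.integral_Iic_add_Ioi hi0.integrableOn hi0.integrableOn).symm
  rw [e0, i0, i0', i1, i1', i2, ep, em]
  have : α + β * ((-V : ℝ) : ℂ) = α - β * V := by push_cast; ring
  rw [this]
  simp only [ofReal_zero, add_zero]
  ring

/-- crude bound right -/
theorem PR_right_crude (s : ℂ) (hs : s.re ≤ 0) (κ : ℝ) (hκ : 0 ≤ κ) (m : ℝ) (hm : 0 < m) (w : ℂ)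
    (h0 : 0 ≤ w.im) (h1 : w.im ≤ Real.pi / 2) (h2 : m ≤ Real.sin (2 * w.im)) :
    ‖PR s κ w‖ ≤ Real.exp (|s.im| * 4 + (1 - s.re + 1) ^ 2 / (8 * (Real.pi * m))) * Real.exp (-|w.re|) := by
  rw [norm_PR, ← Real.exp_add]
  apply Real.exp_le_exp.mpr
  have hp := Real.pi_pos
  have hp4 := Real.pi_le_four
  have e1 := expo_bound (1 - s.re) (Real.pi * m) w.re (by linarith) (by positivity)
  have e2 : s.im * w.im ≤ |s.im| * 4 := by
    calc s.im * w.im ≤ |s.im| * w.im := by gcongr; exact le_abs_self _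
      _ ≤ _ := by gcongr; linarith
  have e3 : 0 ≤ Real.sin w.im := Real.sin_nonneg_of_nonneg_of_le_pi h0 (by linarith)
  have e4 : Real.pi * m * Real.exp (2 * w.re) ≤ Real.pi * (Real.exp (2 * w.re) * Real.sin (2 * w.im)) := by
    calc _ = Real.pi * (Real.exp (2 * w.re) * m) := by ring
      _ ≤ _ := by gcongr
  have e5 : 0 ≤ 2 * Real.pi * κ * (Real.exp w.re * Real.sin w.im) := by positivity
  linarith

theorem PR_left_crude (s : ℂ) (hs : s.re ≤ 0) (κ : ℝ) (hκ : 0 ≤ κ) (w : ℂ) (B : ℝ) (hB : w.re ≤ B)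
    (h0 : |w.im| ≤ 4) :
    ‖PR s κ w‖ ≤ Real.exp (-s.re * |B| + |s.im| * 4 + Real.pi * Real.exp (2 * B) + 2 * Real.pi * κ * Real.exp B) * Real.exp w.re := by
  rw [norm_PR, ← Real.exp_add]
  apply Real.exp_le_exp.mpr
  have hp := Real.pi_pos
  have e2 : s.im * w.im ≤ |s.im| * 4 := by
    calc s.im * w.im ≤ |s.im * w.im| := le_abs_self _
      _ = |s.im| * |w.im| := abs_mul _ _
      _ ≤ _ := by gcongr
  have e1 : -s.re * w.re ≤ -s.re * |B| := by
    apply mul_le_mul_of_nonneg_left (hB.trans (le_abs_self B)); linarith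
  have e4 : -(Real.pi * (Real.exp (2 * w.re) * Real.sin (2 * w.im))) ≤ Real.pi * Real.exp (2 * B) := by
    calc _ = Real.pi * (Real.exp (2 * w.re) * -Real.sin (2 * w.im)) := by ring
      _ ≤ Real.pi * (Real.exp (2 * w.re) * 1) := by
        gcongr; linarith [Real.neg_one_le_sin (2 * w.im)]
      _ ≤ Real.pi * (Real.exp (2 * B) * 1) := by gcongr
      _ = _ := by ring
  have e5 : -(2 * Real.pi * κ * (Real.exp w.re * Real.sin w.im)) ≤ 2 * Real.pi * κ * Real.exp B := by
    calc _ = 2 * Real.pi * κ * (Real.exp w.re * -Real.sin w.im) := by ring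
      _ ≤ 2 * Real.pi * κ * (Real.exp w.re * 1) := by
        gcongr; linarith [Real.neg_one_le_sin (w.im)]
      _ ≤ 2 * Real.pi * κ * (Real.exp B * 1) := by gcongr
      _ = _ := by ring
  linarith

/-- radial bounds. -/
theorem PR_radial_right (s : ℂ) (hs : s.re ≤ -2) (κ : ℝ) (hκ : 0 ≤ κ) (w : ℂ) (y : ℝ) (hy : 0 ≤ y)
    (h1 : -s.re ≤ 2 * Real.pi * (exp w ^ 2).im) (h2 : 0 ≤ (exp w).im) :
    ‖PR s κ (w + y)‖ ≤ ‖PR s κ w‖ * Real.exp (1 - y) := by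
  rw [exp_sq_im] at h1
  rw [exp_im_sin] at h2
  rw [norm_PR, norm_PR, ← Real.exp_add]
  apply Real.exp_le_exp.mpr
  simp only [add_re, ofReal_re, add_im, ofReal_im, add_zero, mul_add, Real.exp_add]
  have g1 := g_ge_abs y
  have g0 := g_nonneg y
  rw [abs_of_nonneg hy] at g1
  have k1 : 0 ≤ Real.exp (2 * y) - 1 := by linarith [Real.add_one_le_exp (2 * y)]
  have k2 : 0 ≤ Real.exp y - 1 := by linarith [Real.add_one_le_exp y]
  have k3 := mul_le_mul_of_nonneg_right h1 k1
  have k4 : 0 ≤ 2 * Real.pi * κ * (Real.exp w.re * Real.sin w.im) * (Real.exp y - 1) := by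
    have := Real.pi_pos; positivity
  nlinarith

theorem PR_radial_left (s : ℂ) (hs : s.re ≤ 0) (κ : ℝ) (hκ : 0 ≤ κ) (w : ℂ) (y : ℝ) (hy : y ≤ 0)
    (h1 : 2 * Real.pi * (exp w ^ 2).im ≤ -s.re) :
    ‖PR s κ (w + y)‖ ≤ ‖PR s κ w‖ * Real.exp (2 * Real.pi * κ * ‖exp w‖) * Real.exp y := by
  rw [exp_sq_im] at h1
  have h2 := (le_abs_self _).trans (Complex.abs_im_le_norm (exp w))
  rw [exp_im_sin] at h2
  rw [norm_PR, norm_PR, ← Real.exp_add, ← Real.exp_add]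
  apply Real.exp_le_exp.mpr
  simp only [add_re, ofReal_re, add_im, ofReal_im, add_zero, mul_add]
  rw [Real.exp_add, Real.exp_add]
  have g0 := g_nonneg y
  have k1 : 0 ≤ 1 - Real.exp (2 * y) := by
    have := Real.exp_le_one_iff.mpr (show 2 * y ≤ 0 by linarith); linarith
  have k2 : 0 ≤ 1 - Real.exp y := by
    have := Real.exp_le_one_iff.mpr hy; linarith
  have k2' : 1 - Real.exp y ≤ 1 := by linarith [Real.exp_pos y]
  have k3 := mul_le_mul_of_nonneg_right h1 k1
  have k4 : 2 * Real.pi * κ * (Real.exp w.re * Real.sin w.im) * (1 - Real.exp y) ≤ 2 * Real.pi * κ * ‖exp w‖ := by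
    have := Real.pi_pos
    calc _ ≤ 2 * Real.pi * κ * ‖exp w‖ * (1 - Real.exp y) := by gcongr
      _ ≤ 2 * Real.pi * κ * ‖exp w‖ * 1 := by gcongr
      _ = _ := by ring
  nlinarith

end RZ

namespace RZ
open Complex Filter Topology Set

noncomputable def om : ℂ := ((Real.sqrt 2 / 2 : ℝ) : ℂ) * (1 + I)

theorem sq2 : (Real.sqrt 2 / 2) * (Real.sqrt 2 / 2) = 1 / 2 := by
  have := Real.mul_self_sqrt (show (0:ℝ) ≤ 2 by norm_num); linarith

theorem om_sq : om ^ 2 = I := by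
  unfold om
  have h : ((Real.sqrt 2 / 2 : ℝ) : ℂ) * ((Real.sqrt 2 / 2 : ℝ) : ℂ) = 1 / 2 := by
    rw [← ofReal_mul, sq2]; norm_num
  linear_combination (1 + I) ^ 2 * h + 1 / 2 * I_sq

theorem om_re : om.re = Real.sqrt 2 / 2 := by unfold om; rw [re_ofReal_mul]; simp
theorem om_im : om.im = Real.sqrt 2 / 2 := by unfold om; rw [im_ofReal_mul]; simp

theorem om_norm : ‖om‖ = 1 := by
  have h : ‖om‖ ^ 2 = 1 := by rw [← norm_pow, om_sq, norm_I]
  nlinarith [norm_nonneg om]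

noncomputable def EE (η : ℂ) (κ : ℝ) (u : ℂ) : ℂ :=
  u + S η * (gQ u - u ^ 2) + 2 * Real.pi * I * κ * η * (exp u - 1 - u)

theorem seg_eq (η : ℂ) (hη : η ≠ 0) (κ v : ℝ) (u : ℂ) (hu : η * u = -κ / 2 + om * v) :
    PR (S η) κ (log η + u) = η * fR (S η) η * exp (2 * Real.pi * I * κ * η) * exp (-Real.pi * I * κ ^ 2 / 2) *
      (exp (-2 * Real.pi * v ^ 2) * exp (EE η κ u)) := by
  rw [PR_eta η hη]
  simp only [mul_assoc]
  congr 2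
  simp only [← Complex.exp_add]
  congr 1
  unfold EE S
  have e : 2 * (Real.pi : ℂ) * I * (η * u) ^ 2 + 2 * Real.pi * I * κ * (η * u) =
      -Real.pi * I * κ ^ 2 / 2 - 2 * Real.pi * v ^ 2 := by
    rw [hu]
    linear_combination 2 * (Real.pi : ℂ) * I * v ^ 2 * om_sq + 2 * Real.pi * v ^ 2 * I_sq
  linear_combination e

theorem gQ_bd (u : ℂ) (h : ‖u‖ ≤ 1 / 2) : ‖gQ u - u ^ 2‖ ≤ ‖u‖ ^ 3 := by
  have h2 : ‖2 * u‖ ≤ 1 := by rw [norm_mul]; simp; linarith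
  have := Complex.exp_bound h2 (n := 3) (by norm_num)
  rw [Finset.sum_range_succ, Finset.sum_range_succ, Finset.sum_range_succ] at this
  norm_num [Nat.factorial] at this
  have e : gQ u - u ^ 2 = (exp (2 * u) - (1 + 2 * u + (2 * u) ^ 2 / 2)) / 2 := by
    unfold gQ; ring
  rw [e, norm_div]
  have h0 : 0 ≤ ‖u‖ ^ 3 := by positivity
  simp only [Complex.norm_ofNat]
  have e3 : (2 * ‖u‖) ^ 3 = 8 * ‖u‖ ^ 3 := by ring
  rw [e3] at this
  linarith

theorem exp2_bd (u : ℂ) (h : ‖u‖ ≤ 1) : ‖exp u - 1 - u‖ ≤ 3 / 4 * ‖u‖ ^ 2 := by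
  have := Complex.exp_bound h (n := 2) (by norm_num)
  rw [Finset.sum_range_succ, Finset.sum_range_succ] at this
  norm_num [Nat.factorial] at this
  have e : exp u - 1 - u = exp u - (1 + u) := by ring
  rw [e]; linarith

theorem EE_bd (η : ℂ) (hη : η ≠ 0) (κ : ℝ) (hκ : 0 ≤ κ) (u : ℂ) (A : ℝ) (hA : ‖η * u‖ ≤ A) (hA2 : A ≤ ‖η‖ / 2) :
    ‖EE η κ u‖ ≤ (A + 2 * Real.pi * A ^ 3 + 2 * Real.pi * κ * A ^ 2) / ‖η‖ := by
  have hr : 0 < ‖η‖ := norm_pos_iff.mpr hη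
  have hp := Real.pi_pos
  have hA0 : 0 ≤ A := (norm_nonneg _).trans hA
  have hu : ‖u‖ ≤ A / ‖η‖ := by rw [le_div_iff₀ hr, mul_comm, ← norm_mul]; exact hA
  have hu2 : ‖u‖ ≤ 1 / 2 := hu.trans (by rw [div_le_iff₀ hr]; linarith)
  unfold EE
  have hS : ‖S η‖ = 2 * Real.pi * ‖η‖ ^ 2 := by
    unfold S; simp [abs_of_pos hp]
  have h1 : ‖S η * (gQ u - u ^ 2)‖ ≤ 2 * Real.pi * A ^ 3 / ‖η‖ := by
    rw [norm_mul, hS]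
    calc _ ≤ 2 * Real.pi * ‖η‖ ^ 2 * (A / ‖η‖) ^ 3 := by gcongr; exact (gQ_bd u hu2).trans (by gcongr)
      _ = _ := by field_simp
  have h2 : ‖2 * Real.pi * I * κ * η * (exp u - 1 - u)‖ ≤ 2 * Real.pi * κ * A ^ 2 / ‖η‖ := by
    rw [norm_mul]
    have : ‖2 * Real.pi * I * κ * η‖ = 2 * Real.pi * κ * ‖η‖ := by
      simp [abs_of_pos hp, abs_of_nonneg hκ]
    rw [this]
    calc _ ≤ 2 * Real.pi * κ * ‖η‖ * (1 * (A / ‖η‖) ^ 2) := by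
          gcongr
          refine (exp2_bd u (by linarith)).trans ?_
          gcongr; norm_num
      _ = _ := by field_simp
  calc _ ≤ ‖u‖ + ‖S η * (gQ u - u ^ 2)‖ + ‖2 * Real.pi * I * κ * η * (exp u - 1 - u)‖ := norm_add₃_le
    _ ≤ A / ‖η‖ + 2 * Real.pi * A ^ 3 / ‖η‖ + 2 * Real.pi * κ * A ^ 2 / ‖η‖ := by gcongr
    _ = _ := by ring

/-- both forms of E bound -/
theorem EE_bd2 (η : ℂ) (hη : η ≠ 0) (κ : ℝ) (hκ : 1 / 2 ≤ κ) (hκr : 2000 * κ ≤ ‖η‖) (hκ3 : κ ^ 3 ≤ ‖η‖)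
    (v : ℝ) (hv : |v| ≤ ‖η‖ / 16) (u : ℂ) (hu : η * u = -κ / 2 + om * v) :
    ‖EE η κ u‖ ≤ (2 * Real.pi + 1) + 3 * Real.pi / 4 * v ^ 2 ∧
    ‖EE η κ u‖ ≤ 104 * (κ ^ 3 / ‖η‖) * (1 + |v|) ^ 3 := by
  set r := ‖η‖ with hr'
  have hr : 0 < r := norm_pos_iff.mpr hη
  have hp := Real.pi_pos
  have hp4 := Real.pi_le_four
  have hκ0 : 0 ≤ κ := by linarith
  have hA : ‖η * u‖ ≤ κ / 2 + |v| := by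
    rw [hu]
    refine (norm_add_le _ _).trans ?_
    rw [norm_mul, om_norm, norm_div, norm_neg]
    simp [abs_of_nonneg hκ0]
  have hE := EE_bd η hη κ hκ0 u _ hA (by linarith)
  rw [← hr'] at hE
  have hv0 := abs_nonneg v
  have hvs : |v| ^ 2 = v ^ 2 := sq_abs v
  set z := |v| with hz
  constructor
  · refine hE.trans ?_
    rw [div_le_iff₀ hr]
    have c1 : (κ / 2 + z) ^ 3 ≤ 4 * ((κ / 2) ^ 3 + z ^ 3) := by
      nlinarith [mul_nonneg (add_nonneg (half_pos (by linarith : 0 < κ)).le hv0) (sq_nonneg (κ / 2 - z))]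
    have c2 : (κ / 2 + z) ^ 2 ≤ 2 * ((κ / 2) ^ 2 + z ^ 2) := by nlinarith [sq_nonneg (κ / 2 - z)]
    have c3 : z ^ 3 ≤ r / 16 * v ^ 2 := by
      rw [← hvs]; nlinarith [mul_le_mul_of_nonneg_right hv (sq_nonneg z)]
    have c4 : κ * z ^ 2 ≤ r / 16 * v ^ 2 := by
      rw [← hvs]; gcongr; linarith
    have c5 : 2 * Real.pi * (κ / 2 + z) ^ 3 ≤ 2 * Real.pi * (κ ^ 3 / 2 + r / 4 * v ^ 2) := by
      gcongr; linarith
    have c6 : 2 * Real.pi * κ * (κ / 2 + z) ^ 2 ≤ 2 * Real.pi * (κ ^ 3 / 2 + r / 8 * v ^ 2) := by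
      calc _ = 2 * Real.pi * (κ * (κ / 2 + z) ^ 2) := by ring
        _ ≤ 2 * Real.pi * (κ * (2 * ((κ / 2) ^ 2 + z ^ 2))) := by gcongr
        _ ≤ _ := by gcongr; linarith
    have c7 : Real.pi * κ ^ 3 ≤ Real.pi * r := by gcongr
    nlinarith
  · refine hE.trans ?_
    have d1 : κ / 2 + z ≤ 2 * κ * (1 + z) := by nlinarith
    have d0 : 0 ≤ κ / 2 + z := by positivity
    have d2 : (1:ℝ) ≤ 4 * κ ^ 2 := by nlinarith
    have hz1 : 1 ≤ 1 + z := by linarith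
    have d3 : κ / 2 + z ≤ 8 * κ ^ 3 * (1 + z) ^ 3 := by
      calc _ ≤ 2 * κ * (1 + z) := d1
        _ ≤ 2 * κ * (1 + z) ^ 3 := by gcongr; exact le_self_pow₀ hz1 (by norm_num)
        _ = 2 * κ * 1 * (1 + z) ^ 3 := by ring
        _ ≤ 2 * κ * (4 * κ ^ 2) * (1 + z) ^ 3 := by gcongr
        _ = _ := by ring
    have d4 : 2 * Real.pi * (κ / 2 + z) ^ 3 ≤ 64 * κ ^ 3 * (1 + z) ^ 3 := by
      calc _ ≤ 2 * 4 * (2 * κ * (1 + z)) ^ 3 := by gcongr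
        _ = _ := by ring
    have d5 : 2 * Real.pi * κ * (κ / 2 + z) ^ 2 ≤ 32 * κ ^ 3 * (1 + z) ^ 3 := by
      calc _ ≤ 2 * 4 * κ * (2 * κ * (1 + z)) ^ 2 := by gcongr
        _ = 32 * κ ^ 3 * (1 + z) ^ 2 := by ring
        _ ≤ _ := by gcongr; norm_num
    calc _ ≤ (104 * κ ^ 3 * (1 + z) ^ 3) / r := by gcongr; linarith
      _ = _ := by ring

noncomputable def KC : ℝ := 20000 * Real.exp 10

theorem seg_ptw (η : ℂ) (hη : η ≠ 0) (κ : ℝ) (hκ : 1 / 2 ≤ κ) (hκr : 2000 * κ ≤ ‖η‖) (hκ3 : κ ^ 3 ≤ ‖η‖)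
    (v : ℝ) (hv : |v| ≤ ‖η‖ / 16) (u : ℂ) (hu : η * u = -κ / 2 + om * v) :
    ‖exp (-2 * Real.pi * v ^ 2) * exp (EE η κ u) - exp (-2 * Real.pi * v ^ 2)‖ ≤
      KC * (κ ^ 3 / ‖η‖) * Real.exp (-|v|) := by
  obtain ⟨h1, h2⟩ := EE_bd2 η hη κ hκ hκr hκ3 v hv u hu
  have hr : 0 < ‖η‖ := norm_pos_iff.mpr hη
  have hp := Real.pi_gt_three
  have hp4 := Real.pi_lt_d2
  have e1 : ‖exp (EE η κ u) - 1‖ ≤ ‖EE η κ u‖ * Real.exp ‖EE η κ u‖ := by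
    have := Complex.norm_exp_sub_sum_le_norm_mul_exp (EE η κ u) 1
    simpa using this
  have e0 : ‖exp (-2 * Real.pi * (v:ℂ) ^ 2)‖ = Real.exp (-2 * Real.pi * v ^ 2) := by
    rw [Complex.norm_exp]
    congr 1
    have : (-2 * Real.pi * (v:ℂ) ^ 2) = ((-2 * Real.pi * v ^ 2 : ℝ) : ℂ) := by push_cast; ring
    rw [this, ofReal_re]
  have e2 : exp (-2 * Real.pi * (v:ℂ) ^ 2) * exp (EE η κ u) - exp (-2 * Real.pi * (v:ℂ) ^ 2) =
    exp (-2 * Real.pi * (v:ℂ) ^ 2) * (exp (EE η κ u) - 1) := by ring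
  rw [e2, norm_mul, e0]
  have hz0 := abs_nonneg v
  have hvs : |v| ^ 2 = v ^ 2 := sq_abs v
  set z := |v|
  have e3 : (1 + z) ^ 3 ≤ 6 * Real.exp (1 + z) := by
    have := Real.pow_div_factorial_le_exp (1 + z) (by linarith) 3
    norm_num [Nat.factorial] at this
    linarith
  calc _ ≤ Real.exp (-2 * Real.pi * v ^ 2) * (‖EE η κ u‖ * Real.exp ‖EE η κ u‖) := by gcongr
    _ ≤ Real.exp (-2 * Real.pi * v ^ 2) * ((104 * (κ ^ 3 / ‖η‖) * (1 + z) ^ 3) *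
          Real.exp ((2 * Real.pi + 1) + 3 * Real.pi / 4 * v ^ 2)) := by
        apply mul_le_mul_of_nonneg_left _ (Real.exp_pos _).le
        exact mul_le_mul h2 (Real.exp_le_exp.mpr h1) (Real.exp_pos _).le (by positivity)
    _ ≤ Real.exp (-2 * Real.pi * v ^ 2) * ((104 * (κ ^ 3 / ‖η‖) * (6 * Real.exp (1 + z))) *
          Real.exp ((2 * Real.pi + 1) + 3 * Real.pi / 4 * v ^ 2)) := by gcongr
    _ = 624 * (κ ^ 3 / ‖η‖) * (Real.exp (-2 * Real.pi * v ^ 2) * Real.exp (1 + z) *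
          Real.exp ((2 * Real.pi + 1) + 3 * Real.pi / 4 * v ^ 2)) := by ring
    _ = 624 * (κ ^ 3 / ‖η‖) * Real.exp (-2 * Real.pi * v ^ 2 + (1 + z) + ((2 * Real.pi + 1) + 3 * Real.pi / 4 * v ^ 2)) := by
        rw [← Real.exp_add, ← Real.exp_add]
    _ ≤ 20000 * (κ ^ 3 / ‖η‖) * Real.exp (10 - z) := by
        have hκ0 : 0 ≤ κ := by linarith
        apply mul_le_mul
        · gcongr; norm_num
        · apply Real.exp_le_exp.mpr
          have : 3 * v ^ 2 ≤ Real.pi * v ^ 2 := by gcongr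
          have : 2 * z - 3 * v ^ 2 ≤ 1 := by rw [← hvs]; nlinarith [sq_nonneg (3 * z - 1)]
          nlinarith
        · positivity
        · positivity
    _ = _ := by unfold KC; rw [sub_eq_add_neg, Real.exp_add]; ring

end RZ

namespace RZ
open Complex Filter Topology Set

theorem geo_right (η : ℂ) (ha : 0 < η.im) (hb : η.im ≤ η.re) (κ : ℝ) (hκ : 0 ≤ κ) (hκr : 2000 * κ ≤ ‖η‖)
    (u : ℂ) (hu : η * u = -κ / 2 + om * (‖η‖ / 16 : ℝ)) :
    (η ^ 2).im ≤ ((η * exp u) ^ 2).im ∧ 0 ≤ (η * exp u).im ∧ 0 ≤ u.im ∧ ‖u‖ ≤ 5 / 64 := by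
  have hη : η ≠ 0 := by intro h; rw [h] at ha; simp at ha
  set r := ‖η‖ with hr'
  have hr : 0 < r := norm_pos_iff.mpr hη
  have hs2 : (1.41 : ℝ) ≤ Real.sqrt 2 := Real.le_sqrt_of_sq_le (by norm_num)
  have hp : ‖η * u‖ ≤ 5 / 64 * r := by
    rw [hu]
    refine (norm_add_le _ _).trans ?_
    rw [norm_mul, om_norm, norm_div, norm_neg, norm_real, norm_real, Real.norm_of_nonneg hκ, Real.norm_of_nonneg (by positivity)]
    simp only [Complex.norm_ofNat]
    linarith
  have hu1 : ‖u‖ ≤ 5 / 64 := by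
    rw [norm_mul, ← hr'] at hp
    exact le_of_mul_le_mul_left (by linarith) hr
  have hab : r ≤ η.re + η.im := by
    have := Complex.norm_le_abs_re_add_abs_im η
    rw [abs_of_pos ha, abs_of_pos (by linarith)] at this; exact this
  have hre : (η * u).re = -κ / 2 + Real.sqrt 2 / 2 * (r / 16) := by
    rw [hu, add_re, mul_comm om, re_ofReal_mul, om_re]
    have : (-(κ:ℂ) / 2) = ((-κ / 2 : ℝ) : ℂ) := by push_cast; ring
    rw [this, ofReal_re]; ring
  have him : (η * u).im = Real.sqrt 2 / 2 * (r / 16) := by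
    rw [hu, add_im, mul_comm om, im_ofReal_mul, om_im]
    have : (-(κ:ℂ) / 2) = ((-κ / 2 : ℝ) : ℂ) := by push_cast; ring
    rw [this, ofReal_im]; ring
  have har : η.im ≤ r := (le_abs_self _).trans (Complex.abs_im_le_norm η)
  refine ⟨?_, ?_, ?_, hu1⟩
  · have e : (η * exp u) ^ 2 = η ^ 2 + 2 * (η * (η * u)) + η ^ 2 * (exp (2 * u) - 1 - 2 * u) := by
      rw [mul_pow, ← Complex.exp_nat_mul]; push_cast; ring
    have n1 : ‖η ^ 2 * (exp (2 * u) - 1 - 2 * u)‖ ≤ 0.02 * r ^ 2 := by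
      rw [norm_mul, norm_pow, ← hr']
      have := exp2_bd (2 * u) (by rw [norm_mul]; simp; linarith)
      rw [norm_mul, Complex.norm_ofNat] at this
      calc _ ≤ r ^ 2 * (3 / 4 * (2 * (5 / 64)) ^ 2) := by gcongr; exact this.trans (by gcongr)
        _ ≤ _ := by nlinarith [sq_nonneg r]
    have n2 := (abs_le.mp (Complex.abs_im_le_norm (η ^ 2 * (exp (2 * u) - 1 - 2 * u)))).1
    have n3 : (2 * (η * (η * u))).im = 2 * (η.re * (η * u).im + η.im * (η * u).re) := by
      rw [← ofReal_ofNat, im_ofReal_mul, mul_im η (η * u)]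
    rw [e, add_im, add_im, n3, hre, him]
    have k1 : 0.08 * r ^ 2 ≤ 2 * (Real.sqrt 2 / 2 * (r / 16)) * (η.re + η.im) := by
      calc 0.08 * r ^ 2 ≤ 2 * (1.41 / 2 * (r / 16)) * r := by nlinarith [sq_nonneg r]
        _ ≤ _ := by gcongr
    have k2 : η.im * κ ≤ r * (r / 2000) := by gcongr; linarith
    nlinarith [sq_nonneg r]
  · have e : η * exp u = η + η * u + η * (exp u - 1 - u) := by ring
    have n1 : ‖η * (exp u - 1 - u)‖ ≤ 0.01 * r := by
      rw [norm_mul, ← hr']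
      have := exp2_bd u (by linarith)
      calc _ ≤ r * (3 / 4 * (5 / 64) ^ 2) := by gcongr; exact this.trans (by gcongr)
        _ ≤ _ := by nlinarith
    have n2 := (abs_le.mp (Complex.abs_im_le_norm (η * (exp u - 1 - u)))).1
    rw [e, add_im, add_im, him]
    nlinarith
  · have e : u = (η * u) / η := by field_simp
    rw [e, div_im, hre, him]
    rw [← sub_div]
    apply div_nonneg _ (normSq_nonneg _)
    have : 0 ≤ Real.sqrt 2 / 2 * (r / 16) := by positivity
    nlinarith [mul_nonneg this (sub_nonneg.mpr hb), mul_nonneg hκ ha.le]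

theorem geo_left (η : ℂ) (ha : 0 < η.im) (hb : η.im ≤ η.re) (κ : ℝ) (hκ : 0 ≤ κ) (hκr : 2000 * κ ≤ ‖η‖)
    (u : ℂ) (hu : η * u = -κ / 2 + om * (-(‖η‖ / 16) : ℝ)) :
    ((η * exp u) ^ 2).im ≤ (η ^ 2).im ∧ ‖u‖ ≤ 5 / 64 := by
  have hη : η ≠ 0 := by intro h; rw [h] at ha; simp at ha
  set r := ‖η‖ with hr'
  have hr : 0 < r := norm_pos_iff.mpr hη
  have hs2 : (1.41 : ℝ) ≤ Real.sqrt 2 := Real.le_sqrt_of_sq_le (by norm_num)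
  have hp : ‖η * u‖ ≤ 5 / 64 * r := by
    rw [hu]
    refine (norm_add_le _ _).trans ?_
    rw [norm_mul, om_norm, norm_div, norm_neg, norm_real, norm_real, Real.norm_of_nonneg hκ, norm_neg, Real.norm_of_nonneg (by positivity)]
    simp only [Complex.norm_ofNat]
    linarith
  have hu1 : ‖u‖ ≤ 5 / 64 := by
    rw [norm_mul, ← hr'] at hp
    exact le_of_mul_le_mul_left (by linarith) hr
  have hab : r ≤ η.re + η.im := by
    have := Complex.norm_le_abs_re_add_abs_im η
    rw [abs_of_pos ha, abs_of_pos (by linarith)] at this; exact this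
  have hre : (η * u).re = -κ / 2 - Real.sqrt 2 / 2 * (r / 16) := by
    rw [hu, add_re, mul_comm om, re_ofReal_mul, om_re]
    have : (-(κ:ℂ) / 2) = ((-κ / 2 : ℝ) : ℂ) := by push_cast; ring
    rw [this, ofReal_re]; ring
  have him : (η * u).im = -(Real.sqrt 2 / 2 * (r / 16)) := by
    rw [hu, add_im, mul_comm om, im_ofReal_mul, om_im]
    have : (-(κ:ℂ) / 2) = ((-κ / 2 : ℝ) : ℂ) := by push_cast; ring
    rw [this, ofReal_im]; ring
  refine ⟨?_, hu1⟩
  have e : (η * exp u) ^ 2 = η ^ 2 + 2 * (η * (η * u)) + η ^ 2 * (exp (2 * u) - 1 - 2 * u) := by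
    rw [mul_pow, ← Complex.exp_nat_mul]; push_cast; ring
  have n1 : ‖η ^ 2 * (exp (2 * u) - 1 - 2 * u)‖ ≤ 0.02 * r ^ 2 := by
    rw [norm_mul, norm_pow, ← hr']
    have := exp2_bd (2 * u) (by rw [norm_mul]; simp; linarith)
    rw [norm_mul, Complex.norm_ofNat] at this
    calc _ ≤ r ^ 2 * (3 / 4 * (2 * (5 / 64)) ^ 2) := by gcongr; exact this.trans (by gcongr)
      _ ≤ _ := by nlinarith [sq_nonneg r]
  have n2 := (abs_le.mp (Complex.abs_im_le_norm (η ^ 2 * (exp (2 * u) - 1 - 2 * u)))).2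
  have n3 : (2 * (η * (η * u))).im = 2 * (η.re * (η * u).im + η.im * (η * u).re) := by
    rw [← ofReal_ofNat, im_ofReal_mul, mul_im η (η * u)]
  rw [e, add_im, add_im, n3, hre, him]
  have k1 : 0.08 * r ^ 2 ≤ 2 * (Real.sqrt 2 / 2 * (r / 16)) * (η.re + η.im) := by
    calc 0.08 * r ^ 2 ≤ 2 * (1.41 / 2 * (r / 16)) * r := by nlinarith [sq_nonneg r]
      _ ≤ _ := by gcongr
  have k2 : 0 ≤ η.im * κ := by positivity
  nlinarith [sq_nonneg r]

theorem sin_low (x θ : ℝ) (h0 : 0 < θ) (h1 : θ ≤ x) (h2 : x ≤ Real.pi / 4 + 5 / 64) (h3 : θ ≤ Real.pi / 4) :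
    min (Real.sin (2 * θ)) (1 / 2) ≤ Real.sin (2 * x) := by
  rcases le_or_gt x (Real.pi / 4) with h | h
  · refine (min_le_left _ _).trans ?_
    apply Real.sin_le_sin_of_le_of_le_pi_div_two <;> linarith
  · refine (min_le_right _ _).trans ?_
    rw [← Real.cos_sub_pi_div_two]
    have := Real.one_sub_sq_div_two_le_cos (x := 2 * x - Real.pi / 2)
    nlinarith

/-- the crude bounds needed by the contour lemma -/
theorem crude_bds (η : ℂ) (ha : 0 < η.im) (hb : η.im ≤ η.re) (hs : (S η).re ≤ -2) (κ : ℝ) (hκ : 0 ≤ κ)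
    (up um : ℂ) (hp0 : 0 ≤ up.im) (hp : ‖up‖ ≤ 5 / 64) (hm : ‖um‖ ≤ 5 / 64) :
    ∃ C : ℝ, (∀ τ ∈ Icc (0:ℝ) 1, ∀ y : ℝ, 0 ≤ y → ‖PR (S η) κ (log η + τ * up + y)‖ ≤ C * Real.exp (-|y|)) ∧
    (∀ τ ∈ Icc (0:ℝ) 1, ∀ y : ℝ, y ≤ 0 → ‖PR (S η) κ (log η + τ * um + y)‖ ≤ C * Real.exp (-|y|)) := by
  obtain ⟨h0, h1⟩ := arg_range η ha hb
  have hpi := Real.pi_gt_three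
  have hpi4 := Real.pi_le_four
  set m := min (Real.sin (2 * arg η)) (1 / 2)
  have hm0 : 0 < m := lt_min (Real.sin_pos_of_pos_of_lt_pi (by linarith) (by linarith)) (by norm_num)
  set C1 := Real.exp (|(S η).im| * 4 + (1 - (S η).re + 1) ^ 2 / (8 * (Real.pi * m))) with hC1
  set B := Real.log ‖η‖ + 1 with hB
  set C2 := Real.exp (-(S η).re * |B| + |(S η).im| * 4 + Real.pi * Real.exp (2 * B) + 2 * Real.pi * κ * Real.exp B) with hC2
  refine ⟨max (C1 * Real.exp (|Real.log ‖η‖| + 1)) (C2 * Real.exp B), fun τ hτ y hy => ?_, fun τ hτ y hy => ?_⟩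
  · have a1 := abs_le.mp ((Complex.abs_re_le_norm up).trans hp)
    have a2 := abs_le.mp ((Complex.abs_im_le_norm up).trans hp)
    have hre : (log η + τ * up + y).re = Real.log ‖η‖ + τ * up.re + y := by
      rw [add_re, add_re, log_re, re_ofReal_mul, ofReal_re]
    have him : (log η + τ * up + y).im = arg η + τ * up.im := by
      rw [add_im, add_im, log_im, im_ofReal_mul, ofReal_im, add_zero]
    have b0 : 0 ≤ τ * up.im := mul_nonneg hτ.1 hp0
    have b1 : τ * up.im ≤ 5 / 64 := by nlinarith [hτ.1, hτ.2]
    have b2 : |τ * up.re| ≤ 1 := by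
      rw [abs_mul, abs_of_nonneg hτ.1]
      have : |up.re| ≤ 1 := ((Complex.abs_re_le_norm up).trans hp).trans (by norm_num)
      nlinarith [hτ.1, hτ.2, abs_nonneg up.re]
    refine (PR_right_crude (S η) (by linarith) κ hκ m hm0 _ (by rw [him]; linarith) (by rw [him]; linarith)
      (by rw [him]; exact sin_low _ _ h0 (by linarith) (by linarith) h1)).trans ?_
    rw [← hC1]
    calc C1 * Real.exp (-|(log η + τ * up + y).re|) ≤ C1 * Real.exp ((|Real.log ‖η‖| + 1) + -|y|) := by
          gcongr
          rw [hre]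
          have := abs_sub_abs_le_abs_sub y (-(Real.log ‖η‖ + τ * up.re))
          rw [abs_neg] at this
          have t2 := abs_add_le (Real.log ‖η‖) (τ * up.re)
          have t3 : y - -(Real.log ‖η‖ + τ * up.re) = Real.log ‖η‖ + τ * up.re + y := by ring
          rw [t3] at this
          linarith
      _ = C1 * Real.exp (|Real.log ‖η‖| + 1) * Real.exp (-|y|) := by rw [Real.exp_add]; ring
      _ ≤ _ := by gcongr; exact le_max_left _ _
  · have a1 := abs_le.mp ((Complex.abs_re_le_norm um).trans hm)
    have hre : (log η + τ * um + y).re = Real.log ‖η‖ + τ * um.re + y := by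
      rw [add_re, add_re, log_re, re_ofReal_mul, ofReal_re]
    have him : (log η + τ * um + y).im = arg η + τ * um.im := by
      rw [add_im, add_im, log_im, im_ofReal_mul, ofReal_im, add_zero]
    have b2 : |τ * um.im| ≤ 1 := by
      rw [abs_mul, abs_of_nonneg hτ.1]
      have : |um.im| ≤ 1 := ((Complex.abs_im_le_norm um).trans hm).trans (by norm_num)
      nlinarith [hτ.1, hτ.2, abs_nonneg um.im]
    have b3 : τ * um.re ≤ 1 := by nlinarith [hτ.1, hτ.2]
    refine (PR_left_crude (S η) (by linarith) κ hκ _ B (by rw [hre]; linarith) ?_).trans ?_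
    · rw [him]
      have := abs_add_le (arg η) (τ * um.im)
      rw [abs_of_pos h0] at this
      linarith
    · rw [← hC2, abs_of_nonpos hy, neg_neg]
      calc C2 * Real.exp (log η + τ * um + y).re ≤ C2 * Real.exp (B + y) := by
            gcongr; rw [hre]; linarith
        _ = C2 * Real.exp B * Real.exp y := by rw [Real.exp_add]; ring
        _ ≤ _ := by gcongr; exact le_max_right _ _

end RZ

namespace RZ
open Complex Filter Topology Set

noncomputable def EX : ℝ := ∫ x : ℝ, Real.exp (-|x|)
theorem EX_nonneg : 0 ≤ EX := integral_nonneg fun _ => (Real.exp_pos _).le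

noncomputable def DD (η : ℂ) (κ : ℝ) : ℂ :=
  fR (S η) η * exp (2 * Real.pi * I * κ * η) * exp (-Real.pi * I * κ ^ 2 / 2)

noncomputable def G0 : ℂ := ∫ v : ℝ, exp (-2 * Real.pi * v ^ 2)

theorem G_norm (v : ℝ) : ‖exp (-2 * Real.pi * (v:ℂ) ^ 2)‖ = Real.exp (-2 * Real.pi * v ^ 2) := by
  rw [Complex.norm_exp]
  congr 1
  have : (-2 * Real.pi * (v:ℂ) ^ 2) = ((-2 * Real.pi * v ^ 2 : ℝ) : ℂ) := by push_cast; ring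
  rw [this, ofReal_re]

theorem G_int : Integrable fun v : ℝ => exp (-2 * Real.pi * (v:ℂ) ^ 2) := by
  have := integrable_cexp_neg_mul_sq (b := 2 * Real.pi) (by simp; exact Real.pi_pos)
  simpa using this

theorem G0_eq : G0 = ((Real.sqrt 2 / 2 : ℝ) : ℂ) := by
  unfold G0
  have h := integral_gaussian (2 * Real.pi)
  have : ∀ v : ℝ, exp (-2 * Real.pi * (v:ℂ) ^ 2) = ((Real.exp (-(2 * Real.pi) * v ^ 2) : ℝ) : ℂ) := by
    intro v; push_cast; ring_nf
  simp only [this]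
  rw [integral_complex_ofReal, h]
  congr 1
  have hp := Real.pi_pos
  rw [show Real.pi / (2 * Real.pi) = (Real.sqrt 2 / 2) ^ 2 by
    rw [sq, sq2]; field_simp]
  exact Real.sqrt_sq (by positivity)

theorem endpoint_bd (η : ℂ) (hη : η ≠ 0) (κ : ℝ) (hκ : 1 / 2 ≤ κ) (hκr : 2000 * κ ≤ ‖η‖) (hκ3 : κ ^ 3 ≤ ‖η‖)
    (v : ℝ) (hv : |v| = ‖η‖ / 16) (u : ℂ) (hu : η * u = -κ / 2 + om * v) :
    ‖PR (S η) κ (log η + u)‖ * Real.exp (4 * Real.pi * κ * ‖η‖) ≤ ‖DD η κ‖ * (1000 * Real.exp 8 * (κ ^ 3 / ‖η‖)) := by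
  obtain ⟨h1, -⟩ := EE_bd2 η hη κ hκ hκr hκ3 v hv.le u hu
  have hv2 : v ^ 2 = ‖η‖ ^ 2 / 256 := by rw [← sq_abs, hv]; ring
  have e : PR (S η) κ (log η + u) = DD η κ * (η * (exp (-2 * Real.pi * v ^ 2) * exp (EE η κ u))) := by
    rw [seg_eq η hη κ v u hu]; unfold DD; ring
  set r := ‖η‖ with hr'
  have hr : 0 < r := norm_pos_iff.mpr hη
  have hp := Real.pi_gt_three
  have hp4 := Real.pi_lt_d2
  rw [e, norm_mul, norm_mul, norm_mul, G_norm, ← hr', mul_assoc]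
  apply mul_le_mul_of_nonneg_left _ (norm_nonneg _)
  have hE : ‖exp (EE η κ u)‖ ≤ Real.exp ((2 * Real.pi + 1) + 3 * Real.pi / 4 * v ^ 2) :=
    (Complex.norm_exp_le_exp_norm _).trans (Real.exp_le_exp.mpr h1)
  have h8 : Real.exp (-(0.008 * r ^ 2)) ≤ 1 / (0.008 * r ^ 2) := by
    rw [Real.exp_neg, ← one_div]
    apply one_div_le_one_div_of_le (by positivity)
    linarith [Real.add_one_le_exp (0.008 * r ^ 2)]
  have k3 : (1:ℝ) ≤ 8 * κ ^ 3 := by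
    have : (1/2 : ℝ) ^ 3 ≤ κ ^ 3 := by gcongr
    linarith
  calc r * (Real.exp (-2 * Real.pi * v ^ 2) * ‖exp (EE η κ u)‖) * Real.exp (4 * Real.pi * κ * r)
      ≤ r * (Real.exp (-2 * Real.pi * v ^ 2) * Real.exp ((2 * Real.pi + 1) + 3 * Real.pi / 4 * v ^ 2)) * Real.exp (4 * Real.pi * κ * r) := by gcongr
    _ = r * Real.exp (-2 * Real.pi * v ^ 2 + ((2 * Real.pi + 1) + 3 * Real.pi / 4 * v ^ 2) + 4 * Real.pi * κ * r) := by
        rw [← Real.exp_add, mul_assoc, ← Real.exp_add]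
    _ ≤ r * Real.exp (8 + -(0.008 * r ^ 2)) := by
        apply mul_le_mul_of_nonneg_left _ hr.le
        apply Real.exp_le_exp.mpr
        have t1 : 4 * Real.pi * κ * r ≤ 4 * Real.pi * (r / 2000) * r := by gcongr; linarith
        have t2 : 3 * r ^ 2 ≤ Real.pi * r ^ 2 := by gcongr
        rw [hv2]
        nlinarith
    _ = r * (Real.exp 8 * Real.exp (-(0.008 * r ^ 2))) := by rw [Real.exp_add]
    _ ≤ r * (Real.exp 8 * (1 / (0.008 * r ^ 2))) := by gcongr
    _ = 125 * Real.exp 8 * (1 / r) := by field_simp; norm_num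
    _ ≤ 125 * Real.exp 8 * (8 * κ ^ 3 / r) := by gcongr
    _ = _ := by ring

theorem gauss_tail (r κ : ℝ) (hκ : 1 / 2 ≤ κ) (hκr : 2000 * κ ≤ r) (v : ℝ) (hv : r / 16 ≤ |v|) :
    Real.exp (-2 * Real.pi * v ^ 2) ≤ KC * (κ ^ 3 / r) * Real.exp (-|v|) := by
  have hr : 1000 ≤ r := by linarith
  have hp := Real.pi_gt_three
  have hvs : |v| ^ 2 = v ^ 2 := sq_abs v
  have k3 : (1:ℝ) ≤ 8 * κ ^ 3 := by
    have : (1/2 : ℝ) ^ 3 ≤ κ ^ 3 := by gcongr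
    linarith
  have hz0 := abs_nonneg v
  set z := |v|
  have h1 : Real.exp (-z) ≤ 16 / r := by
    rw [Real.exp_neg, show 16 / r = (r / 16)⁻¹ by field_simp]
    apply inv_anti₀ (by positivity)
    linarith [Real.add_one_le_exp z]
  calc _ ≤ Real.exp (-z + -z) := by
        apply Real.exp_le_exp.mpr
        rw [← hvs]
        have : 62 ≤ z := by linarith
        nlinarith
    _ = Real.exp (-z) * Real.exp (-z) := Real.exp_add _ _
    _ ≤ 16 / r * Real.exp (-z) := by gcongr
    _ ≤ _ := by
        gcongr
        calc 16 / r = 16 * (1 / r) := by ring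
          _ ≤ 16 * (8 * κ ^ 3 / r) := by gcongr
          _ = 128 * (κ ^ 3 / r) := by ring
          _ ≤ KC * (κ ^ 3 / r) := by
            have hκ0 : 0 ≤ κ := by linarith
            gcongr
            unfold KC
            have := Real.add_one_le_exp (10:ℝ)
            linarith

noncomputable def CI : ℝ := (2 * KC + 4000 * Real.exp 9) * EX + 1

theorem CI_pos : 0 < CI := by
  have := EX_nonneg
  unfold CI KC
  positivity

theorem I_asym (η : ℂ) (ha : 0 < η.im) (hb : η.im ≤ η.re) (hs : (S η).re ≤ -2) (κ : ℝ) (hκ : 1 / 2 ≤ κ)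
    (hκr : 2000 * κ ≤ ‖η‖) (hκ3 : κ ^ 3 ≤ ‖η‖) :
    ‖(∫ y : ℝ, PR (S η) κ (log η + y)) - om * G0 * DD η κ‖ ≤ CI * ‖DD η κ‖ * (κ ^ 3 / ‖η‖) := by
  have hη : η ≠ 0 := by intro h; rw [h] at ha; simp at ha
  have hκ0 : 0 ≤ κ := by linarith
  set r := ‖η‖ with hr'
  have hr : 0 < r := norm_pos_iff.mpr hη
  have hp := Real.pi_pos
  set α : ℂ := -κ / 2 / η with hα
  set β : ℂ := om / η with hβ
  set V : ℝ := r / 16 with hV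
  have hV0 : 0 < V := by positivity
  have huv : ∀ v : ℝ, η * (α + β * v) = -κ / 2 + om * v := by
    intro v; rw [hα, hβ]; field_simp
  have hup := huv V
  have hum : η * (α - β * V) = -κ / 2 + om * (-V : ℝ) := by
    rw [← huv (-V)]; push_cast; ring
  obtain ⟨r1, r2, r3, r4⟩ := geo_right η ha hb κ hκ0 hκr (α + β * V) hup
  obtain ⟨l1, l2⟩ := geo_left η ha hb κ hκ0 hκr (α - β * V) hum
  obtain ⟨C, hC1, hC2⟩ := crude_bds η ha hb hs κ hκ0 (α + β * V) (α - β * V) r3 r4 l2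
  have hexp : ∀ u : ℂ, exp (log η + u) = η * exp u := by
    intro u; rw [Complex.exp_add, Complex.exp_log hη]
  have hSre : -(S η).re = 2 * Real.pi * (η ^ 2).im := by
    rw [S_re, sq, mul_im]; ring
  have bp : ∀ y : ℝ, 0 ≤ y → ‖PR (S η) κ (log η + (α + β * V) + y)‖ ≤
      ‖DD η κ‖ * (1000 * Real.exp 9 * (κ ^ 3 / r)) * Real.exp (-|y|) := by
    intro y hy
    have h := PR_radial_right (S η) hs κ hκ0 (log η + (α + β * V)) y hy
      (by rw [hexp, hSre]; gcongr) (by rw [hexp]; exact r2)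
    have e1 := endpoint_bd η hη κ hκ hκr hκ3 V (abs_of_pos hV0) _ hup
    have e2 : (1:ℝ) ≤ Real.exp (4 * Real.pi * κ * ‖η‖) := Real.one_le_exp (by positivity)
    refine h.trans ?_
    rw [abs_of_nonneg hy, sub_eq_add_neg, Real.exp_add, ← mul_assoc]
    apply mul_le_mul_of_nonneg_right _ (Real.exp_pos _).le
    calc _ ≤ ‖PR (S η) κ (log η + (α + β * V))‖ * Real.exp (4 * Real.pi * κ * ‖η‖) * Real.exp 1 := by
          gcongr; exact le_mul_of_one_le_right (norm_nonneg _) e2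
      _ ≤ ‖DD η κ‖ * (1000 * Real.exp 8 * (κ ^ 3 / ‖η‖)) * Real.exp 1 := by gcongr
      _ = ‖DD η κ‖ * (1000 * (Real.exp 8 * Real.exp 1) * (κ ^ 3 / r)) := by ring
      _ = _ := by rw [← Real.exp_add, show (8:ℝ) + 1 = 9 by norm_num]
  have bm : ∀ y : ℝ, y ≤ 0 → ‖PR (S η) κ (log η + (α - β * V) + y)‖ ≤
      ‖DD η κ‖ * (1000 * Real.exp 9 * (κ ^ 3 / r)) * Real.exp (-|y|) := by
    intro y hy
    have h := PR_radial_left (S η) (by linarith) κ hκ0 (log η + (α - β * V)) y hy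
      (by rw [hexp, hSre]; gcongr)
    have e1 := endpoint_bd η hη κ hκ hκr hκ3 (-V) (by rw [abs_neg]; exact abs_of_pos hV0) _ hum
    refine h.trans ?_
    rw [abs_of_nonpos hy, neg_neg]
    apply mul_le_mul_of_nonneg_right _ (Real.exp_pos _).le
    calc _ ≤ ‖PR (S η) κ (log η + (α - β * V))‖ * Real.exp (4 * Real.pi * κ * ‖η‖) := by
          apply mul_le_mul_of_nonneg_left _ (norm_nonneg _)
          apply Real.exp_le_exp.mpr
          rw [hexp, norm_mul]
          have : ‖exp (α - β * V)‖ ≤ 2 := by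
            refine (Complex.norm_exp_le_exp_norm _).trans ?_
            calc Real.exp ‖α - β * V‖ ≤ Real.exp (5 / 64) := Real.exp_le_exp.mpr l2
              _ ≤ Real.exp (Real.log 2) := by
                apply Real.exp_le_exp.mpr; linarith [Real.log_two_gt_d9]
              _ = 2 := Real.exp_log (by norm_num)
          calc _ ≤ 2 * Real.pi * κ * (‖η‖ * 2) := by gcongr
            _ = _ := by ring
      _ ≤ _ := e1
      _ ≤ _ := by gcongr; norm_num
  have mp : ∀ w : ℂ, AEStronglyMeasurable (fun y : ℝ => PR (S η) κ (w + y)) volume := fun w =>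
    ((PR_diff _ _).continuous.comp (by fun_prop)).aestronglyMeasurable
  have iX := integrable_exp_neg_abs.const_mul (‖DD η κ‖ * (1000 * Real.exp 9 * (κ ^ 3 / r)))
  have ip : IntegrableOn (fun y : ℝ => PR (S η) κ (log η + (α + β * V) + y)) (Ioi 0) :=
    iX.integrableOn.mono' (mp _).restrict (by
      refine (ae_restrict_iff' measurableSet_Ioi).mpr (Eventually.of_forall fun y hy => bp y (le_of_lt hy)))
  have im : IntegrableOn (fun y : ℝ => PR (S η) κ (log η + (α - β * V) + y)) (Iic 0) :=
    iX.integrableOn.mono' (mp _).restrict (by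
      refine (ae_restrict_iff' measurableSet_Iic).mpr (Eventually.of_forall fun y hy => bm y hy))
  have hcont := contour (PR (S η) κ) (PR_diff _ _) (log η) α β V (PR_ray_int η ha hb hs κ hκ0) im ip C hC1 hC2
  have nX : ∀ (s : Set ℝ) (K : ℝ), 0 ≤ K → ∫ y in s, K * Real.exp (-|y|) ≤ K * EX := by
    intro s K hK
    refine (setIntegral_le_integral (integrable_exp_neg_abs.const_mul K)
      (Eventually.of_forall fun y => mul_nonneg hK (Real.exp_pos _).le)).trans (le_of_eq ?_)
    rw [integral_const_mul]; rfl
  have K0 : 0 ≤ ‖DD η κ‖ * (1000 * Real.exp 9 * (κ ^ 3 / r)) := by positivity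
  have np : ‖∫ y : ℝ in Ioi 0, PR (S η) κ (log η + (α + β * V) + y)‖ ≤
      ‖DD η κ‖ * (1000 * Real.exp 9 * (κ ^ 3 / r)) * EX := by
    refine (norm_integral_le_of_norm_le iX.integrableOn (by
      refine (ae_restrict_iff' measurableSet_Ioi).mpr (Eventually.of_forall fun y hy => bp y (le_of_lt hy)))).trans ?_
    exact nX _ _ K0
  have nm : ‖∫ y : ℝ in Iic 0, PR (S η) κ (log η + (α - β * V) + y)‖ ≤
      ‖DD η κ‖ * (1000 * Real.exp 9 * (κ ^ 3 / r)) * EX := by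
    refine (norm_integral_le_of_norm_le iX.integrableOn (by
      refine (ae_restrict_iff' measurableSet_Iic).mpr (Eventually.of_forall fun y hy => bm y hy))).trans ?_
    exact nX _ _ K0
  -- the segment
  set f : ℝ → ℂ := fun v => exp (-2 * Real.pi * (v:ℂ) ^ 2) * exp (EE η κ (α + β * v)) with hf
  have fseg : ∀ v : ℝ, PR (S η) κ (log η + (α + β * v)) * β = om * DD η κ * f v := by
    intro v
    rw [seg_eq η hη κ v _ (huv v)]
    have h1 : η * β = om := by rw [hβ]; field_simp
    change _ = om * DD η κ * (exp (-2 * Real.pi * (v:ℂ) ^ 2) * exp (EE η κ (α + β * v)))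
    rw [← h1]
    unfold DD
    ring
  have fcont : Continuous f := by
    rw [hf]
    unfold EE gQ
    fun_prop
  simp only [fseg] at hcont
  rw [intervalIntegral.integral_const_mul] at hcont
  have Gcont : Continuous fun v : ℝ => exp (-2 * Real.pi * (v:ℂ) ^ 2) := by fun_prop
  have KC0 : 0 ≤ KC := by unfold KC; positivity
  have K1 : 0 ≤ KC * (κ ^ 3 / r) := by positivity
  have s1 : ‖(∫ v in (-V)..V, f v) - ∫ v : ℝ in (-V)..V, exp (-2 * Real.pi * (v:ℂ) ^ 2)‖ ≤ KC * (κ ^ 3 / r) * EX := by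
    rw [← intervalIntegral.integral_sub (fcont.intervalIntegrable _ _) (Gcont.intervalIntegrable _ _)]
    rw [intervalIntegral.integral_of_le (by linarith)]
    refine (norm_integral_le_of_norm_le (integrable_exp_neg_abs.const_mul (KC * (κ ^ 3 / r))).integrableOn 
      ((ae_restrict_iff' measurableSet_Ioc).mpr (Eventually.of_forall fun v hv => ?_))).trans (nX _ _ K1)
    exact seg_ptw η hη κ hκ hκr hκ3 v (abs_le.mpr ⟨hv.1.le, hv.2⟩) _ (huv v)
  have s2 : ‖(∫ v : ℝ in (-V)..V, exp (-2 * Real.pi * (v:ℂ) ^ 2)) - G0‖ ≤ KC * (κ ^ 3 / r) * EX := by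
    rw [intervalIntegral.integral_of_le (by linarith)]
    have := integral_add_compl (measurableSet_Ioc (a := -V) (b := V)) G_int
    unfold G0
    rw [← this, sub_add_cancel_left, norm_neg]
    refine (norm_integral_le_of_norm_le (integrable_exp_neg_abs.const_mul (KC * (κ ^ 3 / r))).integrableOn 
      ((ae_restrict_iff' measurableSet_Ioc.compl).mpr (Eventually.of_forall fun v hv => ?_))).trans (nX _ _ K1)
    rw [G_norm]
    apply gauss_tail r κ hκ hκr v
    by_contra h
    push Not at h
    exact hv ⟨(abs_lt.mp h).1, (abs_lt.mp h).2.le⟩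
  rw [hcont]
  set A1 := ∫ y : ℝ in Iic 0, PR (S η) κ (log η + (α - β * V) + y)
  set A2 := ∫ y : ℝ in Ioi 0, PR (S η) κ (log η + (α + β * V) + y)
  set F := ∫ v in (-V)..V, f v
  set G := ∫ v : ℝ in (-V)..V, exp (-2 * Real.pi * (v:ℂ) ^ 2)
  have e : A1 + om * DD η κ * F + A2 - om * G0 * DD η κ = A1 + A2 + om * DD η κ * ((F - G) + (G - G0)) := by ring
  rw [e]
  calc _ ≤ ‖A1‖ + ‖A2‖ + ‖om * DD η κ * ((F - G) + (G - G0))‖ := norm_add₃_le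
    _ ≤ ‖A1‖ + ‖A2‖ + ‖DD η κ‖ * (‖F - G‖ + ‖G - G0‖) := by
        rw [norm_mul, norm_mul, om_norm, one_mul]
        gcongr
        exact norm_add_le _ _
    _ ≤ ‖DD η κ‖ * (1000 * Real.exp 9 * (κ ^ 3 / r)) * EX + ‖DD η κ‖ * (1000 * Real.exp 9 * (κ ^ 3 / r)) * EX +
        ‖DD η κ‖ * (KC * (κ ^ 3 / r) * EX + KC * (κ ^ 3 / r) * EX) := by gcongr
    _ = ((2 * KC + 2000 * Real.exp 9) * EX) * (‖DD η κ‖ * (κ ^ 3 / r)) := by ring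
    _ ≤ CI * (‖DD η κ‖ * (κ ^ 3 / r)) := by
        have := EX_nonneg
        gcongr
        unfold CI
        have : (0:ℝ) ≤ 2000 * Real.exp 9 * EX := by positivity
        linarith
    _ = _ := by ring

end RZ

namespace RZ
open Complex Filter Topology Set

theorem sum_cube_geom (n : ℕ) (ρ : ℝ) (h0 : 0 ≤ ρ) (h1 : ρ < 1) :
    ∑ k ∈ Finset.range n, ((k : ℝ) + 1 / 2) ^ 3 * ρ ^ k ≤ 6 / (1 - ρ) ^ 4 := by
  have h := hasSum_choose_mul_geometric_of_norm_lt_one 3 (show ‖ρ‖ < 1 by rwa [Real.norm_of_nonneg h0])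
  have h2 := sum_le_hasSum (Finset.range n) (fun k _ => by positivity) h
  calc ∑ k ∈ Finset.range n, ((k : ℝ) + 1 / 2) ^ 3 * ρ ^ k
      ≤ ∑ k ∈ Finset.range n, 6 * (((k + 3).choose 3 : ℕ) * ρ ^ k) := by
        apply Finset.sum_le_sum
        intro k _
        rw [← mul_assoc]
        gcongr
        have e : (k + 3).descFactorial 3 = 6 * (k + 3).choose 3 := by
          rw [Nat.descFactorial_eq_factorial_mul_choose]; rfl
        have e2 : (k + 3).descFactorial 3 = (k + 1) * ((k + 2) * (k + 3)) := by
          simp [Nat.descFactorial]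
        have e3 : (6 : ℝ) * ((k + 3).choose 3 : ℕ) = (k + 1) * ((k + 2) * (k + 3)) := by
          rw [e2] at e; exact_mod_cast e.symm
        rw [e3]
        have : (0:ℝ) ≤ k := Nat.cast_nonneg k
        nlinarith [mul_nonneg this this, mul_nonneg (mul_nonneg this this) this]
    _ = 6 * ∑ k ∈ Finset.range n, (((k + 3).choose 3 : ℕ) * ρ ^ k) := by rw [Finset.mul_sum]
    _ ≤ 6 * (1 / (1 - ρ) ^ 4) := by gcongr
    _ = _ := by ring

noncomputable def epsk (k : ℕ) : ℂ := exp (-Real.pi * I * (k * (k + 1)) / 2)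

theorem epsk_add_four (k : ℕ) : epsk (k + 4) = epsk k := by
  unfold epsk
  rw [Complex.exp_eq_exp_iff_exists_int]
  refine ⟨-(2 * k + 5), ?_⟩
  push_cast; ring

theorem epsk_vals : epsk 0 = 1 ∧ epsk 1 = -1 ∧ epsk 2 = -1 ∧ epsk 3 = 1 := by
  unfold epsk
  refine ⟨by simp, ?_, ?_, ?_⟩
  · rw [← Complex.exp_pi_mul_I, Complex.exp_eq_exp_iff_exists_int]
    exact ⟨-1, by push_cast; ring⟩
  · rw [← Complex.exp_pi_mul_I, Complex.exp_eq_exp_iff_exists_int]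
    exact ⟨-2, by push_cast; ring⟩
  · rw [Complex.exp_eq_one_iff]
    exact ⟨-3, by push_cast; ring⟩

theorem epsk_mul_four (m j : ℕ) : epsk (4 * m + j) = epsk j := by
  induction m with
  | zero => simp
  | succ m ih => rw [show 4 * (m + 1) + j = (4 * m + j) + 4 by ring, epsk_add_four, ih]

theorem eps_sum (q : ℂ) (m : ℕ) : (1 + q ^ 2) * ∑ k ∈ Finset.range (4 * m), epsk k * q ^ k =
    (1 - q) * (1 - q ^ (4 * m)) := by
  obtain ⟨h0, h1, h2, h3⟩ := epsk_vals
  induction m with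
  | zero => simp
  | succ m ih =>
    rw [show 4 * (m + 1) = 4 * m + 3 + 1 by ring, Finset.sum_range_succ, Finset.sum_range_succ,
      Finset.sum_range_succ, Finset.sum_range_succ, epsk_mul_four, epsk_mul_four, epsk_mul_four]
    have := epsk_mul_four m 0
    rw [add_zero] at this
    rw [this, h0, h1, h2, h3]
    linear_combination ih

theorem DD_eq (η : ℂ) (k : ℕ) : DD η (k + 1 / 2) = fR (S η) η * exp (Real.pi * I * η) * exp (-Real.pi * I / 8) *
    (epsk k * exp (2 * Real.pi * I * η) ^ k) := by
  unfold DD epsk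
  rw [← Complex.exp_nat_mul]
  simp only [mul_assoc]
  congr 1
  simp only [← Complex.exp_add]
  congr 1
  push_cast
  ring

theorem norm_exp_piI (c : ℝ) (η : ℂ) : ‖exp (c * Real.pi * I * η)‖ = Real.exp (-(c * Real.pi * η.im)) := by
  rw [Complex.norm_exp]
  congr 1
  have : (c : ℂ) * Real.pi * I * η = ((c * Real.pi : ℝ) : ℂ) * (I * η) := by push_cast; ring
  rw [this, re_ofReal_mul]
  simp

theorem norm_q (η : ℂ) : ‖exp (2 * Real.pi * I * η)‖ = Real.exp (-(2 * Real.pi * η.im)) := by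
  have := norm_exp_piI 2 η
  simpa using this

theorem norm_qh (η : ℂ) : ‖exp (Real.pi * I * η)‖ = Real.exp (-(Real.pi * η.im)) := by
  have := norm_exp_piI 1 η
  simpa using this

theorem norm_exp_I (x : ℂ) (hx : x.re = 0) : ‖exp x‖ = 1 := by rw [Complex.norm_exp, hx, Real.exp_zero]

theorem epsk_norm (k : ℕ) : ‖epsk k‖ = 1 := by
  unfold epsk
  apply norm_exp_I
  have : (-Real.pi * I * (k * (k + 1)) / 2 : ℂ) = ((-Real.pi * (k * (k + 1)) / 2 : ℝ) : ℂ) * I := by push_cast; ring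
  rw [this, re_ofReal_mul]; simp

theorem norm_e8 : ‖exp (-Real.pi * I / 8)‖ = 1 := by
  apply norm_exp_I
  have : (-Real.pi * I / 8 : ℂ) = ((-Real.pi / 8 : ℝ) : ℂ) * I := by push_cast; ring
  rw [this, re_ofReal_mul]; simp

noncomputable def MM (η : ℂ) : ℂ := om * G0 * fR (S η) η * exp (-Real.pi * I / 8) * exp (Real.pi * I * η) *
  ((1 - exp (2 * Real.pi * I * η)) / (1 + exp (2 * Real.pi * I * η) ^ 2))

theorem p_low (a : ℝ) (ha : 0 < a) : min a 1 / 2 ≤ 1 - Real.exp (-(2 * Real.pi * a)) := by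
  have hp := Real.pi_gt_three
  have h1 : Real.exp (-(2 * Real.pi * a)) ≤ 1 / (1 + 2 * Real.pi * a) := by
    rw [Real.exp_neg, ← one_div]
    apply one_div_le_one_div_of_le (by positivity)
    linarith [Real.add_one_le_exp (2 * Real.pi * a)]
  have h2 : 1 / (1 + 2 * Real.pi * a) ≤ 1 - min a 1 / 2 := by
    rw [div_le_iff₀ (by positivity)]
    have h3 : 6 * a ≤ 2 * Real.pi * a := by nlinarith
    have h4 : min a 1 ≤ a := min_le_left _ _
    have h5 : min a 1 ≤ 1 := min_le_right _ _
    have h6 : 0 < min a 1 := lt_min ha one_pos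
    nlinarith
  linarith

theorem R_split (η : ℂ) (ha : 0 < η.im) (hb : η.im ≤ η.re) (hs : (S η).re ≤ -2) (m : ℕ)
    (hκr : 2000 * (4 * m : ℝ) ≤ ‖η‖) (hκ3 : (4 * m : ℝ) ^ 3 ≤ ‖η‖) :
    ‖((∑ k ∈ Finset.range (4 * m), ∫ y : ℝ, PR (S η) (k + 1 / 2) (log η + y)) + TT η (4 * m)) - MM η‖ ≤
      ‖MM η‖ * Real.exp (-(2 * Real.pi * η.im) * (4 * m)) +
      CI * (‖fR (S η) η‖ * Real.exp (-(Real.pi * η.im))) / ‖η‖ * (6 / (1 - Real.exp (-(2 * Real.pi * η.im))) ^ 4)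
      + ‖TT η (4 * m)‖ := by
  have hη : η ≠ 0 := by intro h; rw [h] at ha; simp at ha
  have hr : 0 < ‖η‖ := norm_pos_iff.mpr hη
  have hpi := Real.pi_pos
  set q := exp (2 * Real.pi * I * η) with hq
  have nq : ‖q‖ = Real.exp (-(2 * Real.pi * η.im)) := norm_q η
  have nq1 : ‖q‖ < 1 := by rw [nq]; rw [Real.exp_lt_one_iff]; nlinarith [mul_pos hpi ha]
  have hne : 1 + q ^ 2 ≠ 0 := by
    intro h
    have h2 : q ^ 2 = -1 := by linear_combination h
    have h3 : ‖q‖ ^ 2 = 1 := by rw [← norm_pow, h2]; simp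
    nlinarith [norm_nonneg q]
  have nDD : ∀ k : ℕ, ‖DD η (k + 1 / 2)‖ = ‖fR (S η) η‖ * Real.exp (-(Real.pi * η.im)) * ‖q‖ ^ k := by
    intro k
    rw [DD_eq, norm_mul, norm_mul, norm_mul, norm_mul, norm_qh, norm_e8, epsk_norm, norm_pow]; ring
  have hmain : ∑ k ∈ Finset.range (4 * m), om * G0 * DD η (k + 1 / 2) = MM η * (1 - q ^ (4 * m)) := by
    simp only [DD_eq]
    rw [← Finset.mul_sum, ← Finset.mul_sum]
    unfold MM
    have := eps_sum q m
    rw [← hq]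
    field_simp
    linear_combination (om * G0 * fR (S η) η) * this
  have herr : ‖∑ k ∈ Finset.range (4 * m), ((∫ y : ℝ, PR (S η) (k + 1 / 2) (log η + y)) - om * G0 * DD η (k + 1 / 2))‖ ≤
      CI * (‖fR (S η) η‖ * Real.exp (-(Real.pi * η.im))) / ‖η‖ * (6 / (1 - Real.exp (-(2 * Real.pi * η.im))) ^ 4) := by
    refine (norm_sum_le _ _).trans ?_
    rw [← nq]
    have hCI := CI_pos
    calc _ ≤ ∑ k ∈ Finset.range (4 * m), CI * (‖fR (S η) η‖ * Real.exp (-(Real.pi * η.im))) / ‖η‖ * (((k:ℝ) + 1 / 2) ^ 3 * ‖q‖ ^ k) := by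
          apply Finset.sum_le_sum
          intro k hk
          have hk' : (k:ℝ) + 1 ≤ 4 * m := by
            have := Finset.mem_range.mp hk
            exact_mod_cast this
          have hk0 : (0:ℝ) ≤ k := Nat.cast_nonneg k
          refine (I_asym η ha hb hs (k + 1 / 2) (by linarith) (by linarith) ?_).trans (le_of_eq ?_)
          · refine le_trans ?_ hκ3
            gcongr; linarith
          · rw [nDD]; ring
      _ ≤ _ := by
          rw [← Finset.mul_sum]
          gcongr
          exact sum_cube_geom _ _ (norm_nonneg _) nq1
  rw [Finset.sum_sub_distrib, hmain] at herr
  set Sg := ∑ k ∈ Finset.range (4 * m), ∫ y : ℝ, PR (S η) (k + 1 / 2) (log η + y)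
  have e : Sg + TT η (4 * m) - MM η = -(MM η * q ^ (4 * m)) + (Sg - MM η * (1 - q ^ (4 * m))) + TT η (4 * m) := by ring
  rw [e]
  refine norm_add₃_le.trans ?_
  gcongr
  rw [norm_neg, norm_mul, norm_pow, nq, ← Real.exp_nat_mul]
  apply le_of_eq; congr 2; push_cast; ring

theorem MM_low (η : ℂ) (ha : 0 < η.im) : 7 / 20 * (‖fR (S η) η‖ * Real.exp (-(Real.pi * η.im))) *
    (1 - Real.exp (-(2 * Real.pi * η.im))) ≤ ‖MM η‖ := by
  have hpi := Real.pi_pos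
  unfold MM
  set q := exp (2 * Real.pi * I * η) with hq
  have nq : ‖q‖ = Real.exp (-(2 * Real.pi * η.im)) := norm_q η
  have nq1 : ‖q‖ < 1 := by rw [nq]; rw [Real.exp_lt_one_iff]; nlinarith [mul_pos hpi ha]
  have hne : 1 + q ^ 2 ≠ 0 := by
    intro h
    have h2 : q ^ 2 = -1 := by linear_combination h
    have h3 : ‖q‖ ^ 2 = 1 := by rw [← norm_pow, h2]; simp
    nlinarith [norm_nonneg q]
  simp only [norm_mul, norm_div]
  rw [om_norm, norm_e8, norm_qh, G0_eq, norm_real, Real.norm_of_nonneg (by positivity), ← nq]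
  have h1 : 1 - ‖q‖ ≤ ‖1 - q‖ := by
    have := norm_sub_norm_le (1:ℂ) q
    simpa using this
  have h2 : ‖1 + q ^ 2‖ ≤ 2 := by
    refine (norm_add_le _ _).trans ?_
    rw [norm_pow, norm_one]; nlinarith [norm_nonneg q]
  have h3 : (1 - ‖q‖) / 2 ≤ ‖1 - q‖ / ‖1 + q ^ 2‖ :=
    div_le_div₀ (norm_nonneg _) h1 (norm_pos_iff.mpr hne) h2
  have hs2 : (1.4 : ℝ) ≤ Real.sqrt 2 := Real.le_sqrt_of_sq_le (by norm_num)
  calc _ = (1.4 / 2) * (‖fR (S η) η‖ * Real.exp (-(Real.pi * η.im))) * ((1 - ‖q‖) / 2) := by ring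
    _ ≤ (Real.sqrt 2 / 2) * (‖fR (S η) η‖ * Real.exp (-(Real.pi * η.im))) * (‖1 - q‖ / ‖1 + q ^ 2‖) := by
        gcongr
    _ = _ := by ring

end RZ

namespace RZ
open Complex Filter Topology Set

set_option maxHeartbeats 1000000 in
theorem main_asym : ∃ A0 : ℝ, 1 ≤ A0 ∧ ∃ z0 : ℝ, 4 ≤ z0 ∧ ∀ (η : ℂ) (z : ℝ), 0 < η.im → η.im ≤ η.re →
    ‖η‖ = z ^ 20 → z0 ≤ z → A0 ≤ η.im ^ 5 * z ^ 20 →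
    (S η).re ≤ -2 ∧ ‖RiemannR (S η) - (1 - exp (Real.pi * I * S η)) * MM η‖ ≤
      (1 / 2) * ‖(1 - exp (Real.pi * I * S η)) * MM η‖ := by
  have hCI := CI_pos
  have hEA := EA_nonneg
  have hlim := (Real.tendsto_pow_mul_exp_neg_atTop_nhds_zero 28).const_mul (8 * EA)
  rw [mul_zero] at hlim
  obtain ⟨z1, hz1⟩ := eventually_atTop.mp (hlim.eventually (ge_mem_nhds (show (0:ℝ) < 35 / 800 by norm_num)))
  refine ⟨4400 * CI + 1, by linarith, max (4400 * CI + 4) z1, le_max_of_le_left (by linarith), ?_⟩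
  intro η z ha hb hr hz hA
  have hzA : 4400 * CI + 4 ≤ z := (le_max_left _ _).trans hz
  have hzz := hz1 z ((le_max_right _ _).trans hz)
  have hz4 : 4 ≤ z := by linarith
  have hz0 : 0 < z := by linarith
  have hpi := Real.pi_gt_three
  set a := η.im with hadef
  -- a z^4 ≥ 1
  have haz : 1 ≤ a * z ^ 4 := by
    by_contra h
    push Not at h
    have : (a * z ^ 4) ^ 5 < 1 := pow_lt_one₀ (by positivity) h (by norm_num)
    have e : (a * z ^ 4) ^ 5 = a ^ 5 * z ^ 20 := by ring
    linarith
  have hone : ∀ k : ℕ, 1 ≤ z ^ k := fun k => one_le_pow₀ (by linarith)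
  have hz20 : z ^ 16 ≤ a * z ^ 20 := by
    calc z ^ 16 ≤ (a * z ^ 4) * z ^ 16 := le_mul_of_one_le_left (by positivity) haz
      _ = _ := by ring
  have hz16 : z ≤ z ^ 16 / 4 := by
    have : z ^ 16 = z * (z * z ^ 14) := by ring
    have h2 : 4 * 1 ≤ z * z ^ 14 := mul_le_mul hz4 (hone 14) (by norm_num) hz0.le
    rw [this]; nlinarith
  -- b ≥ r/2
  have hbr : z ^ 20 / 2 ≤ η.re := by
    have h1 := Complex.norm_le_abs_re_add_abs_im η
    rw [abs_of_pos ha, abs_of_pos (lt_of_lt_of_le ha hb), hr] at h1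
    linarith
  have hσ : (S η).re ≤ -(2 * Real.pi * (a * z ^ 20)) := by
    rw [S_re]
    have : a * (z ^ 20 / 2) ≤ a * η.re := by gcongr
    have h3 : 4 * Real.pi * (a * (z ^ 20 / 2)) ≤ 4 * Real.pi * (a * η.re) := by gcongr
    linarith
  have hσ6 : (S η).re ≤ -(6 * z ^ 16) := by nlinarith
  have hs : (S η).re ≤ -2 := by nlinarith [hone 16]
  refine ⟨hs, ?_⟩
  -- m
  set m := ⌈z ^ 5⌉₊ with hm
  have hm1 : z ^ 5 ≤ m := Nat.le_ceil _
  have hm2 : (m:ℝ) ≤ 2 * z ^ 5 := by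
    have := Nat.ceil_lt_add_one (show 0 ≤ z ^ 5 by positivity)
    linarith [hone 5]
  have h45 : (1024:ℝ) ≤ z ^ 5 := by
    calc (1024:ℝ) = 4 ^ 5 := by norm_num
      _ ≤ z ^ 5 := by gcongr
  have hκ3 : (4 * m : ℝ) ^ 3 ≤ ‖η‖ := by
    rw [hr]
    calc (4 * m : ℝ) ^ 3 ≤ (4 * (2 * z ^ 5)) ^ 3 := by gcongr
      _ = 512 * (z ^ 5) ^ 3 := by ring
      _ ≤ z ^ 5 * (z ^ 5) ^ 3 := by gcongr; linarith
      _ = _ := by ring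
  have hκr : 2000 * (4 * m : ℝ) ≤ ‖η‖ := by
    rw [hr]
    have h6 : (1024:ℝ) * 1024 ≤ z ^ 5 * z ^ 5 := by gcongr
    calc 2000 * (4 * m : ℝ) ≤ 2000 * (4 * (2 * z ^ 5)) := by gcongr
      _ = 16000 * z ^ 5 := by ring
      _ ≤ (z ^ 5 * z ^ 5) * z ^ 10 := by
          apply mul_le_mul (by linarith) (pow_le_pow_right₀ (by linarith) (by norm_num)) (by positivity) (by positivity)
      _ = _ := by ring
  rw [R_expand η ha hb hs (4 * m), ← mul_sub, norm_mul, norm_mul, mul_left_comm]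
  apply mul_le_mul_of_nonneg_left _ (norm_nonneg _)
  refine (R_split η ha hb hs m hκr hκ3).trans ?_
  have hMl := MM_low η ha
  rw [← hadef] at hMl
  rw [← hadef]
  have hp := p_low a ha
  set p := 1 - Real.exp (-(2 * Real.pi * a)) with hpdef
  set F := ‖fR (S η) η‖ with hF
  have hF0 : 0 ≤ F := norm_nonneg _
  have hmin : 1 / z ^ 4 ≤ min a 1 := by
    apply le_min
    · rw [div_le_iff₀ (by positivity)]; exact haz
    · rw [div_le_one (by positivity)]; exact hone 4
  have hp4 : 1 / (2 * z ^ 4) ≤ p := by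
    have : 1 / (2 * z ^ 4) = (1 / z ^ 4) / 2 := by field_simp
    rw [this]; linarith
  have hp0 : 0 < p := lt_of_lt_of_le (by positivity) hp4
  have hp5 : 138 * CI ≤ p ^ 5 * z ^ 20 - 1 / 32 + (138 - 137.5) * CI := by
    have h7 : (4400 * CI + 1) / 32 ≤ (min a 1 / 2) ^ 5 * z ^ 20 := by
      rcases min_choice a 1 with h | h <;> rw [h]
      · have : (a / 2) ^ 5 * z ^ 20 = (a ^ 5 * z ^ 20) / 32 := by ring
        rw [this]; linarith
      · have : z * 1 ≤ z * z ^ 19 := by gcongr; exact hone 19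
        have e : z * z ^ 19 = z ^ 20 := by ring
        have e2 : ((1:ℝ) / 2) ^ 5 * z ^ 20 = z ^ 20 / 32 := by ring
        rw [e2]; linarith
    have h8 : (min a 1 / 2) ^ 5 * z ^ 20 ≤ p ^ 5 * z ^ 20 := by
      have : 0 < min a 1 := lt_min ha one_pos
      gcongr
    linarith
  have h137 : 137.5 * CI ≤ p ^ 5 * z ^ 20 := by linarith
  have ham : z ≤ a * m := by
    calc z ≤ (a * z ^ 4) * z := le_mul_of_one_le_left hz0.le haz
      _ = a * z ^ 5 := by ring
      _ ≤ a * m := by gcongr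
  -- first term
  have T1 : ‖MM η‖ * Real.exp (-(2 * Real.pi * a) * (4 * m)) ≤ ‖MM η‖ * (1 / 8) := by
    apply mul_le_mul_of_nonneg_left _ (norm_nonneg _)
    have h1 : 8 ≤ 2 * Real.pi * a * (4 * m) := by nlinarith
    have h2 := Real.add_one_le_exp (2 * Real.pi * a * (4 * m))
    rw [neg_mul, Real.exp_neg, ← one_div]
    apply one_div_le_one_div_of_le <;> linarith
  have T2 : CI * (F * Real.exp (-(Real.pi * a))) / ‖η‖ * (6 / p ^ 4) ≤ ‖MM η‖ * (1 / 8) := by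
    refine le_trans ?_ (mul_le_mul_of_nonneg_right hMl (by norm_num : (0:ℝ) ≤ 1 / 8))
    rw [hr]
    have h9 : CI / z ^ 20 * (6 / p ^ 4) ≤ 7 / 160 * p := by
      rw [div_mul_div_comm, div_le_iff₀ (by positivity)]
      have : 7 / 160 * p * (z ^ 20 * p ^ 4) = 7 / 160 * (p ^ 5 * z ^ 20) := by ring
      rw [this]; linarith
    calc _ = (F * Real.exp (-(Real.pi * a))) * (CI / z ^ 20 * (6 / p ^ 4)) := by ring
      _ ≤ (F * Real.exp (-(Real.pi * a))) * (7 / 160 * p) := by gcongr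
      _ = _ := by ring
  have T3 : ‖TT η (4 * m)‖ ≤ ‖MM η‖ * (1 / 8) := by
    refine (TT_bound η ha hb hs (4 * m)).trans ?_
    rw [← hadef, ← hF]
    refine le_trans ?_ (mul_le_mul_of_nonneg_right hMl (by norm_num : (0:ℝ) ≤ 1 / 8))
    have b1 : 1 + 1 / a ≤ 2 * z ^ 4 := by
      have : 1 / a ≤ z ^ 4 := by rw [div_le_iff₀ ha]; linarith
      linarith [hone 4]
    have b2 : Real.exp (-(Real.pi * ((4 * m : ℕ):ℝ) * a)) ≤ Real.exp (-(Real.pi * a)) * Real.exp (-z) := by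
      rw [← Real.exp_add]
      apply Real.exp_le_exp.mpr
      push_cast
      have : a * 1 ≤ a * m := by gcongr; linarith
      have h10 : 0 ≤ Real.pi * (a * m - a) := by
        apply mul_nonneg <;> linarith
      nlinarith
    have b3 : Real.exp (((S η).re + 2) / 6) ≤ Real.exp (-(Real.pi * a)) * Real.exp (-z) := by
      rw [← Real.exp_add]
      apply Real.exp_le_exp.mpr
      have h11 : a * 6 ≤ a * z ^ 20 := by
        gcongr
        have : z ^ 20 = z ^ 5 * z ^ 15 := by ring
        rw [this]; nlinarith [hone 15]
      have h12 : 0 ≤ Real.pi * (a * z ^ 20 - 6 * a) := by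
        apply mul_nonneg <;> linarith
      have h13 : 3 * (a * z ^ 20) ≤ Real.pi * (a * z ^ 20) := by gcongr
      linarith
    rw [hr]
    calc _ ≤ EA * (z ^ 20 * F * (2 * z ^ 4) * (Real.exp (-(Real.pi * a)) * Real.exp (-z) + Real.exp (-(Real.pi * a)) * Real.exp (-z))) := by
          gcongr
      _ = (F * Real.exp (-(Real.pi * a))) * (8 * EA * (z ^ 28 * Real.exp (-z))) * (1 / (2 * z ^ 4)) := by
          field_simp; ring
      _ ≤ (F * Real.exp (-(Real.pi * a))) * (35 / 800) * p := by
          gcongr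
      _ = _ := by ring
  linarith [norm_nonneg (MM η)]

end RZ

namespace RZ
open Complex Filter Topology Set

noncomputable def ww (s : ℂ) : ℂ := -I * s / (2 * Real.pi)
noncomputable def et (s : ℂ) : ℂ := exp (log (ww s) / 2)

theorem ww_re (s : ℂ) : (ww s).re = s.im / (2 * Real.pi) := by
  have : ww s = (-I * s) / ((2 * Real.pi : ℝ) : ℂ) := by unfold ww; push_cast; rfl
  rw [this, div_ofReal_re]; simp
theorem ww_im (s : ℂ) : (ww s).im = -s.re / (2 * Real.pi) := by
  have : ww s = (-I * s) / ((2 * Real.pi : ℝ) : ℂ) := by unfold ww; push_cast; rfl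
  rw [this, div_ofReal_im]; simp

theorem et_sq (s : ℂ) (h : s ≠ 0) : et s ^ 2 = ww s := by
  have hw : ww s ≠ 0 := by
    unfold ww
    have : (Real.pi : ℂ) ≠ 0 := by exact_mod_cast Real.pi_ne_zero
    simp [h, this]
  unfold et
  rw [← Complex.exp_nat_mul]
  conv_rhs => rw [← Complex.exp_log hw]
  congr 1; push_cast; ring

theorem S_et (s : ℂ) (h : s ≠ 0) : S (et s) = s := by
  unfold S
  rw [et_sq s h]; unfold ww
  have : (Real.pi : ℂ) ≠ 0 := by exact_mod_cast Real.pi_ne_zero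
  field_simp
  linear_combination (-1) * I_sq

theorem Lim_range (s : ℂ) (h1 : s.re < 0) (h2 : 0 ≤ s.im) : 0 < (log (ww s)).im ∧ (log (ww s)).im ≤ Real.pi / 2 := by
  have hpi := Real.pi_pos
  have hi : 0 < (ww s).im := by rw [ww_im]; apply div_pos <;> linarith
  have hr : 0 ≤ (ww s).re := by rw [ww_re]; positivity
  rw [log_im]
  constructor
  · have h3 : 0 ≤ arg (ww s) := arg_nonneg_iff.mpr hi.le
    rcases h3.lt_or_eq with h | h
    · exact h
    · have := (arg_eq_zero_iff.mp h.symm).2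
      linarith
  · exact (abs_le.mp (abs_arg_le_pi_div_two_iff.mpr hr)).2

theorem et_pos (s : ℂ) (h1 : s.re < 0) (h2 : 0 ≤ s.im) : 0 < (et s).im ∧ (et s).im ≤ (et s).re := by
  have hpi := Real.pi_pos
  obtain ⟨l1, l2⟩ := Lim_range s h1 h2
  have hi : (log (ww s) / 2).im = (log (ww s)).im / 2 := by simp
  have a1 : 0 < (et s).im := by
    unfold et
    rw [exp_im, hi]
    exact mul_pos (Real.exp_pos _) (Real.sin_pos_of_pos_of_lt_pi (by linarith) (by linarith))
  have a2 : 0 < (et s).re := by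
    unfold et
    rw [exp_re, hi]
    exact mul_pos (Real.exp_pos _) (Real.cos_pos_of_mem_Ioo ⟨by linarith, by linarith⟩)
  refine ⟨a1, ?_⟩
  have h0 : s ≠ 0 := by intro h; rw [h] at h1; simp at h1
  have h3 := congrArg Complex.re (et_sq s h0)
  rw [ww_re, pow_two, mul_re] at h3
  have h4 : 0 ≤ s.im / (2 * Real.pi) := by positivity
  nlinarith

theorem log_et (s : ℂ) (h1 : s.re < 0) (h2 : 0 ≤ s.im) : log (et s) = log (ww s) / 2 := by
  have hpi := Real.pi_pos
  obtain ⟨l1, l2⟩ := Lim_range s h1 h2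
  have hi : (log (ww s) / 2).im = (log (ww s)).im / 2 := by simp
  unfold et
  rw [Complex.log_exp] <;> rw [hi] <;> linarith

theorem norm_et_sq (s : ℂ) (h : s ≠ 0) : ‖et s‖ ^ 2 = ‖s‖ / (2 * Real.pi) := by
  have hpi := Real.pi_pos
  rw [← norm_pow, et_sq s h]; unfold ww
  rw [norm_div, norm_mul, norm_mul, norm_neg, norm_I, norm_real, Real.norm_of_nonneg hpi.le]; simp

/-- The region to the left. -/
def WB (B : ℝ) (s : ℂ) : Prop := s.re ≤ -B ∧ 0 ≤ s.im ∧ B * s.im ^ 2 ≤ (-s.re) ^ 5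

noncomputable def EMM (s : ℂ) : ℂ := (1 - exp (Real.pi * I * s)) * MM (et s)

theorem et_im_low (s : ℂ) (h1 : s.re < 0) (h2 : 0 ≤ s.im) : -s.re ≤ 4 * Real.pi * ‖et s‖ * (et s).im := by
  have h0 : s ≠ 0 := by intro h; rw [h] at h1; simp at h1
  have := S_re (et s)
  rw [S_et s h0] at this
  obtain ⟨a1, a2⟩ := et_pos s h1 h2
  have hpi := Real.pi_pos
  have h5 : (et s).re ≤ ‖et s‖ := Complex.re_le_norm _
  have : -s.re = 4 * Real.pi * (et s).re * (et s).im := by linarith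
  rw [this]; gcongr

theorem W_asym : ∃ B : ℝ, 6 ≤ B ∧ ∀ s : ℂ, WB B s → 1 ≤ ‖et s‖ ∧ 1 ≤ (et s).im ^ 5 * ‖et s‖ ∧
    ‖RiemannR s - EMM s‖ ≤ (1 / 2) * ‖EMM s‖ := by
  obtain ⟨A0, hA0, z0, hz0, H⟩ := main_asym
  have hpi := Real.pi_gt_three
  have p1 : 0 ≤ A0 * (4 * Real.pi) ^ 5 := by positivity
  have p2 : 0 ≤ 2 * Real.pi * z0 ^ 40 := by positivity
  set Q := A0 * (4 * Real.pi) ^ 5 with hQ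
  refine ⟨2 * Q + 2 * Real.pi * z0 ^ 40 + 6, by linarith, ?_⟩
  set B := 2 * Q + 2 * Real.pi * z0 ^ 40 + 6 with hB
  rintro s ⟨w1, w2, w3⟩
  have hs0 : s.re < 0 := by linarith
  have h0 : s ≠ 0 := by intro h; rw [h] at hs0; simp at hs0
  obtain ⟨a1, a2⟩ := et_pos s hs0 w2
  have hr2 := norm_et_sq s h0
  have hlow := et_im_low s hs0 w2
  set r := ‖et s‖ with hr
  set a := (et s).im with ha
  have hr0 : 0 ≤ r := norm_nonneg _
  have hsn : -s.re ≤ ‖s‖ := by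
    have := Complex.abs_re_le_norm s
    rw [abs_of_neg hs0] at this; exact this
  have hr20 : z0 ^ 20 ≤ r := by
    have h1 : (z0 ^ 20) ^ 2 ≤ r ^ 2 := by
      rw [hr2, le_div_iff₀ (by positivity)]
      have : (z0 ^ 20) ^ 2 * (2 * Real.pi) = 2 * Real.pi * z0 ^ 40 := by ring
      rw [this]; linarith
    exact le_of_sq_le_sq h1 hr0
  have hr1 : 1 ≤ r := le_trans (one_le_pow₀ (by linarith)) hr20
  have hA : A0 ≤ a ^ 5 * r := by
    set u := -s.re with hu
    have hu1 : B ≤ u := by linarith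
    have hu6 : 6 ≤ u := by linarith
    have n2 : ‖s‖ ^ 2 = u ^ 2 + s.im ^ 2 := by
      rw [Complex.sq_norm, Complex.normSq_apply]; rw [hu]; ring
    have h2 : u ^ 5 ≤ (4 * Real.pi * r * a) ^ 5 := by gcongr
    have h3 : r ^ 4 ≤ u ^ 2 + s.im ^ 2 := by
      rw [← n2]
      have : r ^ 4 = (r ^ 2) ^ 2 := by ring
      rw [this, hr2]
      gcongr
      apply div_le_self (norm_nonneg _); linarith
    have h4 : Q * (u ^ 2 + s.im ^ 2) ≤ u ^ 5 := by
      have e1 : Q * s.im ^ 2 ≤ u ^ 5 / 2 := by nlinarith [sq_nonneg s.im]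
      have e2 : Q * u ^ 2 ≤ u ^ 5 / 2 := by
        have : Q ≤ u / 2 := by linarith
        have h5 : u ^ 3 * 1 ≤ u ^ 3 * u ^ 2 := by gcongr; nlinarith
        have h6 : Q * u ^ 2 ≤ (u / 2) * u ^ 2 := by gcongr
        nlinarith
      linarith
    have h7 : Q * r ^ 4 ≤ u ^ 5 := le_trans (by gcongr) h4
    have h8 : ((4 * Real.pi) ^ 5 * r ^ 4) * A0 ≤ ((4 * Real.pi) ^ 5 * r ^ 4) * (a ^ 5 * r) := by
      calc _ = Q * r ^ 4 := by rw [hQ]; ring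
        _ ≤ _ := h7
        _ ≤ _ := h2
        _ = _ := by ring
    exact le_of_mul_le_mul_left h8 (by positivity)
  have hz : (r ^ ((1:ℝ) / 20)) ^ 20 = r := by
    rw [← Real.rpow_natCast, ← Real.rpow_mul hr0]; norm_num
  have hz1 : z0 ≤ r ^ ((1:ℝ) / 20) := by
    apply le_of_pow_le_pow_left₀ (n := 20) (by norm_num) (by positivity)
    rw [hz]; exact hr20
  have := (H (et s) (r ^ ((1:ℝ) / 20)) a1 a2 (by rw [hz]) hz1 (by rw [hz]; exact hA)).2
  rw [S_et s h0] at this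
  exact ⟨hr1, hA0.trans hA, this⟩

end RZ

namespace RZ
open Complex Filter Topology Set

noncomputable def lam (s : ℂ) : ℂ := -s * (log (ww s) / 2) + s / 2 + Real.pi * I * et s
noncomputable def cst : ℂ := om * G0 * exp (-Real.pi * I / 8)
noncomputable def P1f (s : ℂ) : ℂ := 1 + -exp (Real.pi * I * s)
noncomputable def P2f (s : ℂ) : ℂ := 1 + -exp (2 * Real.pi * I * et s)
noncomputable def P3f (s : ℂ) : ℂ := 1 + exp (2 * Real.pi * I * et s) ^ 2
noncomputable def DDf (s : ℂ) : ℂ := cst * exp (lam s) * P1f s * (P2f s / P3f s)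
noncomputable def GLg (s : ℂ) : ℂ := lam s + log (P1f s) + log (P2f s) - log (P3f s) + log (RiemannR s / DDf s)

theorem EMM_eq (s : ℂ) (h1 : s.re < 0) (h2 : 0 ≤ s.im) : EMM s = DDf s := by
  have h0 : s ≠ 0 := by intro h; rw [h] at h1; simp at h1
  obtain ⟨a1, a2⟩ := et_pos s h1 h2
  have hη : et s ≠ 0 := by intro h; rw [h] at a1; simp at a1
  have hpi : (Real.pi : ℂ) ≠ 0 := by exact_mod_cast Real.pi_ne_zero
  unfold EMM MM DDf cst P1f P2f P3f lam
  rw [fR_eta _ hη, S_et s h0, log_et s h1 h2, et_sq s h0]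
  have e : Real.pi * I * ww s = s / 2 := by
    unfold ww; field_simp; linear_combination (-1) * I_sq
  rw [e, Complex.exp_add _ (Real.pi * I * et s)]
  ring

theorem cst_ne : cst ≠ 0 := by
  unfold cst
  have : om ≠ 0 := by intro h; have := om_norm; rw [h] at this; simp at this
  rw [G0_eq]
  simp [this, Complex.exp_ne_zero]

theorem slit1 (z : ℂ) (h : ‖z‖ < 1) : 1 + z ∈ slitPlane := Complex.mem_slitPlane_of_norm_lt_one h

theorem P1_slit (s : ℂ) (h : 0 < s.im) : P1f s ∈ slitPlane := by
  apply slit1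
  rw [norm_neg, norm_qh, Real.exp_lt_one_iff]
  have := mul_pos Real.pi_pos h
  linarith

theorem q_lt (s : ℂ) (h1 : s.re < 0) (h2 : 0 ≤ s.im) : ‖exp (2 * Real.pi * I * et s)‖ < 1 := by
  rw [norm_q, Real.exp_lt_one_iff]
  have := mul_pos Real.pi_pos (et_pos s h1 h2).1
  linarith

theorem P2_slit (s : ℂ) (h1 : s.re < 0) (h2 : 0 ≤ s.im) : P2f s ∈ slitPlane := by
  apply slit1
  rw [norm_neg]; exact q_lt s h1 h2

theorem P3_slit (s : ℂ) (h1 : s.re < 0) (h2 : 0 ≤ s.im) : P3f s ∈ slitPlane := by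
  apply slit1
  rw [norm_pow]; exact pow_lt_one₀ (norm_nonneg _) (q_lt s h1 h2) (by norm_num)

theorem Df_ne (s : ℂ) (h1 : s.re < 0) (h2 : 0 < s.im) : DDf s ≠ 0 := by
  unfold DDf
  have a := slitPlane_ne_zero (P1_slit s h2)
  have b := slitPlane_ne_zero (P2_slit s h1 h2.le)
  have c := slitPlane_ne_zero (P3_slit s h1 h2.le)
  exact mul_ne_zero (mul_ne_zero (mul_ne_zero cst_ne (Complex.exp_ne_zero _)) a) (div_ne_zero b c)

theorem et_diff (s : ℂ) (h1 : s.re < 0) : DifferentiableAt ℂ (fun s => log (ww s)) s ∧ DifferentiableAt ℂ et s := by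
  have hw : DifferentiableAt ℂ ww s := by unfold ww; fun_prop
  have hsl : ww s ∈ slitPlane := by
    right; rw [ww_im]
    have := Real.pi_pos
    exact (div_pos (by linarith) (by linarith)).ne'
  have h := hw.clog hsl
  refine ⟨h, ?_⟩
  unfold et
  exact (h.div_const 2).cexp

theorem GLg_deriv (s : ℂ) (h1 : s.re < 0) (h2 : 0 < s.im) (h : ‖RiemannR s - EMM s‖ ≤ (1 / 2) * ‖EMM s‖) :
    RiemannR s ≠ 0 ∧ HasDerivAt GLg (logDeriv RiemannR s) s ∧ |(GLg s).im - (lam s).im| ≤ 4 * Real.pi := by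
  rw [EMM_eq s h1 h2.le] at h
  have hD := Df_ne s h1 h2
  have hQ : RiemannR s / DDf s ∈ slitPlane := by
    have e : RiemannR s / DDf s = 1 + (RiemannR s - DDf s) / DDf s := by field_simp; ring
    rw [e]
    apply slit1
    rw [norm_div, div_lt_one (norm_pos_iff.mpr hD)]
    have := norm_pos_iff.mpr hD
    linarith
  have hR : RiemannR s ≠ 0 := by
    intro h0; rw [h0, zero_div] at hQ; exact slitPlane_ne_zero hQ rfl
  refine ⟨hR, ?_, ?_⟩
  · obtain ⟨d1, d2⟩ := et_diff s h1
    have dl : DifferentiableAt ℂ lam s := by unfold lam; fun_prop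
    have dp1 : DifferentiableAt ℂ P1f s := by unfold P1f; fun_prop
    have dp2 : DifferentiableAt ℂ P2f s := by unfold P2f; fun_prop
    have dp3 : DifferentiableAt ℂ P3f s := by unfold P3f; fun_prop
    have hl := dl.hasDerivAt
    have hp1 := dp1.hasDerivAt
    have hp2 := dp2.hasDerivAt
    have hp3 := dp3.hasDerivAt
    have hr := (R_entire s).hasDerivAt
    have n1 := slitPlane_ne_zero (P1_slit s h2)
    have n2 := slitPlane_ne_zero (P2_slit s h1 h2.le)
    have n3 := slitPlane_ne_zero (P3_slit s h1 h2.le)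
    have hDd : HasDerivAt DDf _ s := ((hl.cexp.const_mul cst).mul hp1).mul (hp2.div hp3 n3)
    have hQd := (hr.div hDd hD).clog hQ
    have := (((hl.add (hp1.clog (P1_slit s h2))).add (hp2.clog (P2_slit s h1 h2.le))).sub
      (hp3.clog (P3_slit s h1 h2.le))).add hQd
    refine HasDerivAt.congr_deriv (f := GLg) this ?_
    rw [logDeriv_apply]
    have hE : cst * exp (lam s) ≠ 0 := mul_ne_zero cst_ne (Complex.exp_ne_zero _)
    have hDe : DDf s = cst * exp (lam s) * P1f s * (P2f s / P3f s) := rfl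
    simp only [Pi.div_apply, Pi.mul_apply]
    rw [hDe]
    have := cst_ne
    have := Complex.exp_ne_zero (lam s)
    field_simp
    ring
  · unfold GLg
    simp only [add_im, sub_im, log_im]
    have a1 := abs_le.mp (abs_arg_le_pi (P1f s))
    have a2 := abs_le.mp (abs_arg_le_pi (P2f s))
    have a3 := abs_le.mp (abs_arg_le_pi (P3f s))
    have a4 := abs_le.mp (abs_arg_le_pi (RiemannR s / DDf s))
    rw [abs_le]
    constructor <;> linarith [a1.1, a1.2, a2.1, a2.2, a3.1, a3.2, a4.1, a4.2]

end RZ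

namespace RZ
open Complex Filter Topology Set

theorem norm_ww (s : ℂ) : ‖ww s‖ = ‖s‖ / (2 * Real.pi) := by
  have hpi := Real.pi_pos
  unfold ww
  rw [norm_div, norm_mul, norm_mul, norm_neg, norm_I, norm_real, Real.norm_of_nonneg hpi.le]; simp

theorem et_b (s : ℂ) (h0 : s ≠ 0) : (et s).re ^ 2 = s.im / (2 * Real.pi) + (et s).im ^ 2 := by
  have h3 := congrArg Complex.re (et_sq s h0)
  rw [ww_re, pow_two, mul_re] at h3
  linarith

theorem et_ab (s : ℂ) (h0 : s ≠ 0) : 4 * Real.pi * (et s).re * (et s).im = -s.re := by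
  have := S_re (et s)
  rw [S_et s h0] at this
  linarith

theorem lam_im_est (s : ℂ) (h1 : s.re < 0) (hT : 2 * Real.pi ≤ s.im) :
    |(lam s).im - (-(s.im / 2 * Real.log (s.im / (2 * Real.pi))) + s.im / 2 + Real.pi * Real.sqrt (s.im / (2 * Real.pi)))|
      ≤ 3 * (-s.re) := by
  have hpi := Real.pi_gt_three
  have hpi4 := Real.pi_le_four
  have hT0 : 0 < s.im := by linarith
  have h0 : s ≠ 0 := by intro h; rw [h] at h1; simp at h1
  obtain ⟨a1, a2⟩ := et_pos s h1 hT0.le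
  obtain ⟨l1, l2⟩ := Lim_range s h1 hT0.le
  have hb := et_b s h0
  have hab := et_ab s h0
  have e : (lam s).im = -(s.re * (log (ww s)).im / 2) - s.im * (log (ww s)).re / 2 + s.im / 2 + Real.pi * (et s).re := by
    have : lam s = ((-(1/2) : ℝ) : ℂ) * (s * log (ww s)) + ((1/2 : ℝ) : ℂ) * s + (Real.pi : ℂ) * (I * et s) := by
      unfold lam; push_cast; ring
    rw [this, add_im, add_im, im_ofReal_mul, im_ofReal_mul, im_ofReal_mul, I_mul_im, mul_im]
    ring
  set u := -s.re with hu
  set T := s.im with hTd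
  set a := (et s).im with had
  set b := (et s).re with hbd
  set φ := (log (ww s)).im with hφ
  -- log
  have hn1 : T ≤ ‖s‖ := (le_abs_self _).trans (Complex.abs_im_le_norm s)
  have hn2 : ‖s‖ ≤ T + u := by
    have := Complex.norm_le_abs_re_add_abs_im s
    rw [abs_of_neg h1, abs_of_pos hT0] at this
    linarith
  have hL : (log (ww s)).re = Real.log (‖s‖ / (2 * Real.pi)) := by rw [log_re, norm_ww]
  have hL1 : Real.log (T / (2 * Real.pi)) ≤ (log (ww s)).re := by
    rw [hL]; apply Real.log_le_log (by positivity); gcongr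
  have hL2 : T * (log (ww s)).re - T * Real.log (T / (2 * Real.pi)) ≤ u := by
    rw [hL, ← mul_sub, ← Real.log_div (by positivity) (by positivity)]
    have e2 : ‖s‖ / (2 * Real.pi) / (T / (2 * Real.pi)) = ‖s‖ / T := by field_simp
    rw [e2]
    have h3 := Real.log_le_sub_one_of_pos (show 0 < ‖s‖ / T by positivity)
    calc T * Real.log (‖s‖ / T) ≤ T * (‖s‖ / T - 1) := by gcongr
      _ = ‖s‖ - T := by field_simp
      _ ≤ u := by linarith
  have hL3 : 0 ≤ T * (log (ww s)).re - T * Real.log (T / (2 * Real.pi)) := by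
    rw [← mul_sub]; apply mul_nonneg hT0.le; linarith
  -- sqrt
  set X := T / (2 * Real.pi) with hX
  have hX1 : 1 ≤ X := by rw [hX, le_div_iff₀ (by positivity)]; linarith
  have hs1 : 1 ≤ Real.sqrt X := by rw [Real.one_le_sqrt]; exact hX1
  have hsq : Real.sqrt X ^ 2 = X := Real.sq_sqrt (by linarith)
  have hb1 : Real.sqrt X ≤ b := by
    apply Real.sqrt_le_iff.mpr ⟨by linarith, by nlinarith [sq_nonneg a]⟩
  have hb2 : b ≤ Real.sqrt X + a := by
    apply le_of_sq_le_sq _ (by linarith)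
    nlinarith [mul_nonneg (by linarith : 0 ≤ Real.sqrt X) a1.le]
  have ha3 : Real.pi * a ≤ u := by
    rw [← hab]
    have : 0 ≤ Real.pi * a := by positivity
    nlinarith
  have hp1 : 0 ≤ Real.pi * b - Real.pi * Real.sqrt X := by
    rw [← mul_sub]; apply mul_nonneg (by linarith); linarith
  have hp2 : Real.pi * b - Real.pi * Real.sqrt X ≤ Real.pi * a := by
    rw [← mul_sub]; apply mul_le_mul_of_nonneg_left _ (by linarith); linarith
  have hu0 : 0 < u := by linarith
  have f1 : 0 ≤ u * φ := by positivity
  have f2 : u * φ ≤ u * 2 := by gcongr; linarith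
  have f3 : s.re * φ = -(u * φ) := by rw [hu]; ring
  rw [e, f3, abs_le]
  constructor <;> linarith

theorem norm_fR_et (s : ℂ) (h1 : s.re < 0) (h2 : 0 ≤ s.im) : 
    Real.exp (-s.re * (Real.log ‖et s‖ - 1 / 2)) ≤ ‖fR (S (et s)) (et s)‖ ∧
    ‖fR (S (et s)) (et s)‖ ≤ Real.exp (-s.re * Real.log ‖et s‖) := by
  have hpi := Real.pi_pos
  have h0 : s ≠ 0 := by intro h; rw [h] at h1; simp at h1
  obtain ⟨a1, a2⟩ := et_pos s h1 h2
  obtain ⟨l1, l2⟩ := Lim_range s h1 h2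
  have hη : et s ≠ 0 := by intro h; rw [h] at a1; simp at a1
  have hr : (log (et s)).re = Real.log ‖et s‖ := log_re _
  have hpi' : (Real.pi : ℂ) ≠ 0 := by exact_mod_cast Real.pi_ne_zero
  rw [fR_eta _ hη, S_et s h0, et_sq s h0, Complex.norm_exp]
  have e : Real.pi * I * ww s = s / 2 := by
    unfold ww; field_simp; linear_combination (-1) * I_sq
  have e2 : (-s * log (et s) + Real.pi * I * ww s).re = -s.re * Real.log ‖et s‖ + s.im * (log (et s)).im + s.re / 2 := by
    rw [e, add_re, mul_re, ← hr]; simp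
  rw [e2]
  have hi : (log (et s)).im = (log (ww s)).im / 2 := by rw [log_et s h1 h2]; simp
  rw [hi]
  have h3 : s.im * (log (ww s)).im ≤ -s.re := by
    rcases h2.eq_or_lt with h | h
    · rw [← h]; linarith
    · have hre : 0 < (ww s).re := by rw [ww_re]; positivity
      have h4 : (log (ww s)).im < Real.pi / 2 := by
        rw [log_im]
        exact lt_of_abs_lt (abs_arg_lt_pi_div_two_iff.mpr (Or.inl hre))
      have h5 := Real.le_tan l1.le h4
      have h6 : Real.tan (log (ww s)).im = -s.re / s.im := by
        rw [log_im, tan_arg, ww_re, ww_im]; field_simp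
      rw [h6, le_div_iff₀ h] at h5
      linarith
  have h7 : 0 ≤ s.im * (log (ww s)).im := by positivity
  constructor <;> apply Real.exp_le_exp.mpr <;> linarith

theorem one_sub_exp_le (s : ℂ) (h2 : 0 ≤ s.im) : ‖1 - exp (Real.pi * I * s)‖ ≤ 2 := by
  refine (norm_sub_le _ _).trans ?_
  rw [norm_one, norm_qh]
  have : Real.exp (-(Real.pi * s.im)) ≤ 1 := by
    rw [Real.exp_le_one_iff]; have := mul_nonneg Real.pi_pos.le h2; linarith
  linarith

theorem R_left_upper (s : ℂ) (h1 : s.re ≤ -2) (h2 : 0 ≤ s.im) :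
    ‖RiemannR s‖ ≤ 4 * EA * (‖et s‖ * (1 + 7 * ‖et s‖)) * Real.exp (-s.re * Real.log ‖et s‖) := by
  have hpi := Real.pi_gt_three
  have hpi4 := Real.pi_lt_d2
  have hEA := EA_nonneg
  have hs : s.re < 0 := by linarith
  have h0 : s ≠ 0 := by intro h; rw [h] at hs; simp at hs
  obtain ⟨a1, a2⟩ := et_pos s hs h2
  have hS := S_et s h0
  have hx := R_expand (et s) a1 a2 (by rw [hS]; exact h1) 0
  have hT := TT_bound (et s) a1 a2 (by rw [hS]; exact h1) 0
  have hf := (norm_fR_et s hs h2).2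
  have hlow := et_im_low s hs h2
  rw [hS] at hx hT hf
  simp only [Finset.range_zero, Finset.sum_empty, zero_add] at hx
  rw [hx, norm_mul]
  set r := ‖et s‖
  have hr0 : 0 ≤ r := norm_nonneg _
  have ha : 1 / (et s).im ≤ 7 * r := by
    rw [div_le_iff₀ a1]
    nlinarith [mul_nonneg hr0 a1.le]
  have he : Real.exp (-(Real.pi * ((0:ℕ):ℝ) * (et s).im)) + Real.exp ((s.re + 2) / 6) ≤ 2 := by
    have : Real.exp ((s.re + 2) / 6) ≤ 1 := by rw [Real.exp_le_one_iff]; linarith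
    simp only [Nat.cast_zero, mul_zero, zero_mul, neg_zero, Real.exp_zero]; linarith
  calc _ ≤ 2 * (EA * (r * Real.exp (-s.re * Real.log r) * (1 + 7 * r) * 2)) := by
        apply mul_le_mul (one_sub_exp_le s h2) _ (norm_nonneg _) (by norm_num)
        refine hT.trans ?_
        gcongr
    _ = _ := by ring

theorem R_left_lower (s : ℂ) (h1 : s.re < 0) (h2 : 1 ≤ s.im) (hr : Real.exp 1 ≤ ‖et s‖)
    (ha : 1 ≤ (et s).im ^ 5 * ‖et s‖) (h : ‖RiemannR s - EMM s‖ ≤ (1 / 2) * ‖EMM s‖) :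
    Real.exp s.re / (23 * ‖et s‖) ≤ ‖RiemannR s‖ := by
  have hpi := Real.pi_gt_three
  have hs2 : 0 ≤ s.im := by linarith
  have h0 : s ≠ 0 := by intro h; rw [h] at h1; simp at h1
  obtain ⟨a1, a2⟩ := et_pos s h1 hs2
  have hab := et_ab s h0
  have hM := MM_low (et s) a1
  have hp := p_low (et s).im a1
  have hf := (norm_fR_et s h1 hs2).1
  have hrE : ‖EMM s‖ / 2 ≤ ‖RiemannR s‖ := by
    have := norm_sub_norm_le (EMM s) (RiemannR s)
    rw [norm_sub_rev] at this
    linarith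
  refine le_trans ?_ hrE
  unfold EMM
  rw [norm_mul]
  set r := ‖et s‖ with hrd
  have he1 : 1 ≤ Real.exp 1 := Real.one_le_exp (by norm_num)
  have hr1 : 1 ≤ r := he1.trans hr
  have hlr : 1 ≤ Real.log r := by rw [Real.le_log_iff_exp_le (by linarith)]; exact hr
  have hF1 : 1 ≤ ‖fR (S (et s)) (et s)‖ := by
    refine le_trans (Real.one_le_exp ?_) hf
    apply mul_nonneg <;> linarith
  have hmin : 1 / r ≤ min (et s).im 1 := by
    apply le_min
    · rcases le_total (et s).im 1 with h4 | h4
      · rw [div_le_iff₀ (by linarith)]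
        have : (et s).im ^ 5 ≤ (et s).im := by
          calc (et s).im ^ 5 ≤ (et s).im ^ 1 := pow_le_pow_of_le_one a1.le h4 (by norm_num)
            _ = _ := pow_one _
        nlinarith
      · refine le_trans ?_ h4
        rw [div_le_one (by linarith)]; exact hr1
    · rw [div_le_one (by linarith)]; exact hr1
  have hb : 1 / 2 ≤ (et s).re := by
    have h5 := Complex.norm_le_abs_re_add_abs_im (et s)
    rw [abs_of_pos a1, abs_of_pos (lt_of_lt_of_le a1 a2)] at h5
    linarith
  have hea : Real.exp s.re ≤ Real.exp (-(Real.pi * (et s).im)) := by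
    apply Real.exp_le_exp.mpr
    have : 0 ≤ Real.pi * (et s).im := by positivity
    nlinarith
  have hone : 1 / 2 ≤ ‖1 - exp (Real.pi * I * s)‖ := by
    have h6 := norm_sub_norm_le (1:ℂ) (exp (Real.pi * I * s))
    rw [norm_one, norm_qh] at h6
    have h7 : Real.exp (-(Real.pi * s.im)) ≤ 1 / 2 := by
      rw [Real.exp_neg, ← one_div]
      apply one_div_le_one_div_of_le (by norm_num)
      have := Real.add_one_le_exp (Real.pi * s.im)
      nlinarith
    linarith
  have hMl : 7 / 20 * (1 * Real.exp s.re) * (1 / r / 2) ≤ ‖MM (et s)‖ := by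
    refine le_trans ?_ hM
    gcongr
    linarith
  calc Real.exp s.re / (23 * r) = (1/23) * (Real.exp s.re / r) := by field_simp
    _ ≤ (7 / 160) * (Real.exp s.re / r) := mul_le_mul_of_nonneg_right (by norm_num) (by positivity)
    _ = (1 / 2) * (7 / 20 * (1 * Real.exp s.re) * (1 / r / 2)) / 2 := by ring
    _ ≤ _ := by gcongr

end RZ

namespace RZ
open Complex Filter Topology Set

/-- the property of the constant `B` from `W_asym` -/
def GoodB (B : ℝ) : Prop := 6 ≤ B ∧ ∀ s : ℂ, WB B s → 1 ≤ ‖et s‖ ∧ 1 ≤ (et s).im ^ 5 * ‖et s‖ ∧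
    ‖RiemannR s - EMM s‖ ≤ (1 / 2) * ‖EMM s‖

theorem exists_goodB : ∃ B, GoodB B := by
  obtain ⟨B, h⟩ := W_asym
  exact ⟨B, h⟩

theorem top_upper : ∃ K2 ≥ (1:ℝ), ∃ T1 ≥ (3:ℝ), ∀ T U : ℝ, T1 ≤ T → 6 ≤ U → 16 * (U + 3) ≤ T →
    ∀ z ∈ Metric.closedBall ((-U : ℝ) + (T : ℝ) * I : ℂ) (8 * (U + 3)),
      ‖RiemannR z‖ ≤ K2 * Real.exp (15 * U * Real.log T) := by
  obtain ⟨K, hK, t0, ht0, hP⟩ := R_poly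
  have hEA := EA_nonneg
  have hpi := Real.pi_gt_three
  refine ⟨256 * K + 32 * EA + 1, by linarith, 2 * t0 + 3, by linarith, ?_⟩
  intro T U hT hU hUT z hz
  have hT3 : 3 ≤ T := by linarith
  have hT0 : 0 < T := by linarith
  rw [Metric.mem_closedBall, dist_eq_norm] at hz
  have hre := (Complex.abs_re_le_norm _).trans hz
  have him := (Complex.abs_im_le_norm _).trans hz
  simp at hre him
  rw [abs_le] at hre him
  have hlog : 1 ≤ Real.log T := by
    rw [Real.le_log_iff_exp_le hT0]
    linarith [Real.exp_one_lt_three]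
  have him0 : T / 2 ≤ z.im := by linarith [him.1]
  have him1 : z.im ≤ 2 * T := by linarith [him.2]
  have hexp : ∀ k : ℝ, k ≤ 15 * U → Real.exp (k * Real.log T) ≤ Real.exp (15 * U * Real.log T) := by
    intro k hk
    apply Real.exp_le_exp.mpr; gcongr
  have hpow : ∀ k : ℕ, T ^ k = Real.exp (k * Real.log T) := by
    intro k
    rw [Real.exp_nat_mul, Real.exp_log hT0]
  rcases le_total (-7) z.re with h | h
  · refine (hP z h (by linarith)).trans ?_
    calc K * z.im ^ 8 ≤ K * (2 * T) ^ 8 := by gcongr; linarith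
      _ = 256 * K * T ^ 8 := by ring
      _ ≤ (256 * K + 32 * EA + 1) * Real.exp (15 * U * Real.log T) := by
          rw [hpow 8]
          apply mul_le_mul (by linarith) (hexp _ (by push_cast; linarith)) (Real.exp_pos _).le (by linarith)
  · have hz0 : z ≠ 0 := by intro h0; rw [h0] at h; simp at h; linarith
    refine (R_left_upper z (by linarith) (by linarith)).trans ?_
    have hr2 := norm_et_sq z hz0
    have hn : ‖z‖ ≤ 3 * T := by
      have := Complex.norm_le_abs_re_add_abs_im z
      rw [abs_of_neg (by linarith), abs_of_pos (by linarith)] at this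
      linarith [hre.1]
    have hr0 : 0 ≤ ‖et z‖ := norm_nonneg _
    have hrT : ‖et z‖ ≤ T := by
      apply le_of_sq_le_sq _ hT0.le
      rw [hr2, div_le_iff₀ (by positivity)]
      nlinarith
    have hrp : 0 < ‖et z‖ := by
      rw [norm_pos_iff]; unfold et; exact Complex.exp_ne_zero _
    have hE : Real.exp (-z.re * Real.log ‖et z‖) ≤ Real.exp ((9 * U + 24) * Real.log T) := by
      apply Real.exp_le_exp.mpr
      calc -z.re * Real.log ‖et z‖ ≤ -z.re * Real.log T := by
            apply mul_le_mul_of_nonneg_left (Real.log_le_log hrp hrT) (by linarith)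
        _ ≤ _ := by
            apply mul_le_mul_of_nonneg_right _ (by linarith)
            linarith [hre.1]
    calc _ ≤ 4 * EA * (T * (1 + 7 * T)) * Real.exp ((9 * U + 24) * Real.log T) := by gcongr
      _ ≤ 4 * EA * (T * (T + 7 * T)) * Real.exp ((9 * U + 24) * Real.log T) := by
          gcongr; linarith
      _ = 32 * EA * (Real.exp ((2:ℕ) * Real.log T) * Real.exp ((9 * U + 24) * Real.log T)) := by
          rw [← hpow 2]; ring
      _ = 32 * EA * Real.exp ((9 * U + 26) * Real.log T) := by
          rw [← Real.exp_add]; congr 2; push_cast; ring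
      _ ≤ _ := by
          apply mul_le_mul (by linarith) (hexp _ (by linarith)) (Real.exp_pos _).le (by linarith)

theorem top_bound (B : ℝ) (hB : GoodB B) (m : ℂ → ℕ) (hm : ∀ ρ, RiemannR ρ = 0 → MultAt RiemannR ρ (m ρ)) :
    ∃ C > (0:ℝ), ∃ T1 ≥ (3:ℝ), ∀ T U : ℝ, T1 ≤ T → 6 ≤ U → 16 * (U + 3) ≤ T →
    WB B ((-U : ℝ) + (T : ℝ) * I) → (∀ z, RiemannR z = 0 → z.im ≠ T) →
    |(∫ x : ℝ in (-U)..3, logDeriv RiemannR (x + T * I)).im| ≤ C * U * Real.log T := by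
  obtain ⟨K2, hK2, T1, hT1, H⟩ := top_upper
  have hpi := Real.pi_gt_three
  have hpi4 := Real.pi_le_four
  refine ⟨6 * (Real.log K2 + 15 + 1 + Real.log 23 + 1 + 1), ?_, T1 + 200, by linarith, ?_⟩
  · have := Real.log_nonneg hK2
    have := Real.log_nonneg (show (1:ℝ) ≤ 23 by norm_num)
    positivity
  intro T U hT hU hUT hW hz
  set c : ℂ := (-U : ℝ) + (T : ℝ) * I with hc
  have cre : c.re = -U := by simp [hc]
  have cim : c.im = T := by simp [hc]
  have hT0 : 0 < T := by linarith
  obtain ⟨w1, w2, w3⟩ := hB.2 c hW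
  have hc0 : c ≠ 0 := by intro h; rw [h] at cim; simp at cim; linarith
  have hr2 := norm_et_sq c hc0
  have hn1 : T ≤ ‖c‖ := by rw [← cim]; exact (le_abs_self _).trans (Complex.abs_im_le_norm c)
  have hn2 : ‖c‖ ≤ 2 * T := by
    have := Complex.norm_le_abs_re_add_abs_im c
    rw [cre, cim, abs_of_neg (by linarith), abs_of_pos hT0] at this
    linarith
  have hr3 : Real.exp 1 ≤ ‖et c‖ := by
    have h3 := Real.exp_one_lt_three
    have : (3:ℝ) ≤ ‖et c‖ := by
      apply le_of_sq_le_sq _ (norm_nonneg _)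
      rw [hr2, le_div_iff₀ (by positivity)]
      linarith
    linarith
  have hrT : ‖et c‖ ≤ T := by
    apply le_of_sq_le_sq _ hT0.le
    rw [hr2, div_le_iff₀ (by positivity)]
    nlinarith
  have hl := R_left_lower c (by rw [cre]; linarith) (by rw [cim]; linarith) hr3 w2 w3
  rw [cre] at hl
  have hlow : Real.exp (-U) / (23 * T) ≤ ‖RiemannR c‖ := le_trans (by gcongr) hl
  have hRc : 0 < ‖RiemannR c‖ := lt_of_lt_of_le (by positivity) hlow
  have hloc := local_arg RiemannR R_entire m hm c (norm_pos_iff.mp hRc) (U + 3) (by linarith) _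
    (H T U (by linarith) hU hUT) (by intro z h; rw [cim]; exact hz z h)
  have hlog : 1 ≤ Real.log T := by
    rw [Real.le_log_iff_exp_le hT0]
    linarith [Real.exp_one_lt_three]
  have eint : (∫ x : ℝ in (-U)..3, logDeriv RiemannR (x + T * I)) = ∫ x : ℝ in (0:ℝ)..(U + 3), logDeriv RiemannR (c + x) := by
    have := intervalIntegral.integral_comp_add_right (a := 0) (b := U + 3) (fun x : ℝ => logDeriv RiemannR (x + T * I)) (-U)
    rw [show (0:ℝ) + -U = -U by ring, show U + 3 + -U = 3 by ring] at this
    rw [← this]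
    congr 1; funext x; congr 1; rw [hc]; push_cast; ring
  rw [eint]
  refine hloc.trans ?_
  have hlg : Real.log (K2 * Real.exp (15 * U * Real.log T) / ‖RiemannR c‖) ≤
      Real.log K2 + 15 * U * Real.log T + U + Real.log 23 + Real.log T := by
    rw [Real.log_div (by positivity) hRc.ne', Real.log_mul (by positivity) (Real.exp_pos _).ne', Real.log_exp]
    have h5 := Real.log_le_log (by positivity) hlow
    rw [Real.log_div (Real.exp_pos _).ne' (by positivity), Real.log_exp, Real.log_mul (by norm_num) hT0.ne'] at h5
    linarith
  have hUL : 1 ≤ U * Real.log T := by nlinarith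
  have k1 : Real.log K2 ≤ Real.log K2 * (U * Real.log T) := le_mul_of_one_le_right (Real.log_nonneg hK2) hUL
  have k2 : Real.log 23 ≤ Real.log 23 * (U * Real.log T) := le_mul_of_one_le_right (Real.log_nonneg (by norm_num)) hUL
  have k3 : U ≤ U * Real.log T := le_mul_of_one_le_right (by linarith) hlog
  have k4 : Real.log T ≤ U * Real.log T := le_mul_of_one_le_left (by linarith) (by linarith)
  nlinarith

end RZ

namespace RZ
open Complex Filter Topology Set

theorem deriv_R_cont : Continuous (deriv RiemannR) :=
  (R_entire.contDiff (n := 1)).continuous_deriv (by norm_num)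

theorem ld_contOn (g : ℝ → ℂ) (hg : Continuous g) (s : Set ℝ) (h : ∀ x ∈ s, RiemannR (g x) ≠ 0) :
    ContinuousOn (fun x => logDeriv RiemannR (g x)) s := by
  have : (fun x => logDeriv RiemannR (g x)) = fun x => deriv RiemannR (g x) / RiemannR (g x) := by
    funext x; rw [logDeriv_apply]
  rw [this]
  exact (deriv_R_cont.comp hg).continuousOn.div (R_entire.continuous.comp hg).continuousOn h

theorem ftc_h (G u : ℂ → ℂ) (a b y : ℝ) (hab : a ≤ b) (h : ∀ x ∈ Icc a b, HasDerivAt G (u (x + y * I)) (x + y * I))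
    (hc : ContinuousOn (fun x : ℝ => u (x + y * I)) (Icc a b)) :
    (∫ x : ℝ in a..b, u (x + y * I)) = G (b + y * I) - G (a + y * I) := by
  refine intervalIntegral.integral_eq_sub_of_hasDerivAt (f := fun x : ℝ => G (x + y * I)) ?_ ?_
  · intro x hx
    rw [uIcc_of_le hab] at hx
    have := HasDerivAt.comp (x : ℂ) (h x hx) ((hasDerivAt_id (x : ℂ)).add_const (y * I : ℂ))
    rw [mul_one] at this
    exact this.comp_ofReal
  · apply ContinuousOn.intervalIntegrable
    rw [uIcc_of_le hab]; exact hc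

theorem ftc_v (G u : ℂ → ℂ) (a b x : ℝ) (hab : a ≤ b) (h : ∀ y ∈ Icc a b, HasDerivAt G (u (x + y * I)) (x + y * I))
    (hc : ContinuousOn (fun y : ℝ => u (x + y * I)) (Icc a b)) :
    I • (∫ y : ℝ in a..b, u (x + y * I)) = G (x + b * I) - G (x + a * I) := by
  rw [smul_eq_mul, ← intervalIntegral.integral_const_mul]
  refine intervalIntegral.integral_eq_sub_of_hasDerivAt (f := fun y : ℝ => G (x + y * I)) ?_ ?_
  · intro y hy
    rw [uIcc_of_le hab] at hy
    have := HasDerivAt.comp (y : ℂ) (h y hy) (((hasDerivAt_id (y : ℂ)).mul_const I).const_add (x : ℂ))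
    have h2 := this.comp_ofReal
    refine h2.congr_deriv ?_
    ring
  · apply ContinuousOn.intervalIntegrable
    rw [uIcc_of_le hab]; exact continuousOn_const.mul hc

theorem R_slit (s : ℂ) (h : ‖RiemannR s - 1‖ ≤ 3 / 4) : RiemannR s ∈ slitPlane := by
  have := slit1 (RiemannR s - 1) (by linarith)
  rwa [add_sub_cancel] at this

theorem count_rect (B : ℝ) (hB : GoodB B) (m : ℂ → ℕ) (hm : ∀ ρ, RiemannR ρ = 0 → MultAt RiemannR ρ (m ρ))
    (tR : ℝ) (htR1 : 1 ≤ tR) (htR : ∀ s : ℂ, 3 ≤ s.re → tR ≤ s.im → ‖RiemannR s - 1‖ ≤ 3 / 4)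
    (t0 : ℝ) (ht0 : tR ≤ t0) (hz0 : ∀ z, RiemannR z = 0 → z.im ≠ t0)
    (B' : ℝ) (hB' : B ≤ B') (hB5 : B * t0 ^ 2 ≤ B' ^ 5) :
    ∃ C > (0:ℝ), ∃ T2 ≥ (3:ℝ), ∀ T U : ℝ, T2 ≤ T → B' ≤ U → 16 * (U + 3) ≤ T → B * T ^ 2 ≤ U ^ 5 →
    (∀ z, RiemannR z = 0 → z.im ≠ T) → ∀ Z : Finset ℂ,
    (∀ ρ, ρ ∈ Z ↔ RiemannR ρ = 0 ∧ -U < ρ.re ∧ ρ.re < 3 ∧ t0 < ρ.im ∧ ρ.im < T) →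
    |2 * Real.pi * ∑ ρ ∈ Z, (m ρ : ℝ) - (T / 2 * Real.log (T / (2 * Real.pi)) - T / 2 -
      Real.pi * Real.sqrt (T / (2 * Real.pi)))| ≤ C * U * Real.log T := by
  obtain ⟨C1, hC1, T1, hT1, htop⟩ := top_bound B hB m hm
  have hpi := Real.pi_gt_three
  have hpi4 := Real.pi_lt_d2
  have hB6 := hB.1
  set p0 : ℂ := ((-B' : ℝ) : ℂ) + t0 * I with hp0
  set Q : ℂ := ∫ x : ℝ in (-B')..3, logDeriv RiemannR (x + t0 * I) with hQ
  refine ⟨|(GLg p0).im| + |Q.im| + C1 + 22, by positivity, max T1 (t0 + 7), le_max_of_le_left hT1, ?_⟩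
  intro T U hT hU hUT hU5 hzT Z hZ
  have hTT1 : T1 ≤ T := (le_max_left _ _).trans hT
  have hTt0 : t0 + 7 ≤ T := (le_max_right _ _).trans hT
  have hT0 : 0 < T := by linarith
  have hBp : 0 ≤ B := by linarith
  -- W membership
  have W1 : ∀ y ∈ Icc t0 T, WB B (((-U : ℝ) : ℂ) + y * I) := by
    intro y hy
    refine ⟨by simp; linarith, by simp; linarith [hy.1], ?_⟩
    have : B * y ^ 2 ≤ B * T ^ 2 := by gcongr <;> linarith [hy.1, hy.2]
    simp; linarith
  have W2 : ∀ x ∈ Icc (-U) (-B'), WB B ((x : ℂ) + t0 * I) := by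
    intro x hx
    refine ⟨by simp; linarith [hx.2], by simp; linarith, ?_⟩
    have : B' ^ 5 ≤ (-x) ^ 5 := by gcongr <;> linarith [hx.2]
    simp; linarith
  have D1 : ∀ y ∈ Icc t0 T, _ := fun y hy => GLg_deriv (((-U : ℝ) : ℂ) + y * I) (by simp; linarith)
    (by simp; linarith [hy.1]) (hB.2 _ (W1 y hy)).2.2
  have D2 : ∀ x ∈ Icc (-U) (-B'), _ := fun x hx => GLg_deriv ((x : ℂ) + t0 * I) (by simp; linarith [hx.2])
    (by simp; linarith) (hB.2 _ (W2 x hx)).2.2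
  have D3 : ∀ y ∈ Icc t0 T, RiemannR (((3:ℝ):ℂ) + y * I) ∈ slitPlane := fun y hy =>
    R_slit _ (htR _ (by simp) (by simp; linarith [hy.1]))
  have Nb : ∀ x : ℝ, RiemannR (x + t0 * I) ≠ 0 := fun x h => hz0 _ h (by simp)
  have Nt : ∀ x : ℝ, RiemannR (x + T * I) ≠ 0 := fun x h => hzT _ h (by simp)
  have gh : ∀ y : ℝ, Continuous fun x : ℝ => (x : ℂ) + y * I := fun y => by fun_prop
  have gv : ∀ x : ℝ, Continuous fun y : ℝ => (x : ℂ) + y * I := fun x => by fun_prop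
  have harg := arg_principle RiemannR R_entire m (-U) 3 t0 T (by linarith) (by linarith) Z hZ
    (fun ρ hρ => hm ρ ((hZ ρ).1 hρ).1) (by
      intro x y hx1 hx2 hy1 hy2 h
      rcases h with h | h | h | h
      · rw [h]; exact (D1 y ⟨hy1, hy2⟩).1
      · rw [h]; exact slitPlane_ne_zero (D3 y ⟨hy1, hy2⟩)
      · rw [h]; exact Nb x
      · rw [h]; exact Nt x)
  have I1 : (∫ x : ℝ in (-U)..3, logDeriv RiemannR (x + t0 * I)) =
      (GLg p0 - GLg (((-U : ℝ) : ℂ) + t0 * I)) + Q := by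
    have hcont : Continuous fun x : ℝ => logDeriv RiemannR (x + t0 * I) := by
      rw [← continuousOn_univ]; exact ld_contOn _ (gh t0) _ (fun x _ => Nb x)
    rw [← intervalIntegral.integral_add_adjacent_intervals (hcont.intervalIntegrable _ (-B')) (hcont.intervalIntegrable _ _)]
    rw [ftc_h GLg (logDeriv RiemannR) (-U) (-B') t0 (by linarith) (fun x hx => (D2 x hx).2.1) hcont.continuousOn]
  have I2 : I • (∫ y : ℝ in t0..T, logDeriv RiemannR (((-U : ℝ) : ℂ) + y * I)) =
      GLg (((-U : ℝ) : ℂ) + T * I) - GLg (((-U : ℝ) : ℂ) + t0 * I) :=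
    ftc_v GLg (logDeriv RiemannR) t0 T (-U) (by linarith) (fun y hy => (D1 y hy).2.1)
      (ld_contOn _ (gv _) _ (fun y hy => (D1 y hy).1))
  have I3 : I • (∫ y : ℝ in t0..T, logDeriv RiemannR (((3 : ℝ) : ℂ) + y * I)) =
      log (RiemannR (((3 : ℝ) : ℂ) + T * I)) - log (RiemannR (((3 : ℝ) : ℂ) + t0 * I)) :=
    ftc_v (fun z => log (RiemannR z)) (logDeriv RiemannR) t0 T 3 (by linarith) (fun y hy => by
      rw [logDeriv_apply]
      exact (R_entire _).hasDerivAt.clog (D3 y hy))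
      (ld_contOn _ (gv _) _ (fun y hy => slitPlane_ne_zero (D3 y hy)))
  unfold rectInt at harg
  rw [I1, I2, I3] at harg
  have htp := htop T U hTT1 (by linarith) hUT (W1 T ⟨by linarith, le_rfl⟩) hzT
  have hG := (D1 T ⟨by linarith, le_rfl⟩).2.2
  have hl := lam_im_est (((-U : ℝ) : ℂ) + T * I) (by simp; linarith) (by simp; linarith)
  simp only [add_im, sub_im, log_im] at harg
  have cim : (((-U : ℝ) : ℂ) + T * I).im = T := by simp
  have cre : (((-U : ℝ) : ℂ) + T * I).re = -U := by simp
  rw [cim, cre] at hl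
  have a1 := abs_le.mp (abs_arg_le_pi (RiemannR (((3 : ℝ) : ℂ) + T * I)))
  have a2 := abs_le.mp (abs_arg_le_pi (RiemannR (((3 : ℝ) : ℂ) + t0 * I)))
  have hlog : 1 ≤ Real.log T := by
    rw [Real.le_log_iff_exp_le hT0]
    linarith [Real.exp_one_lt_three]
  have k3 : U ≤ U * Real.log T := le_mul_of_one_le_right (by linarith) hlog
  have hUL : 1 ≤ U * Real.log T := by linarith
  have k1 : |(GLg p0).im| ≤ |(GLg p0).im| * (U * Real.log T) := le_mul_of_one_le_right (abs_nonneg _) hUL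
  have k2 : |Q.im| ≤ |Q.im| * (U * Real.log T) := le_mul_of_one_le_right (abs_nonneg _) hUL
  have e1 := abs_le.mp (le_refl |(GLg p0).im|)
  have e2 := abs_le.mp (le_refl |Q.im|)
  rw [abs_le] at htp hG hl
  rw [← harg, abs_le]
  constructor <;> linarith [a1.1, a1.2, a2.1, a2.2, htp.1, htp.2, hG.1, hG.2, hl.1, hl.2, e1.1, e1.2, e2.1, e2.2]

end RZ

namespace RZ
open Complex Filter Topology Set

theorem W_ne (B : ℝ) (hB : GoodB B) (s : ℂ) (h : WB B s) (hs : 0 < s.im) : RiemannR s ≠ 0 :=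
  (GLg_deriv s (by linarith [h.1, hB.1]) hs (hB.2 s h).2.2).1

theorem Z_fin (B : ℝ) (hB : GoodB B) (τ : ℝ) (hτ : 0 ≤ τ) : {ρ : ℂ | RiemannR ρ = 0 ∧ 0 < ρ.im ∧ ρ.im ≤ τ}.Finite := by
  obtain ⟨σ1, h1⟩ := R_right_bdd τ
  have hB6 := hB.1
  set U := B + B * τ ^ 2 + 1 with hU
  have hBt : 0 ≤ B * τ ^ 2 := by have : 0 ≤ B := by linarith
                                 positivity
  have hc : RiemannR (σ1 : ℂ) ≠ 0 := slitPlane_ne_zero (R_slit _ (h1 _ (by simp) (by simp) (by simpa using hτ)))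
  have hfin := finite_zeros RiemannR R_entire _ hc (Icc (-U) σ1 ×ℂ Icc 0 τ) (isCompact_Icc.reProdIm isCompact_Icc)
  refine hfin.subset ?_
  rintro ρ ⟨hR, h2, h3⟩
  refine ⟨?_, hR⟩
  rw [Complex.mem_reProdIm]
  refine ⟨⟨?_, ?_⟩, h2.le, h3⟩
  · by_contra hlt
    push Not at hlt
    refine W_ne B hB ρ ⟨by linarith, h2.le, ?_⟩ h2 hR
    have u1 : 1 ≤ -ρ.re := by linarith
    calc B * ρ.im ^ 2 ≤ B * τ ^ 2 := by have : 0 ≤ B := by linarith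
                                        gcongr
      _ ≤ -ρ.re := by linarith
      _ = (-ρ.re) ^ 1 := (pow_one _).symm
      _ ≤ (-ρ.re) ^ 5 := pow_le_pow_right₀ u1 (by norm_num)
  · by_contra hlt
    push Not at hlt
    exact slitPlane_ne_zero (R_slit _ (h1 _ hlt.le h2.le h3)) hR

noncomputable def FF (T : ℝ) : ℝ := T / (4 * Real.pi) * Real.log (T / (2 * Real.pi)) - T / (4 * Real.pi) -
  (1 / 2) * Real.sqrt (T / (2 * Real.pi))

theorem FF_cont (T : ℝ) (hT : 0 < T) : ContinuousAt FF T := by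
  unfold FF
  have hpi := Real.pi_pos
  have h : ContinuousAt (fun T : ℝ => Real.log (T / (2 * Real.pi))) T :=
    ContinuousAt.log (by fun_prop) (by positivity)
  have h2 : ContinuousAt (fun T : ℝ => Real.sqrt (T / (2 * Real.pi))) T :=
    ContinuousAt.sqrt (by fun_prop)
  exact ((ContinuousAt.mul (by fun_prop) h).sub (by fun_prop)).sub (continuousAt_const.mul h2)

set_option maxHeartbeats 1000000 in
theorem final (m : ℂ → ℕ) (hm : ∀ ρ, RiemannR ρ = 0 → MultAt RiemannR ρ (m ρ)) :
    ∃ C > (0:ℝ), ∃ T₀ > (0:ℝ), ∀ T ≥ T₀,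
    |(∑ᶠ ρ ∈ {ρ : ℂ | RiemannR ρ = 0 ∧ 0 < ρ.im ∧ ρ.im ≤ T}, (m ρ : ℝ)) - FF T| ≤
      C * T ^ ((2:ℝ) / 5) * (Real.log T) ^ 2 := by
  classical
  obtain ⟨B, hB⟩ := exists_goodB
  have hB6 := hB.1
  have hpi := Real.pi_gt_three
  obtain ⟨tR, htR1, htR⟩ := R_right
  -- choose t0
  obtain ⟨t0, ht0m, ht0⟩ : ∃ t ∈ Ioo tR (tR + 1), t ∉ Complex.im '' {ρ : ℂ | RiemannR ρ = 0 ∧ 0 < ρ.im ∧ ρ.im ≤ tR + 1} :=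
    (Ioo_infinite (by linarith)).exists_notMem_finite ((Z_fin B hB (tR + 1) (by linarith)).image _)
  have hz0 : ∀ z, RiemannR z = 0 → z.im ≠ t0 := by
    intro z hz h
    exact ht0 ⟨z, ⟨hz, by rw [h]; linarith [ht0m.1], by rw [h]; exact ht0m.2.le⟩, h⟩
  have ht01 : 1 ≤ t0 := by linarith [ht0m.1]
  have hBt : 0 ≤ B * t0 ^ 2 := by have : 0 ≤ B := by linarith
                                  positivity
  set B' := B + B * t0 ^ 2 with hB'
  have hB5 : B * t0 ^ 2 ≤ B' ^ 5 := by
    calc B * t0 ^ 2 ≤ B' ^ 1 := by rw [pow_one]; linarith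
      _ ≤ B' ^ 5 := pow_le_pow_right₀ (by linarith) (by norm_num)
  obtain ⟨C, hC, T2, hT2, H⟩ := count_rect B hB m hm tR htR1 htR t0 ht0m.1.le hz0 B' (by linarith) hB5
  set N0 : ℝ := ∑ ρ ∈ (Z_fin B hB t0 (by linarith)).toFinset, (m ρ : ℝ) with hN0
  have hN0n : 0 ≤ N0 := Finset.sum_nonneg fun _ _ => Nat.cast_nonneg _
  set C3 := B' + 2 * B with hC3
  have hlim := (tendsto_rpow_atTop (show (0:ℝ) < 3 / 5 by norm_num)).eventually_ge_atTop (16 * (C3 + 3))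
  obtain ⟨T4, hT4⟩ := eventually_atTop.mp hlim
  refine ⟨N0 + 1 + 2 * C * C3, by positivity, max (max T2 T4) (t0 + 3), by positivity, ?_⟩
  intro T hT
  have h1 : T2 ≤ T := (le_max_left _ _).trans ((le_max_left _ _).trans hT)
  have h2 : T4 ≤ T := (le_max_right _ _).trans ((le_max_left _ _).trans hT)
  have h3 : t0 + 3 ≤ T := (le_max_right _ _).trans hT
  have hT3 : 4 ≤ T := by linarith
  have hT0 : 0 < T := by linarith
  -- U
  set P := T ^ ((2:ℝ) / 5) with hP
  have hP1 : 1 ≤ P := Real.one_le_rpow (by linarith) (by norm_num)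
  have hP5 : P ^ 5 = T ^ 2 := by
    rw [hP, ← Real.rpow_natCast, ← Real.rpow_mul hT0.le, ← Real.rpow_natCast]; norm_num
  set U := C3 * P with hU
  have hC3B : B' ≤ C3 := by linarith
  have hUB : B' ≤ U := hC3B.trans (le_mul_of_one_le_right (by linarith) hP1)
  have hU5 : B * (T + 1) ^ 2 ≤ U ^ 5 := by
    have h5 : (T + 1) ^ 2 ≤ 4 * T ^ 2 := by nlinarith
    have h6 : 4 * B ≤ C3 ^ 5 := by
      calc 4 * B ≤ C3 * C3 := by nlinarith
        _ = C3 ^ 2 := by ring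
        _ ≤ C3 ^ 5 := pow_le_pow_right₀ (by linarith) (by norm_num)
    calc B * (T + 1) ^ 2 ≤ B * (4 * T ^ 2) := by gcongr
      _ = (4 * B) * T ^ 2 := by ring
      _ ≤ C3 ^ 5 * T ^ 2 := by gcongr
      _ = U ^ 5 := by rw [hU, mul_pow, hP5]
  have hUT : 16 * (U + 3) ≤ T := by
    have e : T = P * T ^ ((3:ℝ) / 5) := by
      rw [hP, ← Real.rpow_add hT0]; norm_num
    have h7 := hT4 T h2
    calc 16 * (U + 3) ≤ 16 * (C3 * P + 3 * P) := by rw [hU]; linarith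
      _ = P * (16 * (C3 + 3)) := by ring
      _ ≤ P * T ^ ((3:ℝ) / 5) := by gcongr
      _ = T := e.symm
  -- choose T'
  have hF1 := Z_fin B hB (T + 1) (by linarith)
  have ev1 : ∀ᶠ t in 𝓝[>] T, ∀ ρ ∈ {ρ : ℂ | RiemannR ρ = 0 ∧ 0 < ρ.im ∧ ρ.im ≤ T + 1}, T < ρ.im → t < ρ.im := by
    rw [Filter.eventually_all_finite hF1]
    intro ρ _
    by_cases h : T < ρ.im
    · filter_upwards [(gt_mem_nhds h).filter_mono nhdsWithin_le_nhds] with t ht _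
      exact ht
    · exact Eventually.of_forall fun t h' => absurd h' h
  have ev2 : ∀ᶠ t in 𝓝[>] T, t < T + 1 := (gt_mem_nhds (by linarith : T < T + 1)).filter_mono nhdsWithin_le_nhds
  have ev3 : ∀ᶠ t in 𝓝[>] T, dist (FF t) (FF T) < 1 :=
    ((FF_cont T hT0).eventually (Metric.ball_mem_nhds _ one_pos)).filter_mono nhdsWithin_le_nhds
  have ev4 : ∀ᶠ t in 𝓝[>] T, T < t := self_mem_nhdsWithin
  obtain ⟨T', q1, q2, q3, q4⟩ := (ev1.and (ev2.and (ev3.and ev4))).exists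
  have hgap : ∀ z, RiemannR z = 0 → T < z.im → T' < z.im := by
    intro z hz hT
    rcases le_or_gt z.im (T + 1) with h | h
    · exact q1 z ⟨hz, by linarith, h⟩ hT
    · linarith
  have hzT : ∀ z, RiemannR z = 0 → z.im ≠ T' := by
    intro z hz h
    have := hgap z hz (by linarith)
    linarith
  have hU5' : ∀ y : ℝ, 0 ≤ y → y ≤ T' → B * y ^ 2 ≤ U ^ 5 := by
    intro y hy0 hy
    refine le_trans ?_ hU5
    have : 0 ≤ B := by linarith
    gcongr; linarith
  have hZT := Z_fin B hB T hT0.le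
  set Z := hZT.toFinset.filter (fun ρ => t0 < ρ.im) with hZ
  have hcount := H T' U (by linarith) hUB (by linarith) (hU5' T' (by linarith) le_rfl) hzT Z (by
    intro ρ
    rw [hZ, Finset.mem_filter, Set.Finite.mem_toFinset]
    constructor
    · rintro ⟨⟨r1, r2, r3⟩, r4⟩
      refine ⟨r1, ?_, ?_, r4, by linarith⟩
      · by_contra hlt
        push Not at hlt
        refine W_ne B hB ρ ⟨by linarith, r2.le, ?_⟩ r2 r1
        refine (hU5' ρ.im r2.le (by linarith)).trans ?_
        have : 0 ≤ U := by linarith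
        gcongr; linarith
      · by_contra hlt
        push Not at hlt
        exact slitPlane_ne_zero (R_slit _ (htR ρ hlt (by linarith [ht0m.1]))) r1
    · rintro ⟨r1, r2, r3, r4, r5⟩
      refine ⟨⟨r1, by linarith, ?_⟩, r4⟩
      by_contra hlt
      push Not at hlt
      have := hgap ρ r1 hlt
      linarith)
  have hsum : (∑ᶠ ρ ∈ {ρ : ℂ | RiemannR ρ = 0 ∧ 0 < ρ.im ∧ ρ.im ≤ T}, (m ρ : ℝ)) = ∑ ρ ∈ Z, (m ρ : ℝ) + N0 := by
    rw [finsum_mem_eq_finite_toFinset_sum _ hZT, ← Finset.sum_filter_add_sum_filter_not _ (fun ρ : ℂ => t0 < ρ.im)]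
    congr 1
    rw [hN0]
    apply Finset.sum_congr _ (fun _ _ => rfl)
    ext ρ
    simp only [Finset.mem_filter, Set.Finite.mem_toFinset, mem_ofPred_eq, not_lt]
    constructor
    · rintro ⟨⟨r1, r2, r3⟩, r4⟩; exact ⟨r1, r2, r4⟩
    · rintro ⟨r1, r2, r4⟩; exact ⟨⟨r1, r2, by linarith⟩, r4⟩
  rw [hsum]
  set N1 := ∑ ρ ∈ Z, (m ρ : ℝ) with hN1
  have hFF : T' / 2 * Real.log (T' / (2 * Real.pi)) - T' / 2 - Real.pi * Real.sqrt (T' / (2 * Real.pi)) = 2 * Real.pi * FF T' := by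
    unfold FF; field_simp; ring
  rw [hFF, ← mul_sub, abs_mul, abs_of_pos (by positivity : 0 < 2 * Real.pi)] at hcount
  have hc2 : |N1 - FF T'| ≤ C * U * Real.log T' := by
    nlinarith [abs_nonneg (N1 - FF T')]
  have hlog : 1 ≤ Real.log T := by
    rw [Real.le_log_iff_exp_le hT0]
    linarith [Real.exp_one_lt_three]
  have hlT : Real.log T' ≤ 2 * Real.log T := by
    have : Real.log T' ≤ Real.log (T ^ 2) := Real.log_le_log (by linarith) (by nlinarith)
    rw [Real.log_pow] at this
    exact_mod_cast this
  have hU0 : 0 ≤ U := by linarith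
  have hL2 : Real.log T ≤ (Real.log T) ^ 2 := by nlinarith
  have hc3 : C * U * Real.log T' ≤ 2 * C * C3 * (P * (Real.log T) ^ 2) := by
    calc C * U * Real.log T' ≤ C * U * (2 * (Real.log T) ^ 2) := by
          apply mul_le_mul_of_nonneg_left (by linarith) (by positivity)
      _ = _ := by rw [hU]; ring
  have hPL : 1 ≤ P * (Real.log T) ^ 2 := by nlinarith
  rw [Real.dist_eq] at q3
  have k1 : N0 + 1 ≤ (N0 + 1) * (P * (Real.log T) ^ 2) := le_mul_of_one_le_right (by linarith) hPL
  have habs : |N1 + N0 - FF T| ≤ |N1 - FF T'| + N0 + |FF T' - FF T| := by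
    have : N1 + N0 - FF T = (N1 - FF T') + N0 + (FF T' - FF T) := by ring
    rw [this]
    refine (abs_add_three _ _ _).trans ?_
    rw [abs_of_nonneg hN0n]
  calc _ ≤ _ := habs
    _ ≤ 2 * C * C3 * (P * (Real.log T) ^ 2) + (N0 + 1) * (P * (Real.log T) ^ 2) := by linarith
    _ = _ := by ring

end RZ

/-- With `m` the multiplicity of each zero of `R` and
`N(T) = ∑_{0 < Im ρ ≤ T} m ρ`, there are `C > 0` and `T₀ > 0` with
`|N(T) − ((T/4π) log (T/2π) − T/4π − (1/2)√(T/2π))| ≤ C T^{2/5} (log T)²`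
for all `T ≥ T₀`. -/
theorem countZerosR_asymptotic_second_term
    (m : ℂ → ℕ)
    (hm : ∀ ρ : ℂ, RiemannR ρ = 0 →
      ∃ g : ℂ → ℂ, AnalyticAt ℂ g ρ ∧ g ρ ≠ 0 ∧
        ∀ᶠ s in nhds ρ, RiemannR s = (s - ρ) ^ (m ρ) * g s) :
    ∃ C > (0 : ℝ), ∃ T₀ > (0 : ℝ), ∀ T ≥ T₀,
      |(∑ᶠ ρ ∈ {ρ : ℂ | RiemannR ρ = 0 ∧ 0 < ρ.im ∧ ρ.im ≤ T}, (m ρ : ℝ)) -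
        (T / (4 * Real.pi) * Real.log (T / (2 * Real.pi)) -
          T / (4 * Real.pi) -
          (1 / 2) * Real.sqrt (T / (2 * Real.pi)))| ≤
        C * T ^ ((2 : ℝ) / 5) * (Real.log T) ^ 2 := by
  exact RZ.final m hm
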